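/- arXiv:math/0606511 — 4 statements merged into one kernel-verified Lean document; each statement's English description precedes it below -/
import Mathlib

section
/- Let P → R be a surjection of graded k-algebras over a field k of positive characteristic p, with P a polynomial ring and R a complete intersection (P modulo an ideal generated by a homogeneous regular sequence), and let M be a finitely generated graded P-module. Suppose the minimal homogeneous generators of Tor_1^P(M, R) have degrees γ_1, …, γ_ℓ. If the minimal homogeneous generators of Tor_1^P(F_P^e(M), R) have degrees q·γ_1, …, q·γ_ℓ (with q = p^e), then Tor_1^R(M ⊗_P R, ^{φ_R^e}R) = 0. -/
set_option synthInstance.maxHeartbeats 1000000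
set_option maxHeartbeats 1000000

open Finset CategoryTheory

section Prelim
variable {k : Type} [Field k] {R : Type} [CommRing R] [Algebra k R]

/-- The irrelevant maximal ideal `m = ⊕_{i>0} R_i` of a graded algebra with pieces `𝒜`. -/
def irrel (𝒜 : ℕ → Submodule k R) : Ideal R :=
  Ideal.span {x : R | ∃ i, 0 < i ∧ x ∈ 𝒜 i}

/-- The degree-zero piece is exactly `k`. -/
def ZeroPieceIsBase (𝒜 : ℕ → Submodule k R) : Prop :=
  ∀ x ∈ 𝒜 0, ∃ c : k, c • (1 : R) = x

/-- The Frobenius power `I^{[q]}`, generated by the `q`-th powers of the elements of `I`. -/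
def frobPow {R : Type} [CommRing R] (I : Ideal R) (q : ℕ) : Ideal R :=
  Ideal.span ((fun x => x ^ q) '' (I : Set R))

/-- The `k`-dimension of the degree-`n` graded piece of the socle `(J : m)/J` of `R/J`. -/
noncomputable def socCount (𝒜 : ℕ → Submodule k R) (J : Ideal R) (n : ℕ) : ℕ :=
  Module.finrank k ((Submodule.restrictScalars k (J.colon (irrel 𝒜)) ⊓ 𝒜 n) : Submodule k R) -
    Module.finrank k ((Submodule.restrictScalars k J ⊓ 𝒜 n) : Submodule k R)

/-- The socle degrees of `R/J` are `d 0 ≤ … ≤ d (ℓ-1)`, as a multiset. -/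
def HasSocleDegrees (𝒜 : ℕ → Submodule k R) (J : Ideal R) {ℓ : ℕ} (d : Fin ℓ → ℕ) : Prop :=
  Monotone d ∧ ∀ n : ℕ, socCount 𝒜 J n = (univ.filter fun i => d i = n).card

/-- The Hilbert series of `R/J`. -/
noncomputable def hilbQ (𝒜 : ℕ → Submodule k R) (J : Ideal R) : PowerSeries ℤ :=
  PowerSeries.mk fun n =>
    (Module.finrank k ((𝒜 n : Submodule k R)) : ℤ) -
      (Module.finrank k ((Submodule.restrictScalars k J ⊓ 𝒜 n) : Submodule k R) : ℤ)

/-- `a` is the `a`-invariant of `R/J`: for a Cohen-Macaulay graded quotient this is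
the degree of the Hilbert series of `R/J` as a rational function, which agrees with the
Goto-Watanabe `a`-invariant defined via graded local cohomology. -/
def IsAInv (𝒜 : ℕ → Submodule k R) (J : Ideal R) (a : ℤ) : Prop :=
  ∃ num den : Polynomial ℤ, den ≠ 0 ∧
    (den : PowerSeries ℤ) * hilbQ 𝒜 J = (num : PowerSeries ℤ) ∧
    a = (num.natDegree : ℤ) - den.natDegree

/-- `R` is F-pure: if `x ∉ J` then `x^q ∉ J^{[q]}` for all `q = p^e`. -/
def IsFPureRing (R : Type) [CommRing R] (p : ℕ) : Prop :=
  ∀ (J : Ideal R) (x : R), x ∉ J → ∀ e : ℕ, x ^ p ^ e ∉ frobPow J (p ^ e)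

/-- A graded `k`-algebra is Cohen-Macaulay iff some homogeneous system of parameters is a
regular sequence. -/
def IsCMGraded (𝒜 : ℕ → Submodule k R) : Prop :=
  ∃ xs : List R, RingTheory.Sequence.IsRegular R xs ∧
    (∀ x ∈ xs, ∃ i, 0 < i ∧ x ∈ 𝒜 i) ∧
    (Ideal.span {x | x ∈ xs}).radical = irrel 𝒜

/-- A graded `k`-algebra is Gorenstein iff some homogeneous system of parameters is a
regular sequence and the (artinian) quotient by it has one-dimensional socle. -/
def IsGorensteinGraded (𝒜 : ℕ → Submodule k R) : Prop :=
  ∃ xs : List R, RingTheory.Sequence.IsRegular R xs ∧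
    (∀ x ∈ xs, ∃ i, 0 < i ∧ x ∈ 𝒜 i) ∧
    (Ideal.span {x | x ∈ xs}).radical = irrel 𝒜 ∧
    ∃ δ : ℕ, socCount 𝒜 (Ideal.span {x | x ∈ xs}) δ = 1 ∧
      ∀ n : ℕ, n ≠ δ → socCount 𝒜 (Ideal.span {x | x ∈ xs}) n = 0

/-- `x 0, …, x (ℓ-1)` is a minimal generating set for the submodule `N`. -/
def IsMinGenSet {R M : Type} [CommRing R] [AddCommGroup M] [Module R M] {ℓ : ℕ}
    (x : Fin ℓ → M) (N : Submodule R M) : Prop :=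
  Submodule.span R (Set.range x) = N ∧ ∀ i, x i ∉ Submodule.span R (x '' {j | j ≠ i})

/-- `Tor_n^R(M, N)`. -/
noncomputable def TorM (R : Type) [CommRing R] (n : ℕ) (M N : ModuleCat R) : ModuleCat R :=
  ((Tor (ModuleCat R) n).obj M).obj N

/-- `R` viewed as a module over itself via the `e`-th iterate of the Frobenius
endomorphism, i.e. `^{φ_R^e}R`. -/
noncomputable def frobMod (R : Type) [CommRing R] (p : ℕ) [ExpChar R p] (e : ℕ) : ModuleCat R :=
  (ModuleCat.restrictScalars (iterateFrobenius R p e)).obj (ModuleCat.of R R)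

/-- `M` has finite projective dimension over the graded algebra `R`: over a Noetherian
graded algebra with `R₀ = k` this is equivalent to the eventual vanishing of
`Tor_n^R(M, R/m)`, `m` the irrelevant maximal ideal. -/
def HasFinProjDim (𝒜 : ℕ → Submodule k R) (M : ModuleCat R) : Prop :=
  ∃ n : ℕ, ∀ m : ℕ, n ≤ m → Subsingleton (TorM R m M (ModuleCat.of R (R ⧸ irrel 𝒜)))

/-- The degree-`n` graded piece of the twisted graded free module `⊕_j R(-b j)`. -/
def freePiece (𝒬 : ℕ → Submodule k R) {m : ℕ} (b : Fin m → ℕ) (n : ℤ) :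
    Submodule k (Fin m → R) :=
  Submodule.pi Set.univ fun j =>
    if 0 ≤ n - (b j : ℤ) then 𝒬 (n - (b j : ℤ)).toNat else ⊥

/-- The data `(r, b, A)` is a minimal homogeneous free resolution of `R/J` of length `c`:
the `i`-th free module is `⊕_{j < r i} R(-b i j)`, and the differentials are given by the
homogeneous matrices `A i`, with entries in the irrelevant maximal ideal (minimality). -/
def IsMinGradedFreeResolution (𝒜 : ℕ → Submodule k R) (J : Ideal R) (c : ℕ)
    (r : ℕ → ℕ) (b : (i : ℕ) → Fin (r i) → ℕ)
    (A : (i : ℕ) → Matrix (Fin (r i)) (Fin (r (i + 1))) R) : Prop :=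
  r 0 = 1 ∧ (∀ j, b 0 j = 0) ∧ (∀ i, c < i → r i = 0) ∧ 0 < r c ∧
    (∀ i j l, A i j l ∈ 𝒜 (b (i + 1) l - b i j) ∧ (b (i + 1) l < b i j → A i j l = 0)) ∧
    (∀ i j l, A i j l ∈ irrel 𝒜) ∧
    (∀ i, Function.Exact (Matrix.mulVecLin (A (i + 1))) (Matrix.mulVecLin (A i))) ∧
    Function.Exact (Matrix.mulVecLin (A 0))
      ((J.mkQ).comp (∑ j : Fin (r 0), LinearMap.proj j))

end Prelim

/-- An ideal of a weighted polynomial ring is homogeneous iff it contains all the weighted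
homogeneous components of its elements. -/
def IsWHomogeneousIdeal {k σ : Type} [Field k] (w : σ → ℕ)
    (I : Ideal (MvPolynomial σ k)) : Prop :=
  ∀ x ∈ I, ∀ n : ℕ, MvPolynomial.weightedHomogeneousComponent w n x ∈ I

/-- Extend an `ℕ`-indexed family of graded pieces to `ℤ` (zero in negative degrees). -/
def extZ {k R : Type} [Field k] [CommRing R] [Algebra k R]
    (𝒜 : ℕ → Submodule k R) : ℤ → Submodule k R := fun z =>
  if 0 ≤ z then 𝒜 z.toNat else ⊥

/-- The degree-`n` piece of the twisted graded free module `⊕_j R(-bz j)`. -/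
def freePieceZ {k R : Type} [Field k] [CommRing R] [Algebra k R]
    (𝒬 : ℤ → Submodule k R) {m : ℕ} (bz : Fin m → ℤ) (n : ℤ) :
    Submodule k (Fin m → R) :=
  Submodule.pi Set.univ fun j => 𝒬 (n - bz j)

/-- `(r, bz, A, ε)` is a minimal homogeneous free resolution of the graded module `M`
(with graded pieces `ℳ`) over the graded algebra `(R, 𝒜)`:  the `i`-th free module is
`⊕_{j < r i} R(-bz i j)`, the differentials are given by the homogeneous matrices `A i`
with entries in the irrelevant maximal ideal (minimality), and `ε` is a degree-preserving
augmentation onto `M`. -/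
def IsMinGradedFreeResolutionOf {k R : Type} [Field k] [CommRing R] [Algebra k R]
    (𝒜 : ℕ → Submodule k R) {M : Type} [AddCommGroup M] [Module R M] [Module k M]
    (ℳ : ℤ → Submodule k M)
    (r : ℕ → ℕ) (bz : (i : ℕ) → Fin (r i) → ℤ)
    (A : (i : ℕ) → Matrix (Fin (r i)) (Fin (r (i + 1))) R)
    (ε : (Fin (r 0) → R) →ₗ[R] M) : Prop :=
  (∀ i j l, A i j l ∈ extZ 𝒜 (bz (i + 1) l - bz i j)) ∧
  (∀ i j l, A i j l ∈ irrel 𝒜) ∧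
  (∀ i, Function.Exact (Matrix.mulVecLin (A (i + 1))) (Matrix.mulVecLin (A i))) ∧
  Function.Surjective ε ∧
  Function.Exact (Matrix.mulVecLin (A 0)) ε ∧
  (∀ (n : ℤ) (v : Fin (r 0) → R), v ∈ freePieceZ (extZ 𝒜) (bz 0) n → ε v ∈ ℳ n)

/-- Reduction of a matrix modulo an ideal. -/
def redMat {P : Type} [CommRing P] (C : Ideal P) {m n : ℕ}
    (A : Matrix (Fin m) (Fin n) P) : Matrix (Fin m) (Fin n) (P ⧸ C) :=
  A.map (Ideal.Quotient.mk C)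

/-- The graded pieces of the quotient of a graded algebra by a homogeneous ideal. -/
def quotPieces {k R : Type} [Field k] [CommRing R] [Algebra k R]
    (𝒜 : ℕ → Submodule k R) (C : Ideal R) : ℕ → Submodule k (R ⧸ C) := fun n =>
  Submodule.map (Ideal.Quotient.mkₐ k C).toLinearMap (𝒜 n)


section RegSeq
open RingTheory.Sequence Function
open scoped Pointwise

theorem s6_wr_ext {R : Type} [CommRing R] (rs : List R) :
    ∀ {M N Q : Type} [AddCommGroup M] [AddCommGroup N] [AddCommGroup Q] [Module R M] [Module R N]
    [Module R Q] (f : M →ₗ[R] N) (g : N →ₗ[R] Q), Injective f → Exact f g → Surjective g →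
    IsWeaklyRegular M rs → IsWeaklyRegular Q rs → IsWeaklyRegular N rs := by
  induction rs with
  | nil => intros; exact IsWeaklyRegular.nil _ _
  | cons r rs ih =>
    intro M N Q _ _ _ _ _ _ f g hf hfg hg hM hQ
    rw [isWeaklyRegular_cons_iff] at hM hQ ⊢
    refine ⟨isSMulRegular_of_range_eq_ker hf hfg.linearMap_ker_eq.symm hM.1 hQ.1, ?_⟩
    refine ih (QuotSMulTop.map r f) (QuotSMulTop.map r g) ?_ (QuotSMulTop.map_exact r hfg hg)
      (QuotSMulTop.map_surjective r hg) hM.2 hQ.2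
    have h0 : Exact (0 : Unit →ₗ[R] M) f := by
      intro y
      constructor
      · intro hy
        exact ⟨(), by simpa using (hf (by simpa using hy.symm : f 0 = f y))⟩
      · rintro ⟨_, rfl⟩; simp
    have := QuotSMulTop.map_first_exact_on_four_term_exact_of_isSMulRegular_last h0 hfg hQ.1
    rw [map_zero] at this
    rw [← LinearMap.ker_eq_bot, this.linearMap_ker_eq]
    exact LinearMap.range_zero

theorem s6_wr_pow_head {R : Type} [CommRing R] {M : Type} [AddCommGroup M] [Module R M]
    (g : R) (rs : List R) (h : IsWeaklyRegular M (g :: rs)) (t : ℕ) :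
    IsWeaklyRegular M (g ^ (t + 1) :: rs) := by
  induction t with
  | zero => simpa using h
  | succ t ih =>
    rw [isWeaklyRegular_cons_iff] at h ih ⊢
    refine ⟨h.1.pow _, ?_⟩
    have h1 : g • (⊤ : Submodule R M) ≤ (g ^ (t + 1 + 1) • (⊤ : Submodule R M)).comap
        (LinearMap.lsmul R M (g ^ (t + 1))) := by
      rintro _ ⟨x, -, rfl⟩
      exact ⟨x, trivial, by simp [pow_succ g (t+1), mul_smul]; exact smul_comm _ _ _⟩
    have h2 : g ^ (t + 1 + 1) • (⊤ : Submodule R M) ≤ (g ^ (t + 1) • (⊤ : Submodule R M)).comap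
        LinearMap.id := by
      rintro _ ⟨x, -, rfl⟩
      exact ⟨g • x, trivial, by simp [pow_succ g (t+1), mul_smul]; exact smul_comm _ _ _⟩
    refine s6_wr_ext rs (Submodule.mapQ _ _ _ h1) (Submodule.mapQ _ _ _ h2) ?_ ?_ ?_ h.2 ih.2
    · rw [← LinearMap.ker_eq_bot, LinearMap.ker_eq_bot']
      intro x hx
      obtain ⟨x, rfl⟩ := Submodule.Quotient.mk_surjective _ x
      rw [Submodule.mapQ_apply, Submodule.Quotient.mk_eq_zero] at hx
      rw [Submodule.Quotient.mk_eq_zero]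
      obtain ⟨y, -, hy⟩ := hx
      refine ⟨y, trivial, ?_⟩
      apply h.1.pow (t+1)
      simpa [pow_succ g (t+1), mul_smul] using hy
    · intro x
      obtain ⟨x, rfl⟩ := Submodule.Quotient.mk_surjective _ x
      rw [Submodule.mapQ_apply, Submodule.Quotient.mk_eq_zero]
      constructor
      · rintro ⟨y, -, hy⟩
        refine ⟨Submodule.Quotient.mk y, ?_⟩
        rw [Submodule.mapQ_apply]
        congr 1
      · rintro ⟨y, hy⟩
        obtain ⟨y, rfl⟩ := Submodule.Quotient.mk_surjective _ y
        rw [Submodule.mapQ_apply, Submodule.Quotient.eq] at hy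
        obtain ⟨u, -, hu⟩ := hy
        refine ⟨y - g • u, trivial, ?_⟩
        simp only [DistribSMul.toLinearMap_apply, LinearMap.lsmul_apply] at hu
        simp only [DistribSMul.toLinearMap_apply, LinearMap.id_apply, smul_sub, ← mul_smul, ← pow_succ, hu]
        abel
    · intro x
      obtain ⟨x, rfl⟩ := Submodule.Quotient.mk_surjective _ x
      exact ⟨Submodule.Quotient.mk x, rfl⟩

theorem s6_wr_pow {R : Type} [CommRing R] (rs ss : List R)
    (h2 : List.Forall₂ (fun a b => ∃ n : ℕ, b = a ^ (n + 1)) rs ss) :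
    ∀ {M : Type} [AddCommGroup M] [Module R M], IsWeaklyRegular M rs → IsWeaklyRegular M ss := by
  induction h2 with
  | nil => intro M _ _ h; exact h
  | cons hab _ ih =>
    intro M _ _ h
    obtain ⟨n, rfl⟩ := hab
    have := s6_wr_pow_head _ _ h n
    rw [isWeaklyRegular_cons_iff] at this ⊢
    exact ⟨this.1, ih this.2⟩

theorem s6_wr_mid {R : Type} [CommRing R] (l1 l2 : List R) (g : R) 
    (h : IsWeaklyRegular R (l1 ++ g :: l2)) (x : R) (hx : g * x ∈ Ideal.ofList (l1 ++ l2)) :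
    x ∈ Ideal.ofList (l1 ++ l2) := by
  rw [isWeaklyRegular_append_iff, isWeaklyRegular_cons_iff] at h
  obtain ⟨-, h1, h2⟩ := h
  set X := R ⧸ (Ideal.ofList l1 • ⊤ : Submodule R R)
  have e1 : Exact (0 : Unit →ₗ[R] X) (LinearMap.lsmul R X g) := by
    intro y
    constructor
    · intro hy
      exact ⟨(), by simpa using (h1 (by simpa using hy.symm : g • 0 = g • y))⟩
    · rintro ⟨_, rfl⟩; simp
  have e2 : Exact (LinearMap.lsmul R X g) (Submodule.mkQ (g • (⊤ : Submodule R X))) := by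
    intro y
    rw [Submodule.mkQ_apply, Submodule.Quotient.mk_eq_zero]
    constructor
    · rintro ⟨z, -, hz⟩; exact ⟨z, hz⟩
    · rintro ⟨z, hz⟩; exact ⟨z, trivial, hz⟩
  have := map_first_exact_on_four_term_right_exact_of_isSMulRegular_last e1 e2
    (Submodule.mkQ_surjective _) h2
  have key : ∀ y : X, g • y ∈ (Ideal.ofList l2 • ⊤ : Submodule R X) → 
      y ∈ (Ideal.ofList l2 • ⊤ : Submodule R X) := by
    intro y hy
    obtain ⟨u, hu⟩ := (this (Submodule.Quotient.mk y)).1 (by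
      rw [Submodule.mapQ_apply, Submodule.Quotient.mk_eq_zero]; exact hy)
    obtain ⟨u, rfl⟩ := Submodule.Quotient.mk_surjective _ u
    rw [← Submodule.Quotient.mk_eq_zero, ← hu]
    simp
  have key2 : ∀ y : R, Submodule.Quotient.mk y ∈ (Ideal.ofList l2 • ⊤ : Submodule R X) ↔
      y ∈ Ideal.ofList (l1 ++ l2) := by
    intro y
    have : (Ideal.ofList l2 • ⊤ : Submodule R X) = 
      (Ideal.ofList l2 • ⊤ : Submodule R R).map (Submodule.mkQ (Ideal.ofList l1 • ⊤ : Submodule R R)) := by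
      rw [Submodule.map_smul'', Submodule.map_top, Submodule.range_mkQ]
    rw [this, ← Submodule.mkQ_apply, ← Submodule.mem_comap, Submodule.comap_map_eq,
      Submodule.ker_mkQ, Ideal.ofList_append, sup_comm]
    simp
  rw [← key2] at hx ⊢
  exact key _ hx

theorem s6_colon {R : Type} [CommRing R] {c : ℕ} (f : Fin c → R)
    (h : IsWeaklyRegular R (List.ofFn f)) (a : Fin c → ℕ) (ha : ∀ i, 0 < a i) (i : Fin c) (x : R)
    (hx : f i * x ∈ Ideal.span ((fun j => f j ^ a j) '' {j | j ≠ i})) :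
    x ∈ Ideal.span ((fun j => f j ^ a j) '' {j | j ≠ i}) := by
  let G : Fin c → R := fun j => if j = i then f i else f j ^ a j
  have hG : IsWeaklyRegular R (List.ofFn G) := by
    refine s6_wr_pow _ _ ?_ h
    rw [List.forall₂_iff_get]
    refine ⟨by simp, ?_⟩
    intro j h1 h2
    simp only [List.get_ofFn, G]
    simp at h1
    by_cases hj : (⟨j, h1⟩ : Fin c) = i
    · subst hj; exact ⟨0, by simp⟩
    · refine ⟨a ⟨j, h1⟩ - 1, ?_⟩
      simp [hj, Nat.sub_add_cancel (ha ⟨j, h1⟩)]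
  have hl : (i : ℕ) < (List.ofFn G).length := by simp
  have hsplit : List.ofFn G = (List.ofFn G).take i ++ f i :: (List.ofFn G).drop (i + 1) := by
    conv_lhs => rw [← List.take_append_drop i (List.ofFn G), List.drop_eq_getElem_cons hl]
    simp [G]
  have hspan : Ideal.ofList ((List.ofFn G).take i ++ (List.ofFn G).drop (i + 1)) =
      Ideal.span ((fun j => f j ^ a j) '' {j | j ≠ i}) := by
    unfold Ideal.ofList
    congr 1
    ext y
    simp only [Set.mem_ofPred_eq, List.mem_append, List.mem_take_iff_getElem, List.mem_drop_iff_getElem, Set.mem_image]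
    constructor
    · rintro (⟨j, hj, rfl⟩ | ⟨j, hj, rfl⟩)
      · simp at hj
        refine ⟨⟨j, by omega⟩, ?_, ?_⟩
        · intro h; have := congrArg Fin.val h; simp at this; omega
        · have : (⟨j, by omega⟩ : Fin c) ≠ i := by
            intro h; have := congrArg Fin.val h; simp at this; omega
          simp [G, this]
      · simp at hj
        have : (⟨i + 1 + j, by omega⟩ : Fin c) ≠ i := by intro h; have := congrArg Fin.val h; simp at this; omega
        refine ⟨⟨i + 1 + j, by omega⟩, this, ?_⟩
        simp [G, this]
    · rintro ⟨j, hj, rfl⟩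
      have hj' : (j : ℕ) ≠ i := fun h => hj (Fin.ext h)
      rcases lt_or_gt_of_ne hj' with h | h
      · left; exact ⟨j, by simp [h], by simp [G, hj]⟩
      · right
        refine ⟨j - (i + 1), by simp; omega, ?_⟩
        have : (⟨i + 1 + (j - (i+1)), by omega⟩ : Fin c) = j := Fin.ext (by simp; omega)
        simp [G, this, hj]
  rw [← hspan] at hx ⊢
  rw [hsplit] at hG
  exact s6_wr_mid _ _ _ hG x hx
end RegSeq

section TorPart
open TensorProduct

theorem s6_chase {R : Type} [CommRing R] {F0 F1 P2 P1 P0 N : Type}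
    [AddCommGroup F0] [AddCommGroup F1] [AddCommGroup P2] [AddCommGroup P1] [AddCommGroup P0]
    [AddCommGroup N] [Module R F0] [Module R F1] [Module R P2] [Module R P1] [Module R P0]
    [Module R N] [Module.Flat R F0] [Module.Flat R F1]
    (f : F1 →ₗ[R] F0) (d2 : P2 →ₗ[R] P1) (d1 : P1 →ₗ[R] P0) (d0 : P0 →ₗ[R] N)
    (h21 : Function.Exact d2 d1) (h10 : Function.Exact d1 d0) (h0 : Function.Surjective d0)
    (hN : ∀ x : F1 ⊗[R] N, f.rTensor N x = 0 →
      ∃ y : (LinearMap.ker f) ⊗[R] N, (LinearMap.ker f).subtype.rTensor N y = x)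
    (x : (F0 ⧸ LinearMap.range f) ⊗[R] P1)
    (hx : d1.lTensor (F0 ⧸ LinearMap.range f) x = 0) :
    ∃ y, d2.lTensor (F0 ⧸ LinearMap.range f) y = x := by
  set π := (LinearMap.range f).mkQ
  have hπ : Function.Surjective π := Submodule.mkQ_surjective _
  have hfπ : Function.Exact f π := LinearMap.exact_map_mkQ_range f
  have comm : ∀ {A B X Y : Type} [AddCommGroup A] [AddCommGroup B] [AddCommGroup X]
      [AddCommGroup Y] [Module R A] [Module R B] [Module R X] [Module R Y] 
      (u : A →ₗ[R] B) (v : X →ₗ[R] Y) (t : A ⊗[R] X),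
      v.lTensor B (u.rTensor X t) = u.rTensor Y (v.lTensor A t) := by
    intros A B X Y _ _ _ _ _ _ _ _ u v t
    rw [← LinearMap.comp_apply, ← LinearMap.comp_apply, LinearMap.lTensor_comp_rTensor,
      LinearMap.rTensor_comp_lTensor]
  obtain ⟨a, rfl⟩ := LinearMap.rTensor_surjective P1 hπ x
  rw [comm] at hx
  obtain ⟨b, hb⟩ := (rTensor_exact P0 hfπ hπ _).1 hx
  have hbN : f.rTensor N (d0.lTensor F1 b) = 0 := by
    rw [← comm, hb, ← LinearMap.comp_apply, ← LinearMap.lTensor_comp, h10.linearMap_comp_eq_zero]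
    simp
  obtain ⟨c, hc⟩ := hN _ hbN
  obtain ⟨c', rfl⟩ := LinearMap.lTensor_surjective (LinearMap.ker f) h0 c
  rw [← comm] at hc
  have hb' : d0.lTensor F1 (b - (LinearMap.ker f).subtype.rTensor P0 c') = 0 := by
    rw [map_sub, hc, sub_self]
  obtain ⟨d, hd⟩ := (Module.Flat.lTensor_exact F1 h10 _).1 hb'
  have hz : ∀ {X : Type} [AddCommGroup X] [Module R X] (c : (LinearMap.ker f) ⊗[R] X),
      f.rTensor X ((LinearMap.ker f).subtype.rTensor X c) = 0 := by
    intro X _ _ c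
    rw [← LinearMap.comp_apply, ← LinearMap.rTensor_comp, LinearMap.comp_ker_subtype]
    simp
  have ha : d1.lTensor F0 (a - f.rTensor P1 d) = 0 := by
    rw [map_sub, comm, hd, map_sub, hz, hb]
    simp
  obtain ⟨g, hg⟩ := (Module.Flat.lTensor_exact F0 h21 _).1 ha
  refine ⟨π.rTensor P2 g, ?_⟩
  rw [comm, hg, map_sub]
  have : π.rTensor P1 (f.rTensor P1 d) = 0 := by
    rw [← LinearMap.comp_apply, ← LinearMap.rTensor_comp, hfπ.linearMap_comp_eq_zero]
    simp
  rw [this, sub_zero]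

theorem s6_tor {R : Type} [CommRing R] {F0 F1 : Type}
    [AddCommGroup F0] [AddCommGroup F1] [Module R F0] [Module R F1] 
    [Module.Flat R F0] [Module.Flat R F1]
    (f : F1 →ₗ[R] F0) (N : ModuleCat.{0} R)
    (hN : ∀ x : F1 ⊗[R] N, f.rTensor N x = 0 →
      ∃ y : (LinearMap.ker f) ⊗[R] N, (LinearMap.ker f).subtype.rTensor N y = x) :
    Subsingleton (((Tor (ModuleCat R) 1).obj (ModuleCat.of R (F0 ⧸ LinearMap.range f))).obj N) := by
  apply ModuleCat.subsingleton_of_isZero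
  let P := projectiveResolution N
  refine Limits.IsZero.of_iso ?_ (P.isoLeftDerivedObj _ 1)
  change Limits.IsZero (HomologicalComplex.homology _ 1)
  rw [← HomologicalComplex.exactAt_iff_isZero_homology,
    HomologicalComplex.exactAt_iff' _ 2 1 0 (by simp) (by simp),
    ShortComplex.moduleCat_exact_iff]
  intro x hx
  have h21 : Function.Exact (P.complex.d 2 1).hom (P.complex.d 1 0).hom := by
    have := P.complex_exactAt_succ 0
    rw [HomologicalComplex.exactAt_iff' _ 2 1 0 (by simp) (by simp),
      ShortComplex.ShortExact.moduleCat_exact_iff_function_exact] at this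
    exact this
  have h10 : Function.Exact (P.complex.d 1 0).hom (P.π.f 0).hom := by
    have := P.exact₀
    rw [ShortComplex.ShortExact.moduleCat_exact_iff_function_exact] at this
    exact this
  have h0 : Function.Surjective (P.π.f 0).hom := by
    have : Epi (P.π.f 0) := inferInstance
    exact (ModuleCat.epi_iff_surjective _).1 this
  exact s6_chase f _ _ _ h21 h10 h0 hN x hx
end TorPart

section FrobPart
open MvPolynomial

theorem s6_theta {k : Type} [Field k] (p : ℕ) [Fact p.Prime] [CharP k p] (e : ℕ) :
    ∃ (Λ : Type) (b : Λ → k) (θ : Λ → k →+ k),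
      (∀ l c d, θ l (c ^ p ^ e * d) = c * θ l d) ∧
      ∀ d : k, ∃ S : Finset Λ, ∀ T : Finset Λ, S ⊆ T → ∑ l ∈ T, b l * (θ l d) ^ p ^ e = d := by
  classical
  let L := (iterateFrobenius k p e).fieldRange
  let B := Module.Basis.ofVectorSpace L k
  let ψ : k ≃+* L := RingEquiv.ofBijective (iterateFrobenius k p e).rangeRestrictField
    ⟨(iterateFrobenius k p e).rangeRestrictField.injective, by
      rintro ⟨x, y, rfl⟩; exact ⟨y, rfl⟩⟩
  have hψ : ∀ c, (ψ c : k) = c ^ p ^ e := fun c => rfl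
  refine ⟨_, fun l => B l, fun l => (ψ.symm : L ≃+ k).toAddMonoidHom.comp 
    (B.coord l).toAddMonoidHom, ?_, ?_⟩
  · intro l c d
    have : c ^ p ^ e * d = ψ c • d := by rw [Subfield.smul_def, hψ, smul_eq_mul]
    rw [this]
    simp
  · intro d
    refine ⟨(B.repr d).support, fun T hT => ?_⟩
    have := B.linearCombination_repr d
    rw [Finsupp.linearCombination_apply, Finsupp.sum_of_support_subset _ hT _ (by simp)] at this
    conv_rhs => rw [← this]
    refine Finset.sum_congr rfl fun l _ => ?_
    rw [← hψ, Subfield.smul_def, mul_comm]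
    simp

theorem s6_tau {k : Type} [Field k] {σ : Type} (p : ℕ) [Fact p.Prime] [CharP k p] (e : ℕ)
    (θ : k →+ k) (hθ : ∀ c d, θ (c ^ p ^ e * d) = c * θ d) (β : σ →₀ ℕ) :
    ∃ π : MvPolynomial σ k →+ MvPolynomial σ k,
      (∀ a b, π (a ^ p ^ e * b) = a * π b) ∧
      (∀ n d, n.mapRange (· % p ^ e) (Nat.zero_mod _) = β → π (monomial n d) = 
        monomial (n.mapRange (· / p ^ e) (Nat.zero_div _)) (θ d)) ∧
      (∀ n d, n.mapRange (· % p ^ e) (Nat.zero_mod _) ≠ β → π (monomial n d) = 0) := by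
  classical
  have hq : 0 < p ^ e := Nat.pow_pos (Fact.out : p.Prime).pos
  let τ : (σ →₀ ℕ) → k →+ MvPolynomial σ k := fun n =>
    if n.mapRange (· % p ^ e) (Nat.zero_mod _) = β then
      (monomial (n.mapRange (· / p ^ e) (Nat.zero_div _)) : k →ₗ[k] _).toAddMonoidHom.comp θ else 0
  let π : MvPolynomial σ k →+ MvPolynomial σ k :=
    (Finsupp.liftAddHom τ).comp AddMonoidAlgebra.coeffAddEquiv.toAddMonoidHom
  have hπ : ∀ n d, π (monomial n d) = τ n d := fun n d => Finsupp.liftAddHom_apply_single _ _ _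
  refine ⟨π, ?_, ?_, ?_⟩
  · intro a b
    induction a using MvPolynomial.induction_on' with
    | add a a' h h' => rw [add_pow_expChar_pow, add_mul, map_add, h, h', add_mul]
    | monomial m c =>
      induction b using MvPolynomial.induction_on' with
      | add b b' h h' => rw [mul_add, map_add, h, h', map_add, mul_add]
      | monomial n d =>
        rw [monomial_pow, monomial_mul, hπ, hπ]
        have h1 : (p ^ e • m + n).mapRange (· % p ^ e) (Nat.zero_mod _) = 
          n.mapRange (· % p ^ e) (Nat.zero_mod _) := by
          ext i; simp
        have h2 : (p ^ e • m + n).mapRange (· / p ^ e) (Nat.zero_div _) = 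
          m + n.mapRange (· / p ^ e) (Nat.zero_div _) := by
          ext i; simp [Nat.mul_add_div hq]
        simp only [τ, h1, h2]
        split_ifs
        · simp [hθ, monomial_mul]
        · simp
  · intro n d h
    rw [hπ]; simp [τ, h]
  · intro n d h
    rw [hπ]; simp [τ, h]

theorem s6_split {k : Type} [Field k] {σ : Type} (p : ℕ) [Fact p.Prime] [CharP k p] (e : ℕ) :
    ∃ π : MvPolynomial σ k →+ MvPolynomial σ k,
      (∀ a b, π (a ^ p ^ e * b) = a * π b) ∧ π 1 = 1 := by
  obtain ⟨Λ, b, θ, hθ, hb⟩ := s6_theta (k := k) p e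
  have : ∃ l, θ l 1 ≠ 0 := by
    by_contra! h
    obtain ⟨S, hS⟩ := hb 1
    have := hS S le_rfl
    have hq : p ^ e ≠ 0 := (Nat.pow_pos (Fact.out : p.Prime).pos).ne'
    simp only [h, zero_pow hq, mul_zero, Finset.sum_const_zero] at this
    exact zero_ne_one this
  obtain ⟨l, hl⟩ := this
  let θ' : k →+ k := (AddMonoidHom.mulLeft (θ l 1)⁻¹).comp (θ l)
  obtain ⟨π, h1, h2, -⟩ := s6_tau (σ := σ) p e θ' (by intro c d; simp [θ', hθ]; ring) 0
  refine ⟨π, h1, ?_⟩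
  have := h2 0 1 (by simp)
  rw [MvPolynomial.monomial_zero', C_1] at this
  rw [this]
  simp [θ', hl]

end FrobPart
section GrPart
open MvPolynomial

noncomputable def s6_hc {k σ : Type} [Field k] (w : σ → ℕ) (n : ℤ) :
    MvPolynomial σ k →ₗ[k] MvPolynomial σ k :=
  if 0 ≤ n then weightedHomogeneousComponent w n.toNat else 0

theorem s6_coeff_hc {k σ : Type} [Field k] (w : σ → ℕ) (n : ℤ) (a : MvPolynomial σ k) (m : σ →₀ ℕ) :
    coeff m (s6_hc w n a) = if (Finsupp.weight w m : ℤ) = n then coeff m a else 0 := by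
  classical
  unfold s6_hc
  split_ifs with h1 h2 h2
  · rw [coeff_weightedHomogeneousComponent, if_pos (by omega)]
  · rw [coeff_weightedHomogeneousComponent, if_neg (by omega)]
  · omega
  · simp

theorem s6_mem_extZ {k σ : Type} [Field k] (w : σ → ℕ) (d : ℤ) (x : MvPolynomial σ k) :
    x ∈ extZ (weightedHomogeneousSubmodule k w) d ↔
      ∀ m, coeff m x ≠ 0 → (Finsupp.weight w m : ℤ) = d := by
  unfold extZ
  split_ifs with h
  · rw [mem_weightedHomogeneousSubmodule]
    constructor
    · intro hx m hm
      have := hx hm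
      omega
    · intro hx m hm
      have := hx m hm
      omega
  · rw [Submodule.mem_bot]
    constructor
    · rintro rfl m hm
      simp at hm
    · intro hx
      ext m
      by_contra hm
      have := hx m (by simpa using hm)
      omega

theorem s6_hc_mul {k σ : Type} [Field k] (w : σ → ℕ) (n d : ℤ) (a x : MvPolynomial σ k)
    (hx : x ∈ extZ (weightedHomogeneousSubmodule k w) d) :
    s6_hc w n (a * x) = s6_hc w (n - d) a * x := by
  classical
  rw [s6_mem_extZ] at hx
  ext m
  rw [s6_coeff_hc, coeff_mul, coeff_mul]
  split_ifs with h
  · refine Finset.sum_congr rfl fun y hy => ?_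
    rw [Finset.HasAntidiagonal.mem_antidiagonal] at hy
    rw [s6_coeff_hc]
    by_cases h0 : coeff y.2 x = 0
    · simp [h0]
    · have := hx _ h0
      rw [if_pos]
      rw [← h, ← hy, map_add]; push_cast; omega
  · symm
    refine Finset.sum_eq_zero fun y hy => ?_
    rw [Finset.HasAntidiagonal.mem_antidiagonal] at hy
    rw [s6_coeff_hc]
    by_cases h0 : coeff y.2 x = 0
    · simp [h0]
    · have := hx _ h0
      rw [if_neg, zero_mul]
      intro h'
      apply h
      rw [← hy, map_add]; push_cast; omega

theorem s6_hc_neg {k σ : Type} [Field k] (w : σ → ℕ) (n : ℤ) (hn : n < 0) (a : MvPolynomial σ k) :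
    s6_hc w n a = 0 := by
  unfold s6_hc
  rw [if_neg (by omega)]; rfl

theorem s6_hc_zero {k σ : Type} [Field k] (w : σ → ℕ) (hw : ∀ i, 0 < w i) (a : MvPolynomial σ k) :
    s6_hc w 0 a = C (coeff 0 a) := by
  classical
  ext m
  rw [s6_coeff_hc, coeff_C]
  by_cases hm : m = 0
  · subst hm; simp
  · rw [if_neg, if_neg (fun h => hm h.symm)]
    intro h
    apply hm
    have h : Finsupp.weight w m = 0 := by exact_mod_cast h
    have hw' : Finsupp.NonTorsionWeight ℕ w := Finsupp.nonTorsionWeight_of ℕ w fun i => (hw i).ne'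
    exact (Finsupp.weight_eq_zero_iff_eq_zero w).1 h

theorem s6_hc_self {k σ : Type} [Field k] (w : σ → ℕ) (d : ℤ) (x : MvPolynomial σ k)
    (hx : x ∈ extZ (weightedHomogeneousSubmodule k w) d) : s6_hc w d x = x := by
  rw [s6_mem_extZ] at hx
  ext m
  rw [s6_coeff_hc]
  split_ifs with h
  · rfl
  · by_contra h'
    exact h (hx m fun h'' => h' h''.symm)

theorem s6_hc_mem {k σ : Type} [Field k] (w : σ → ℕ) (d : ℤ) (x : MvPolynomial σ k) :
    s6_hc w d x ∈ extZ (weightedHomogeneousSubmodule k w) d := by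
  rw [s6_mem_extZ]
  intro m hm
  rw [s6_coeff_hc] at hm
  by_contra h
  exact hm (if_neg h)

noncomputable def s6_comp {k σ : Type} [Field k] (w : σ → ℕ) {r : ℕ} (b : Fin r → ℤ) (n : ℤ) :
    (Fin r → MvPolynomial σ k) →ₗ[k] (Fin r → MvPolynomial σ k) :=
  LinearMap.pi fun j => (s6_hc w (n - b j)).comp (LinearMap.proj j)

def s6_hom {k σ : Type} [Field k] (w : σ → ℕ) {r : ℕ} (b : Fin r → ℤ) (n : ℤ)
    (x : Fin r → MvPolynomial σ k) : Prop :=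
  ∀ j, x j ∈ extZ (weightedHomogeneousSubmodule k w) (n - b j)

section
variable {k σ : Type} [Field k] (w : σ → ℕ) {r : ℕ} (b : Fin r → ℤ)

theorem s6_comp_smul (n m : ℤ) (a : MvPolynomial σ k) (x : Fin r → MvPolynomial σ k)
    (hx : s6_hom w b m x) : s6_comp w b n (a • x) = s6_hc w (n - m) a • x := by
  ext1 j
  simp only [s6_comp, LinearMap.pi_apply, LinearMap.comp_apply, LinearMap.proj_apply,
    Pi.smul_apply, smul_eq_mul]
  rw [s6_hc_mul w _ _ _ _ (hx j)]
  congr 2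
  ring_nf

theorem s6_comp_smul' (n d : ℤ) (a : MvPolynomial σ k) (x : Fin r → MvPolynomial σ k)
    (ha : a ∈ extZ (weightedHomogeneousSubmodule k w) d) :
    s6_comp w b n (a • x) = a • s6_comp w b (n - d) x := by
  ext1 j
  simp only [s6_comp, LinearMap.pi_apply, LinearMap.comp_apply, LinearMap.proj_apply,
    Pi.smul_apply, smul_eq_mul]
  rw [mul_comm, s6_hc_mul w _ _ _ _ ha, mul_comm]
  congr 2
  ring_nf

theorem s6_comp_self (n : ℤ) (x : Fin r → MvPolynomial σ k)
    (hx : s6_hom w b n x) : s6_comp w b n x = x := by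
  ext1 j
  exact s6_hc_self w _ _ (hx j)

theorem s6_comp_hom (n : ℤ) (x : Fin r → MvPolynomial σ k) :
    s6_hom w b n (s6_comp w b n x) := fun _ => s6_hc_mem w _ _

def s6_gr (N : Submodule (MvPolynomial σ k) (Fin r → MvPolynomial σ k)) : Prop :=
  ∀ n, ∀ x ∈ N, s6_comp w b n x ∈ N

theorem s6_gr_sup {N N' : Submodule (MvPolynomial σ k) (Fin r → MvPolynomial σ k)}
    (h : s6_gr w b N) (h' : s6_gr w b N') : s6_gr w b (N ⊔ N') := by
  intro n x hx
  obtain ⟨y, hy, z, hz, rfl⟩ := Submodule.mem_sup.1 hx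
  rw [map_add]
  exact Submodule.add_mem_sup (h n y hy) (h' n z hz)

theorem s6_gr_span (S : Set (Fin r → MvPolynomial σ k)) (hS : ∀ x ∈ S, ∃ m, s6_hom w b m x) :
    s6_gr w b (Submodule.span (MvPolynomial σ k) S) := by
  intro n x hx
  induction hx using Submodule.closure_induction with
  | zero => rw [map_zero]; exact Submodule.zero_mem _
  | add x y _ _ h h' => rw [map_add]; exact Submodule.add_mem _ h h'
  | smul_mem a x hx =>
    obtain ⟨m, hm⟩ := hS x hx
    rw [s6_comp_smul w b n m a x hm]
    exact Submodule.smul_mem _ _ (Submodule.subset_span hx)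

theorem s6_extZ_pow {q : ℕ} (hq : 0 < q) {d : ℤ} {x : MvPolynomial σ k}
    (hx : x ∈ extZ (weightedHomogeneousSubmodule k w) d) :
    x ^ q ∈ extZ (weightedHomogeneousSubmodule k w) (q * d) := by
  by_cases hd : 0 ≤ d
  · lift d to ℕ using hd
    simp only [extZ, Nat.cast_nonneg, if_true, Int.toNat_natCast] at hx
    have := IsWeightedHomogeneous.pow hx q
    rw [smul_eq_mul] at this
    rw [← Nat.cast_mul]
    simp only [extZ, Nat.cast_nonneg, if_true, Int.toNat_natCast]
    exact this
  · simp only [extZ, if_neg hd, Submodule.mem_bot] at hx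
    rw [hx, zero_pow hq.ne']
    exact Submodule.zero_mem _

theorem s6_hom_pow {q : ℕ} (hq : 0 < q) {n : ℤ} {x : Fin r → MvPolynomial σ k}
    (hx : s6_hom w b n x) : s6_hom w (fun j => q * b j) (q * n) (fun j => x j ^ q) := by
  intro j
  rw [← mul_sub]
  exact s6_extZ_pow w hq (hx j)
end

def s6_vI {P : Type} [CommRing P] (r : ℕ) (I : Ideal P) : Submodule P (Fin r → P) :=
  Submodule.pi Set.univ fun _ => I

theorem s6_mem_vI {P : Type} [CommRing P] {r : ℕ} {I : Ideal P} {x : Fin r → P} :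
    x ∈ s6_vI r I ↔ ∀ j, x j ∈ I := by
  simp [s6_vI, Submodule.mem_pi]

theorem s6_vI_mono {P : Type} [CommRing P] {r : ℕ} {I J : Ideal P} (h : I ≤ J) :
    s6_vI r I ≤ s6_vI r J := fun _ hx => s6_mem_vI.2 fun j => h (s6_mem_vI.1 hx j)

theorem s6_vI_exp {P : Type} [CommRing P] {r c : ℕ} (g : Fin c → P) {x : Fin r → P}
    (hx : x ∈ s6_vI r (Ideal.span (Set.range g))) :
    ∃ y : Fin c → Fin r → P, x = ∑ i, g i • y i := by
  rw [s6_mem_vI] at hx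
  have : ∀ j, ∃ d : Fin c → P, ∑ i, d i * g i = x j := fun j => by
    have := hx j
    rw [Ideal.span, Submodule.mem_span_range_iff_exists_fun] at this
    simpa using this
  choose d hd using this
  refine ⟨fun i j => d j i, ?_⟩
  ext1 j
  rw [← hd]
  simp [Finset.sum_apply, mul_comm]
end GrPart
section MainPart
open MvPolynomial

theorem s6_claim {k σ : Type} [Field k] (w : σ → ℕ) {r r' c : ℕ} (b : Fin r → ℤ)
    (f : Fin c → MvPolynomial σ k) (df : Fin c → ℕ) (hdf : ∀ i, 0 < df i)
    (hf : ∀ i, f i ∈ MvPolynomial.weightedHomogeneousSubmodule k w (df i))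
    (hreg : RingTheory.Sequence.IsWeaklyRegular (MvPolynomial σ k) (List.ofFn f))
    (B : (Fin r → MvPolynomial σ k) →ₗ[MvPolynomial σ k] (Fin r' → MvPolynomial σ k))
    (q : ℕ) (U : Submodule (MvPolynomial σ k) (Fin r → MvPolynomial σ k))
    (hU : s6_gr w b U)
    (hUJ : ∀ u ∈ U, B u ∈ s6_vI r' (Ideal.span (Set.range fun j => f j ^ q)))
    (D : ℤ)
    (H : ∀ n < D, ∀ y, s6_hom w b n y → B y ∈ s6_vI r' (Ideal.span (Set.range f)) →
      y ∈ U ⊔ s6_vI r (Ideal.span (Set.range f)))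
    (N : ℕ) : ∀ (a : Fin c → ℕ) (_ : ∀ i, 0 < a i) (_ : ∀ i, a i ≤ q) (_ : ∑ i, a i ≤ N)
      (n : ℤ) (_ : n ≤ D) (v : Fin r → MvPolynomial σ k) (_ : s6_hom w b n v)
      (_ : B v ∈ s6_vI r' (Ideal.span (Set.range fun j => f j ^ a j)))
      (_ : v ∈ U ⊔ s6_vI r (Ideal.span (Set.range f))),
      v ∈ U ⊔ s6_vI r (Ideal.span (Set.range fun j => f j ^ a j)) := by
  classical
  induction N with
  | zero =>
    intro a ha _ hN n hn v hv hBv hvU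
    have h0 : IsEmpty (Fin c) := by
      constructor
      intro i
      have := Finset.single_le_sum (f := a) (fun _ _ => Nat.zero_le _) (Finset.mem_univ i)
      have := ha i
      omega
    have : (fun j => f j ^ a j) = f := by ext1 j; exact h0.elim j
    rw [this]; exact hvU
  | succ N ih =>
    intro a ha haq hN n hn v hv hBv hvU
    by_cases h1 : ∀ i, a i = 1
    · simpa [h1] using hvU
    push Not at h1
    obtain ⟨i, hi⟩ := h1
    obtain ⟨t, ht⟩ : ∃ t, a i = t + 1 := ⟨a i - 1, by have := ha i; omega⟩
    have ht0 : 0 < t := by have := ha i; omega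
    have hle : ∀ (g h : Fin c → ℕ), (∀ j, g j ≤ h j) →
        Ideal.span (Set.range fun j => f j ^ h j) ≤ Ideal.span (Set.range fun j => f j ^ g j) := by
      intro g h hgh
      rw [Ideal.span_le]
      rintro _ ⟨j, rfl⟩
      exact Ideal.mem_of_dvd _ (pow_dvd_pow _ (hgh j)) (Ideal.subset_span ⟨j, rfl⟩)
    have hsum : ∀ s, ∑ j, Function.update a i s j + (t + 1) = ∑ j, a j + s := by
      intro s
      rw [Finset.sum_update_of_mem (Finset.mem_univ i), ← ht,
        ← Finset.sum_sdiff (Finset.subset_univ {i}), Finset.sum_singleton]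
      omega
    have hup : ∀ s, 0 < s → s ≤ t + 1 → (∀ j, 0 < Function.update a i s j) ∧
        (∀ j, Function.update a i s j ≤ a j) := by
      intro s hs hs'
      constructor
      · intro j
        by_cases hj : j = i
        · subst hj; simpa using hs
        · simpa [hj] using ha j
      · intro j
        by_cases hj : j = i
        · subst hj; simp; omega
        · simp [hj]
    obtain ⟨p1, p2⟩ := hup t ht0 (by omega)
    obtain ⟨s1, s2⟩ := hup 1 one_pos (by omega)
    have hv' := ih _ p1 (fun j => (p2 j).trans (haq j)) (by have := hsum t; omega) n hn v hv
      (s6_vI_mono (hle _ _ p2) hBv) hvU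
    obtain ⟨u, hu, x, hx, rfl⟩ := Submodule.mem_sup.1 hv'
    obtain ⟨y, rfl⟩ := s6_vI_exp _ hx
    set v := u + ∑ j, f j ^ Function.update a i t j • y j with hvdef
    let z : Fin c → Fin r → MvPolynomial σ k := fun j =>
      s6_comp w b (n - (Function.update a i t j : ℤ) * df j) (y j)
    have hve : v = s6_comp w b n u + ∑ j, f j ^ Function.update a i t j • z j := by
      rw [← s6_comp_self w b n v hv, hvdef, map_add, map_sum]
      congr 1
      refine Finset.sum_congr rfl fun j _ => ?_
      rw [s6_comp_smul' w b n ((Function.update a i t j : ℤ) * df j)]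
      apply s6_extZ_pow w (p1 j)
      simpa [extZ] using hf j
    have hu' := hU n u hu
    set u' := s6_comp w b n u
    have hspl : v = u' + (f i ^ t • z i + ∑ j ∈ Finset.univ.erase i, f j ^ a j • z j) := by
      rw [hve, ← Finset.add_sum_erase _ _ (Finset.mem_univ i), Function.update_self]
      congr 2
      refine Finset.sum_congr rfl fun j hj => ?_
      rw [Function.update_of_ne (Finset.ne_of_mem_erase hj)]
    have hrest : ∀ (l : ℕ) (g : Fin c → Fin l → MvPolynomial σ k),
        ∑ j ∈ Finset.univ.erase i, f j ^ a j • g j ∈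
        s6_vI l (Ideal.span (Set.range fun j => f j ^ a j)) := by
      intro l g
      refine Submodule.sum_mem _ fun j _ => s6_mem_vI.2 fun m => ?_
      exact Ideal.mul_mem_right _ _ (Ideal.subset_span ⟨j, rfl⟩)
    have hBz : f i ^ t • B (z i) ∈ s6_vI r' (Ideal.span (Set.range fun j => f j ^ a j)) := by
      have : f i ^ t • B (z i) = B v - B u' - ∑ j ∈ Finset.univ.erase i, f j ^ a j • B (z j) := by
        rw [hspl]
        simp only [map_add, map_sum, map_smul]
        abel
      rw [this]
      refine Submodule.sub_mem _ (Submodule.sub_mem _ hBv ?_) (hrest _ _)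
      exact s6_vI_mono (hle _ _ haq) (hUJ _ hu')
    have hK : Ideal.span ((fun j => f j ^ a j) '' {j | j ≠ i}) ≤
        Ideal.span (Set.range fun j => f j ^ Function.update a i 1 j) := by
      rw [Ideal.span_le]
      rintro _ ⟨j, hj, rfl⟩
      refine Ideal.subset_span ⟨j, ?_⟩
      simp only
      rw [Function.update_of_ne hj]
    have hpow : ∀ (m : ℕ) (x : MvPolynomial σ k),
        f i ^ m * x ∈ Ideal.span ((fun j => f j ^ a j) '' {j | j ≠ i}) →
        x ∈ Ideal.span ((fun j => f j ^ a j) '' {j | j ≠ i}) := by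
      intro m
      induction m with
      | zero => intro x hx; simpa using hx
      | succ m ihm =>
        intro x hx
        rw [pow_succ, mul_assoc] at hx
        exact s6_colon f hreg a ha i x (ihm _ hx)
    have hBz1 : B (z i) ∈ s6_vI r' (Ideal.span (Set.range fun j => f j ^ Function.update a i 1 j)) := by
      rw [s6_mem_vI] at hBz ⊢
      intro m
      have h1 := hBz m
      have hr : (Set.range fun j => f j ^ a j) =
          insert (f i ^ a i) ((fun j => f j ^ a j) '' {j | j ≠ i}) := by
        ext y
        constructor
        · rintro ⟨j, rfl⟩
          by_cases hj : j = i
          · subst hj; exact Set.mem_insert _ _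
          · exact Set.mem_insert_of_mem _ ⟨j, hj, rfl⟩
        · rintro (rfl | ⟨j, _, rfl⟩)
          · exact ⟨i, rfl⟩
          · exact ⟨j, rfl⟩
      rw [hr, Ideal.mem_span_insert] at h1
      obtain ⟨s, y', hy', he⟩ := h1
      have h2 : f i ^ t * (B (z i) m - f i * s) ∈ Ideal.span ((fun j => f j ^ a j) '' {j | j ≠ i}) := by
        have : f i ^ t * (B (z i) m - f i * s) = y' := by
          have he' : f i ^ t * B (z i) m = s * f i ^ a i + y' := he
          rw [ht] at he'
          linear_combination he'
        rw [this]; exact hy'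
      have h3 := hK (hpow t _ h2)
      have h4 : f i * s ∈ Ideal.span (Set.range fun j => f j ^ Function.update a i 1 j) :=
        Ideal.mul_mem_right _ _ (Ideal.subset_span ⟨i, by simp⟩)
      have := Ideal.add_mem _ h3 h4
      simpa using this
    have hzhom : s6_hom w b (n - (t : ℤ) * df i) (z i) := by
      have := s6_comp_hom w b (n - (Function.update a i t i : ℤ) * df i) (y i)
      rw [Function.update_self] at this
      have e2 : z i = s6_comp w b (n - (t : ℤ) * df i) (y i) := by
        simp only [z, Function.update_self]
      rw [e2]; exact this
    have hlt : n - (t : ℤ) * df i < D := by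
      have : (0 : ℤ) < t * df i := by
        have := hdf i
        positivity
      omega
    have hone : Ideal.span (Set.range fun j => f j ^ Function.update a i 1 j) ≤
        Ideal.span (Set.range f) := by
      have := hle (fun _ => 1) (Function.update a i 1) (fun j => s1 j)
      simpa using this
    have hz := ih _ s1 (fun j => (s2 j).trans (haq j)) (by have := hsum 1; omega) _ hlt.le (z i)
      hzhom hBz1 (H _ hlt _ hzhom (s6_vI_mono hone hBz1))
    rw [hspl]
    refine Submodule.add_mem _ (Submodule.mem_sup_left hu')
      (Submodule.add_mem _ ?_ (Submodule.mem_sup_right (hrest _ _)))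
    obtain ⟨u2, hu2, x2, hx2, he2⟩ := Submodule.mem_sup.1 hz
    rw [← he2, smul_add]
    refine Submodule.add_mem_sup (Submodule.smul_mem _ _ hu2) ?_
    obtain ⟨y2, rfl⟩ := s6_vI_exp _ hx2
    rw [Finset.smul_sum]
    refine Submodule.sum_mem _ fun j _ => s6_mem_vI.2 fun m => ?_
    simp only [Pi.smul_apply, smul_eq_mul, ← mul_assoc]
    refine Ideal.mul_mem_right _ _ ?_
    by_cases hj : j = i
    · subst hj
      rw [Function.update_self, ← pow_add, ← ht]
      exact Ideal.subset_span ⟨j, rfl⟩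
    · rw [Function.update_of_ne hj]
      exact Ideal.mul_mem_left _ _ (Ideal.subset_span ⟨j, rfl⟩)
end MainPart
section MainPart2
open MvPolynomial

theorem s6_main {k σ : Type} [Field k] (w : σ → ℕ) (hw : ∀ i, 0 < w i) {r r' c : ℕ} (b : Fin r → ℤ)
    (f : Fin c → MvPolynomial σ k) (df : Fin c → ℕ) (hdf : ∀ i, 0 < df i)
    (hf : ∀ i, f i ∈ MvPolynomial.weightedHomogeneousSubmodule k w (df i))
    (hreg : RingTheory.Sequence.IsWeaklyRegular (MvPolynomial σ k) (List.ofFn f))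
    (B : (Fin r → MvPolynomial σ k) →ₗ[MvPolynomial σ k] (Fin r' → MvPolynomial σ k))
    (q : ℕ) (hq : 0 < q) (K : Submodule (MvPolynomial σ k) (Fin r → MvPolynomial σ k))
    (hK : s6_gr w b K) (hKB : ∀ u ∈ K, B u = 0)
    {ℓ : ℕ} (g : Fin ℓ → ℤ) (z y : Fin ℓ → Fin r → MvPolynomial σ k)
    (hz : ∀ i, s6_hom w b (g i) (z i)) (hy : ∀ i, s6_hom w b (g i) (y i))
    (hzJ : ∀ i, B (z i) ∈ s6_vI r' (Ideal.span (Set.range fun j => f j ^ q)))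
    (hgen : ∀ v, B v ∈ s6_vI r' (Ideal.span (Set.range f)) →
      v ∈ Submodule.span (MvPolynomial σ k) (Set.range y) ⊔ (K ⊔ s6_vI r (Ideal.span (Set.range f))))
    (hmin : ∀ i, z i ∉ Submodule.span (MvPolynomial σ k) (z '' {j | j ≠ i}) ⊔ K ⊔
      s6_vI r (Ideal.span (Set.range fun j => f j ^ q))) :
    ∀ v, B v ∈ s6_vI r' (Ideal.span (Set.range f)) →
      v ∈ Submodule.span (MvPolynomial σ k) (Set.range z) ⊔ K ⊔ s6_vI r (Ideal.span (Set.range f)) := by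
  classical
  have hJC : Ideal.span (Set.range fun j => f j ^ q) ≤ Ideal.span (Set.range f) := by
    rw [Ideal.span_le]
    rintro _ ⟨j, rfl⟩
    have hj : f j ∈ Ideal.span (Set.range f) := Ideal.subset_span ⟨j, rfl⟩
    exact Ideal.pow_mem_of_mem _ hj _ hq
  have hCgr : s6_gr w b (s6_vI r (Ideal.span (Set.range f))) := by
    intro n x hx
    obtain ⟨x, rfl⟩ := s6_vI_exp _ hx
    rw [map_sum]
    refine Submodule.sum_mem _ fun j _ => s6_mem_vI.2 fun m => ?_
    rw [s6_comp_smul' w b n (df j) _ _ (by simpa [extZ] using hf j)]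
    exact Ideal.mul_mem_right _ _ (Ideal.subset_span ⟨j, rfl⟩)
  let U : ℤ → Submodule (MvPolynomial σ k) (Fin r → MvPolynomial σ k) := fun D =>
    Submodule.span (MvPolynomial σ k) (z '' {j | g j < D}) ⊔ K
  have hUgr : ∀ D, s6_gr w b (U D) := fun D => s6_gr_sup w b (s6_gr_span w b _ (by
    rintro _ ⟨j, _, rfl⟩; exact ⟨g j, hz j⟩)) hK
  have hUJ : ∀ D, ∀ u ∈ U D, B u ∈ s6_vI r' (Ideal.span (Set.range fun j => f j ^ q)) := by
    intro D
    change U D ≤ (s6_vI r' (Ideal.span (Set.range fun j => f j ^ q))).comap B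
    refine sup_le (Submodule.span_le.2 ?_) ?_
    · rintro _ ⟨j, _, rfl⟩; exact hzJ j
    · intro u hu
      rw [Submodule.mem_comap, hKB u hu]; exact Submodule.zero_mem _
  have hUmono : ∀ D D', D ≤ D' → U D ≤ U D' := by
    intro D D' h
    refine sup_le_sup_right (Submodule.span_mono (Set.image_mono fun j hj => ?_)) _
    exact lt_of_lt_of_le hj h
  -- decomposition
  have hdec : ∀ n v, s6_hom w b n v → B v ∈ s6_vI r' (Ideal.span (Set.range f)) →
      ∃ a : Fin ℓ → MvPolynomial σ k,
        v - ∑ l, s6_hc w (n - g l) (a l) • y l ∈ K ⊔ s6_vI r (Ideal.span (Set.range f)) := by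
    intro n v hv hBv
    obtain ⟨x, hx, s, hs, rfl⟩ := Submodule.mem_sup.1 (hgen v hBv)
    obtain ⟨a, rfl⟩ := (Submodule.mem_span_range_iff_exists_fun _).1 hx
    refine ⟨a, ?_⟩
    have h1 := s6_comp_self w b n _ hv
    rw [map_add, map_sum] at h1
    rw [← h1]
    simp_rw [fun l => s6_comp_smul w b n (g l) (a l) (y l) (hy l)]
    rw [add_sub_cancel_left]
    exact s6_gr_sup w b hK hCgr n s hs
  have hKU : ∀ D, K ⊔ s6_vI r (Ideal.span (Set.range f)) ≤ U D ⊔ s6_vI r (Ideal.span (Set.range f)) :=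
    fun D => sup_le_sup_right le_sup_right _
  have hQ : ∃ D0 : ℤ, ∀ l, D0 ≤ g l := by
    obtain ⟨D0, h⟩ := (Set.finite_range g).bddBelow
    exact ⟨D0, fun l => h ⟨l, rfl⟩⟩
  obtain ⟨D0, hD0⟩ := hQ
  have main : ∀ N : ℕ, ∀ l, g l < D0 + N → y l ∈ U (D0 + N) ⊔ s6_vI r (Ideal.span (Set.range f)) := by
    intro N
    induction N with
    | zero => intro l hl; have := hD0 l; simp at hl; omega
    | succ N ih =>
      set D := D0 + N with hD
      have hDD : D0 + ((N + 1 : ℕ) : ℤ) = D + 1 := by push_cast; omega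
      rw [hDD]
      have hmono : U D ⊔ s6_vI r (Ideal.span (Set.range f)) ≤
        U (D + 1) ⊔ s6_vI r (Ideal.span (Set.range f)) := sup_le_sup_right (hUmono _ _ (by omega)) _
      have H : ∀ n < D, ∀ x, s6_hom w b n x → B x ∈ s6_vI r' (Ideal.span (Set.range f)) →
          x ∈ U D ⊔ s6_vI r (Ideal.span (Set.range f)) := by
        intro n hn x hx hBx
        obtain ⟨a, ha⟩ := hdec n x hx hBx
        rw [← sub_add_cancel x (∑ l, s6_hc w (n - g l) (a l) • y l)]
        refine Submodule.add_mem _ (hKU D ha) (Submodule.sum_mem _ fun l _ => ?_)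
        by_cases hl : g l < D
        · exact Submodule.smul_mem _ _ (ih l hl)
        · rw [s6_hc_neg w _ (by omega), zero_smul]; exact Submodule.zero_mem _
      let I := {j : Fin ℓ // g j = D}
      have hM : ∀ j : I, ∃ m : I → k,
          z j - ∑ l : I, m l • y l ∈ U D ⊔ s6_vI r (Ideal.span (Set.range f)) := by
        intro j
        have hzj := hz j
        rw [j.2] at hzj
        obtain ⟨a, ha⟩ := hdec D (z j) hzj (s6_vI_mono hJC (hzJ j))
        refine ⟨fun l => coeff 0 (a l), ?_⟩
        have h2 : ∑ l, s6_hc w (D - g l) (a l) • y l -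
            ∑ l : I, coeff 0 (a l) • y l ∈ U D ⊔ s6_vI r (Ideal.span (Set.range f)) := by
          have h3 : ∑ l : I, coeff 0 (a l) • y l =
              ∑ l, if g l = D then coeff 0 (a l) • y l else 0 := by
            rw [← Finset.sum_filter]
            exact (Finset.sum_subtype (univ.filter fun l => g l = D) (by simp)
              (fun l => coeff 0 (a l) • y l)).symm
          rw [h3, ← Finset.sum_sub_distrib]
          refine Submodule.sum_mem _ fun l _ => ?_
          rcases lt_trichotomy (g l) D with h | h | h
          · rw [if_neg h.ne, sub_zero]
            exact Submodule.smul_mem _ _ (ih l h)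
          · rw [if_pos h, h, sub_self, s6_hc_zero w hw]
            have : (C (coeff 0 (a l)) : MvPolynomial σ k) • y l = coeff 0 (a l) • y l := by
              ext1 i
              simp [MvPolynomial.smul_eq_C_mul]
            rw [this, sub_self]; exact Submodule.zero_mem _
          · rw [if_neg h.ne', s6_hc_neg w _ (by omega), zero_smul, sub_zero]
            exact Submodule.zero_mem _
        have := Submodule.add_mem _ (hKU D ha) h2
        simpa using this
      choose m hm using hM
      let Mx : Matrix I I k := Matrix.of m
      have hdet : IsUnit Mx.det := by
        rw [isUnit_iff_ne_zero]
        intro h0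
        obtain ⟨x, hx0, hx⟩ := Matrix.exists_vecMul_eq_zero_iff.2 h0
        obtain ⟨j0, hj0⟩ : ∃ j, x j ≠ 0 := by
          by_contra! h
          exact hx0 (funext h)
        let v := ∑ j : I, x j • z j
        have hvU : v ∈ U D ⊔ s6_vI r (Ideal.span (Set.range f)) := by
          have h1 : ∑ j : I, x j • (z j - ∑ l : I, m j l • y l) ∈
              U D ⊔ s6_vI r (Ideal.span (Set.range f)) :=
            Submodule.sum_mem _ fun j _ => Submodule.smul_of_tower_mem _ _ (hm j)
          have h2 : ∑ j : I, x j • ∑ l : I, m j l • y l = 0 := by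
            simp_rw [Finset.smul_sum, smul_smul]
            rw [Finset.sum_comm]
            refine Finset.sum_eq_zero fun l _ => ?_
            rw [← Finset.sum_smul]
            have := congrFun hx l
            simp only [Matrix.vecMul, dotProduct, Mx, Matrix.of_apply] at this
            rw [this]; simp
          simp_rw [smul_sub] at h1
          rw [Finset.sum_sub_distrib, h2, sub_zero] at h1
          exact h1
        have hvhom : s6_hom w b D v := by
          intro i
          simp only [v, Finset.sum_apply, Pi.smul_apply]
          refine Submodule.sum_mem _ fun j _ => Submodule.smul_mem _ _ ?_
          have := hz j i
          rwa [j.2] at this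
        have hvJ : B v ∈ s6_vI r' (Ideal.span (Set.range fun j => f j ^ q)) := by
          change v ∈ (s6_vI r' (Ideal.span (Set.range fun j => f j ^ q))).comap B
          exact Submodule.sum_mem _ fun j _ => Submodule.smul_of_tower_mem _ _ (hzJ j)
        have hv2 := s6_claim w b f df hdf hf hreg B q (U D) (hUgr D) (hUJ D) D H _
          (fun _ => q) (fun _ => hq) (fun _ => le_rfl) le_rfl D le_rfl v hvhom hvJ hvU
        apply hmin j0
        set T := Submodule.span (MvPolynomial σ k) (z '' {j | j ≠ (j0 : Fin ℓ)}) ⊔ K ⊔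
          s6_vI r (Ideal.span (Set.range fun j => f j ^ q)) with hT
        have hUT : U D ≤ Submodule.span (MvPolynomial σ k) (z '' {j | j ≠ (j0 : Fin ℓ)}) ⊔ K := by
          refine sup_le_sup_right (Submodule.span_mono (Set.image_mono fun j hj => ?_)) _
          rintro rfl
          have h1 : g j0 < D := hj
          have h2 := j0.2
          omega
        have hvT : v ∈ T := sup_le_sup_right hUT _ hv2
        have hrest : ∑ j ∈ univ.erase j0, x j • z j ∈ T := by
          refine Submodule.sum_mem _ fun j hj => Submodule.smul_of_tower_mem _ _ ?_
          refine Submodule.mem_sup_left (Submodule.mem_sup_left (Submodule.subset_span ⟨j, ?_, rfl⟩))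
          intro h
          exact Finset.ne_of_mem_erase hj (Subtype.ext h)
        have hz0 : x j0 • z j0 ∈ T := by
          have : x j0 • z j0 = v - ∑ j ∈ univ.erase j0, x j • z j := by
            rw [eq_sub_iff_add_eq]
            exact Finset.add_sum_erase _ (fun j : I => x j • z j) (Finset.mem_univ j0)
          rw [this]
          exact Submodule.sub_mem _ hvT hrest
        have := Submodule.smul_of_tower_mem T (x j0)⁻¹ hz0
        rwa [smul_smul, inv_mul_cancel₀ hj0, one_smul] at this
      intro l hl
      rcases lt_or_eq_of_le (show g l ≤ D by omega) with h | h
      · exact hmono (ih l h)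
      · let l' : I := ⟨l, h⟩
        have hinv : Mx⁻¹ * Mx = 1 := Matrix.nonsing_inv_mul _ hdet
        have hyl : y l = ∑ j : I, Mx⁻¹ l' j • ∑ i : I, m j i • y i := by
          simp_rw [Finset.smul_sum, smul_smul]
          rw [Finset.sum_comm]
          simp_rw [← Finset.sum_smul]
          have : ∀ i, ∑ j : I, Mx⁻¹ l' j * m j i = if l' = i then 1 else 0 := by
            intro i
            have := congrFun (congrFun hinv l') i
            rw [Matrix.mul_apply, Matrix.one_apply] at this
            exact this
          simp_rw [this]
          simp_rw [ite_smul, one_smul, zero_smul]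
          rw [Finset.sum_ite_eq univ l' (fun i : I => y i), if_pos (Finset.mem_univ _)]
        rw [hyl]
        refine Submodule.sum_mem _ fun j _ => Submodule.smul_of_tower_mem _ _ ?_
        have h1 := hmono (hm j)
        have h2 : z j ∈ U (D + 1) ⊔ s6_vI r (Ideal.span (Set.range f)) := by
          refine Submodule.mem_sup_left (Submodule.mem_sup_left (Submodule.subset_span ⟨j, ?_, rfl⟩))
          have := j.2
          change g j < D + 1
          omega
        have := Submodule.sub_mem _ h2 h1
        rwa [sub_sub_cancel] at this
  have hyall : ∀ l, y l ∈ Submodule.span (MvPolynomial σ k) (Set.range z) ⊔ K ⊔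
      s6_vI r (Ideal.span (Set.range f)) := by
    intro l
    have h1 := main (g l + 1 - D0).toNat l (by have := hD0 l; omega)
    have h2 : U (D0 + ((g l + 1 - D0).toNat : ℤ)) ≤
        Submodule.span (MvPolynomial σ k) (Set.range z) ⊔ K :=
      sup_le_sup_right (Submodule.span_mono (Set.image_subset_range _ _)) _
    exact (sup_le_sup_right h2 (s6_vI r (Ideal.span (Set.range f)))) h1
  intro v hv
  suffices hfin : Submodule.span (MvPolynomial σ k) (Set.range y) ⊔
      (K ⊔ s6_vI r (Ideal.span (Set.range f))) ≤
      Submodule.span (MvPolynomial σ k) (Set.range z) ⊔ K ⊔ s6_vI r (Ideal.span (Set.range f)) from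
    hfin (hgen v hv)
  refine sup_le (Submodule.span_le.2 ?_) ?_
  · rintro _ ⟨l, rfl⟩; exact hyall l
  · exact sup_le_sup_right le_sup_right _
end MainPart2
section LiftPart

theorem s6_lift {k P : Type} [Field k] [CommRing P] [Algebra k P] (𝒜 : ℕ → Submodule k P)
    (C : Ideal P) (d : ℤ) (x : P ⧸ C) (hx : x ∈ extZ (quotPieces 𝒜 C) d) :
    ∃ y ∈ extZ 𝒜 d, Ideal.Quotient.mk C y = x := by
  unfold extZ at hx ⊢
  split_ifs at hx ⊢ with h
  · obtain ⟨y, hy, rfl⟩ := hx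
    exact ⟨y, hy, rfl⟩
  · rw [Submodule.mem_bot] at hx
    exact ⟨0, Submodule.zero_mem _, by rw [hx, map_zero]⟩

theorem s6_red_mulVec {P : Type} [CommRing P] (C : Ideal P) {m n : ℕ}
    (A : Matrix (Fin m) (Fin n) P) (v : Fin n → P) :
    (redMat C A).mulVec (fun j => Ideal.Quotient.mk C (v j)) =
      fun i => Ideal.Quotient.mk C (A.mulVec v i) := by
  ext1 i
  simp [redMat, Matrix.mulVec, dotProduct, map_sum, map_mul]

theorem s6_gen_lift {P : Type} [CommRing P] (C : Ideal P) {m n s ℓ : ℕ}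
    (A0 : Matrix (Fin m) (Fin n) P) (A1 : Matrix (Fin n) (Fin s) P)
    (z : Fin ℓ → ↥(LinearMap.ker (Matrix.mulVecLin (redMat C A0))))
    (y : Fin ℓ → Fin n → P) (hy : ∀ i j, Ideal.Quotient.mk C (y i j) = (z i).1 j)
    (hmin : IsMinGenSet (R := P ⧸ C)
        (fun i =>
          Submodule.mkQ
            (Submodule.comap
              (LinearMap.ker (Matrix.mulVecLin (redMat C A0))).subtype
              (LinearMap.range (Matrix.mulVecLin (redMat C A1)))) (z i)) ⊤) :
    (∀ v, A0.mulVecLin v ∈ s6_vI m C → v ∈ Submodule.span P (Set.range y) ⊔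
      (LinearMap.range A1.mulVecLin ⊔ s6_vI n C)) ∧
    (∀ i, y i ∉ Submodule.span P (y '' {j | j ≠ i}) ⊔ LinearMap.range A1.mulVecLin ⊔ s6_vI n C) := by
  obtain ⟨hgen, hmin⟩ := hmin
  constructor
  · intro v hv
    rw [s6_mem_vI] at hv
    have hv' : (fun j => Ideal.Quotient.mk C (v j)) ∈
        LinearMap.ker (Matrix.mulVecLin (redMat C A0)) := by
      rw [LinearMap.mem_ker, Matrix.mulVecLin_apply, s6_red_mulVec]
      ext1 i
      exact Ideal.Quotient.eq_zero_iff_mem.2 (hv i)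
    let vb : ↥(LinearMap.ker (Matrix.mulVecLin (redMat C A0))) := ⟨_, hv'⟩
    have h1 : Submodule.mkQ
            (Submodule.comap
              (LinearMap.ker (Matrix.mulVecLin (redMat C A0))).subtype
              (LinearMap.range (Matrix.mulVecLin (redMat C A1)))) vb ∈
          (⊤ : Submodule (P ⧸ C) _) := Submodule.mem_top
    rw [← hgen, Submodule.mem_span_range_iff_exists_fun] at h1
    obtain ⟨c, hc⟩ := h1
    simp_rw [← map_smul] at hc
    rw [← map_sum, ← sub_eq_zero, ← map_sub, Submodule.mkQ_apply, Submodule.Quotient.mk_eq_zero,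
      Submodule.mem_comap] at hc
    obtain ⟨u, hu⟩ := hc
    choose c' hc' using fun i => Ideal.Quotient.mk_surjective (c i)
    choose u' hu' using fun i => Ideal.Quotient.mk_surjective (u i)
    have hx : v - ∑ i, c' i • y i + A1.mulVecLin u' ∈ s6_vI n C := by
      rw [s6_mem_vI]
      intro j
      rw [← Ideal.Quotient.eq_zero_iff_mem]
      have h2 := congrFun hu j
      have h3 : u = fun i => Ideal.Quotient.mk C (u' i) := funext fun i => (hu' i).symm
      rw [h3, Matrix.mulVecLin_apply, s6_red_mulVec] at h2
      simp only [Pi.add_apply, Pi.sub_apply, Finset.sum_apply, Pi.smul_apply, smul_eq_mul, map_add,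
        map_sub, map_sum, map_mul, hy, hc', Matrix.mulVecLin_apply]
      have h2' : Ideal.Quotient.mk C (A1.mulVec u' j) = _ := h2
      rw [h2']
      simp [vb, Finset.sum_apply]
    have he : v = ∑ i, c' i • y i + (A1.mulVecLin (-u') +
        (v - ∑ i, c' i • y i + A1.mulVecLin u')) := by
      rw [map_neg]; abel
    rw [he]
    refine Submodule.add_mem_sup ?_ (Submodule.add_mem_sup ⟨_, rfl⟩ hx)
    exact Submodule.sum_mem _ fun i _ => Submodule.smul_mem _ _ (Submodule.subset_span ⟨i, rfl⟩)
  · intro i hi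
    apply hmin i
    obtain ⟨a, ha, x, hx, hax⟩ := Submodule.mem_sup.1 hi
    obtain ⟨t, ht, _, ⟨u, rfl⟩, rfl⟩ := Submodule.mem_sup.1 ha
    have key : ∀ t ∈ Submodule.span P (y '' {j | j ≠ i}),
        ∃ tb : ↥(LinearMap.ker (Matrix.mulVecLin (redMat C A0))),
          (∀ j, tb.1 j = Ideal.Quotient.mk C (t j)) ∧
          Submodule.mkQ
            (Submodule.comap
              (LinearMap.ker (Matrix.mulVecLin (redMat C A0))).subtype
              (LinearMap.range (Matrix.mulVecLin (redMat C A1)))) tb ∈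
          Submodule.span (P ⧸ C) ((fun i =>
          Submodule.mkQ
            (Submodule.comap
              (LinearMap.ker (Matrix.mulVecLin (redMat C A0))).subtype
              (LinearMap.range (Matrix.mulVecLin (redMat C A1)))) (z i)) '' {j | j ≠ i}) := by
      intro t ht
      induction ht using Submodule.closure_induction with
      | zero => exact ⟨0, by simp, by rw [map_zero]; exact Submodule.zero_mem _⟩
      | add x y _ _ hx hy =>
        obtain ⟨xb, h1, h2⟩ := hx
        obtain ⟨yb, h3, h4⟩ := hy
        refine ⟨xb + yb, by simp [h1, h3], ?_⟩
        rw [map_add]; exact Submodule.add_mem _ h2 h4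
      | smul_mem c x hx =>
        obtain ⟨j, hj, rfl⟩ := hx
        refine ⟨Ideal.Quotient.mk C c • z j, ?_, ?_⟩
        · intro j'
          simp [hy]
        · rw [map_smul]
          exact Submodule.smul_mem _ _ (Submodule.subset_span ⟨j, hj, rfl⟩)
    obtain ⟨tb, h1, h2⟩ := key t ht
    have h3 : Submodule.mkQ
            (Submodule.comap
              (LinearMap.ker (Matrix.mulVecLin (redMat C A0))).subtype
              (LinearMap.range (Matrix.mulVecLin (redMat C A1)))) (z i) =
            Submodule.mkQ
            (Submodule.comap
              (LinearMap.ker (Matrix.mulVecLin (redMat C A0))).subtype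
              (LinearMap.range (Matrix.mulVecLin (redMat C A1)))) tb := by
      rw [← sub_eq_zero, ← map_sub, Submodule.mkQ_apply, Submodule.Quotient.mk_eq_zero,
        Submodule.mem_comap]
      refine ⟨fun j => Ideal.Quotient.mk C (u j), ?_⟩
      rw [Matrix.mulVecLin_apply, s6_red_mulVec]
      ext1 j
      have h4 := congrArg (Ideal.Quotient.mk C) (congrFun hax j)
      rw [hy] at h4
      have h5 : Ideal.Quotient.mk C (x j) = 0 := Ideal.Quotient.eq_zero_iff_mem.2 (s6_mem_vI.1 hx j)
      simp only [Pi.add_apply, map_add, h5, add_zero] at h4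
      simp only [Submodule.subtype_apply, Submodule.coe_sub, Pi.sub_apply, h1, ← h4]
      simp
    simp only [h3]
    exact h2

open TensorProduct in
theorem s6_tens {R : Type} [CommRing R] {n m : ℕ} (N : Type) [AddCommGroup N] [Module R N]
    (f : (Fin n → R) →ₗ[R] (Fin m → R)) {ι : Type} [Fintype ι] (t : ι → LinearMap.ker f)
    (h : ∀ v : Fin n → N, (∀ i, ∑ j, f (Pi.single j 1) i • v j = 0) →
      ∃ c : ι → N, ∀ j, v j = ∑ i, (t i).1 j • c i) :
    ∀ x : (Fin n → R) ⊗[R] N, f.rTensor N x = 0 →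
      ∃ y : (LinearMap.ker f) ⊗[R] N, (LinearMap.ker f).subtype.rTensor N y = x := by
  classical
  have hsm : ∀ (v : Fin n → R) (c : N),
      v ⊗ₜ[R] c = ∑ j, (Pi.single j (1 : R) : Fin n → R) ⊗ₜ[R] (v j • c) := by
    intro v c
    simp_rw [← TensorProduct.smul_tmul, ← TensorProduct.sum_tmul]
    congr 1
    ext1 j
    simp [Finset.sum_apply, Pi.single_apply]
  have hx : ∀ x : (Fin n → R) ⊗[R] N, ∃ v : Fin n → N,
      x = ∑ j, (Pi.single j (1 : R) : Fin n → R) ⊗ₜ[R] v j := by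
    intro x
    induction x using TensorProduct.induction_on with
    | zero => exact ⟨0, by simp⟩
    | tmul v c => exact ⟨fun j => v j • c, hsm v c⟩
    | add x y hx hy =>
      obtain ⟨v, rfl⟩ := hx
      obtain ⟨v', rfl⟩ := hy
      exact ⟨v + v', by simp [TensorProduct.tmul_add, Finset.sum_add_distrib]⟩
  intro x hfx
  obtain ⟨v, rfl⟩ := hx x
  obtain ⟨c, hc⟩ := h v (by
    intro i
    have := congrArg (fun y => TensorProduct.lid R N ((LinearMap.proj i : (Fin m → R) →ₗ[R] R).rTensor N y)) hfx
    simpa [map_sum] using this)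
  refine ⟨∑ i, t i ⊗ₜ[R] c i, ?_⟩
  simp only [map_sum, LinearMap.rTensor_tmul, Submodule.subtype_apply]
  simp_rw [fun i => hsm (t i).1 (c i)]
  rw [Finset.sum_comm]
  refine Finset.sum_congr rfl fun j _ => ?_
  rw [hc j, TensorProduct.tmul_sum]
end LiftPart
section FinPart
open MvPolynomial

theorem s6_frob_mulVec {P : Type} [CommRing P] (p : ℕ) [ExpChar P p] (e : ℕ) {m n : ℕ}
    (A : Matrix (Fin m) (Fin n) P) (v : Fin n → P) :
    (A.map (· ^ p ^ e)).mulVec (fun j => v j ^ p ^ e) = fun i => (A.mulVec v i) ^ p ^ e := by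
  ext1 i
  simp only [Matrix.mulVec, dotProduct, Matrix.map_apply]
  rw [← iterateFrobenius_def, map_sum]
  simp [iterateFrobenius_def, mul_pow]

theorem s6_pow_mem {P : Type} [CommRing P] (p : ℕ) [ExpChar P p] (e : ℕ) {c : ℕ}
    (f : Fin c → P) (x : P) (hx : x ∈ Ideal.span (Set.range f)) :
    x ^ p ^ e ∈ Ideal.span (Set.range fun j => f j ^ p ^ e) := by
  rw [Ideal.span, Submodule.mem_span_range_iff_exists_fun] at hx
  obtain ⟨d, rfl⟩ := hx
  rw [← iterateFrobenius_def, map_sum]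
  refine Submodule.sum_mem _ fun j _ => ?_
  rw [smul_eq_mul, map_mul]
  exact Ideal.mul_mem_left _ _ (Ideal.subset_span ⟨j, rfl⟩)

theorem s6_minz {P : Type} [CommRing P] (p e : ℕ) (π : P →+ P)
    (hπ : ∀ a b, π (a ^ p ^ e * b) = a * π b) (h1 : π 1 = 1) {n s ℓ c : ℕ}
    (f : Fin c → P) (A1 : Matrix (Fin n) (Fin s) P) (y : Fin ℓ → Fin n → P) (i : Fin ℓ)
    (hy : y i ∉ Submodule.span P (y '' {j | j ≠ i}) ⊔ LinearMap.range A1.mulVecLin ⊔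
      s6_vI n (Ideal.span (Set.range f))) :
    (fun j => y i j ^ p ^ e) ∉
      Submodule.span P ((fun (l : Fin ℓ) (j : Fin n) => y l j ^ p ^ e) '' {j | j ≠ i}) ⊔
      LinearMap.range (A1.map (· ^ p ^ e)).mulVecLin ⊔
      s6_vI n (Ideal.span (Set.range fun j => f j ^ p ^ e)) := by
  intro hi
  apply hy
  obtain ⟨a, ha, x, hx, hax⟩ := Submodule.mem_sup.1 hi
  obtain ⟨t, ht, _, ⟨u, rfl⟩, rfl⟩ := Submodule.mem_sup.1 ha
  obtain ⟨x, rfl⟩ := s6_vI_exp _ hx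
  have h2 : y i = (fun j => π (t j)) + A1.mulVecLin (fun l => π (u l)) +
      ∑ l, f l • (fun j => π (x l j)) := by
    ext1 j
    have h3 := congrArg π (congrFun hax j)
    have h4 : π (y i j ^ p ^ e) = y i j := by
      have := hπ (y i j) 1
      rwa [mul_one, h1, mul_one] at this
    rw [h4] at h3
    rw [← h3]
    simp only [Pi.add_apply, map_add, Matrix.mulVecLin_apply, Matrix.mulVec, dotProduct,
      Matrix.map_apply, map_sum, hπ, Finset.sum_apply, Pi.smul_apply, smul_eq_mul]
  rw [h2]
  refine Submodule.add_mem_sup (Submodule.add_mem_sup ?_ ⟨_, rfl⟩) ?_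
  · clear hax hi ha h2
    induction ht using Submodule.closure_induction with
    | zero =>
      have : (fun j => π ((0 : Fin n → P) j)) = 0 := by ext1 j; simp
      rw [this]; exact Submodule.zero_mem _
    | add x y _ _ hx hy =>
      have : (fun j => π ((x + y) j)) = (fun j => π (x j)) + (fun j => π (y j)) := by
        ext1 j; simp
      rw [this]; exact Submodule.add_mem _ hx hy
    | smul_mem c x hx =>
      obtain ⟨l, hl, rfl⟩ := hx
      have : (fun j => π ((c • fun j => y l j ^ p ^ e) j)) = π c • y l := by
        ext1 j
        simp only [Pi.smul_apply, smul_eq_mul]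
        rw [mul_comm, hπ, mul_comm]
      simp only at this ⊢
      rw [this]
      exact Submodule.smul_mem _ _ (Submodule.subset_span ⟨l, hl, rfl⟩)
  · refine Submodule.sum_mem _ fun l _ => s6_mem_vI.2 fun j => ?_
    exact Ideal.mul_mem_right _ _ (Ideal.subset_span ⟨l, rfl⟩)
end FinPart

/-- **Proposition 3.1.** Let `P → R = P/C` be a surjection of graded `k`-algebras with `P` a
polynomial ring and `R` a complete intersection, and `M` a finitely generated graded
`P`-module (given via its minimal homogeneous free resolution `(r, bz, A, ε)`).  Suppose
the minimal homogeneous generators of `Tor_1^P(M, R) = ker(Ā 0)/im(Ā 1)` have degrees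
`γ 0, …, γ (ℓ-1)`.  If the minimal homogeneous generators of
`Tor_1^P(F_P^e(M), R) = ker(Ā 0^{[q]})/im(Ā 1^{[q]})` have degrees `q·γ i`, then
`Tor_1^R(M ⊗_P R, ^{φ_R^e}R) = 0`. -/
theorem socle_degrees_stmt6
    {k : Type} [Field k] (p : ℕ) [Fact p.Prime] [CharP k p]
    {σ : Type} [Fintype σ] (w : σ → ℕ) (hw : ∀ i, 0 < w i)
    (e : ℕ) (q : ℕ) (hq : q = p ^ e)
    (c : ℕ) (f : Fin c → MvPolynomial σ k) (df : Fin c → ℕ)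
    (hreg : RingTheory.Sequence.IsRegular (MvPolynomial σ k) (List.ofFn f))
    (hf : ∀ i, f i ∈ MvPolynomial.weightedHomogeneousSubmodule k w (df i))
    (C : Ideal (MvPolynomial σ k)) (hC : C = Ideal.span (Set.range f))
    [CharP (MvPolynomial σ k ⧸ C) p]
    (M : Type) [AddCommGroup M] [Module (MvPolynomial σ k) M] [Module k M]
    [IsScalarTower k (MvPolynomial σ k) M] [Module.Finite (MvPolynomial σ k) M]
    (ℳ : ℤ → Submodule k M)
    (r : ℕ → ℕ) (bz : (i : ℕ) → Fin (r i) → ℤ)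
    (A : (i : ℕ) → Matrix (Fin (r i)) (Fin (r (i + 1))) (MvPolynomial σ k))
    (ε : (Fin (r 0) → MvPolynomial σ k) →ₗ[MvPolynomial σ k] M)
    (hres : IsMinGradedFreeResolutionOf
      (MvPolynomial.weightedHomogeneousSubmodule k w) ℳ r bz A ε)
    {ℓ : ℕ} (γ : Fin ℓ → ℤ) (hγmono : Monotone γ)
    -- the minimal generators of `Tor_1^P(M, R)` have degrees `γ i`
    (hγ : ∃ z : Fin ℓ →
        ↥(LinearMap.ker (Matrix.mulVecLin (redMat C (A 0)))),
      (∀ i, (z i : Fin (r 1) → MvPolynomial σ k ⧸ C) ∈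
        freePieceZ (extZ (quotPieces (MvPolynomial.weightedHomogeneousSubmodule k w) C))
          (bz 1) (γ i)) ∧
      IsMinGenSet (R := MvPolynomial σ k ⧸ C)
        (fun i =>
          Submodule.mkQ
            (Submodule.comap
              (LinearMap.ker (Matrix.mulVecLin (redMat C (A 0)))).subtype
              (LinearMap.range (Matrix.mulVecLin (redMat C (A 1))))) (z i)) ⊤)
    -- the minimal generators of `Tor_1^P(F_P^e M, R)` have degrees `q·γ i`
    (hΓ : ∃ z : Fin ℓ →
        ↥(LinearMap.ker (Matrix.mulVecLin (redMat C ((A 0).map (· ^ q))))),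
      (∀ i, (z i : Fin (r 1) → MvPolynomial σ k ⧸ C) ∈
        freePieceZ (extZ (quotPieces (MvPolynomial.weightedHomogeneousSubmodule k w) C))
          (fun j => q * bz 1 j) ((q : ℤ) * γ i)) ∧
      IsMinGenSet (R := MvPolynomial σ k ⧸ C)
        (fun i =>
          Submodule.mkQ
            (Submodule.comap
              (LinearMap.ker (Matrix.mulVecLin (redMat C ((A 0).map (· ^ q))))).subtype
              (LinearMap.range (Matrix.mulVecLin (redMat C ((A 1).map (· ^ q)))))) (z i)) ⊤) :
    Subsingleton
      (TorM (MvPolynomial σ k ⧸ C) 1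
        (ModuleCat.of (MvPolynomial σ k ⧸ C)
          ((Fin (r 0) → MvPolynomial σ k ⧸ C) ⧸
            LinearMap.range (Matrix.mulVecLin (redMat C (A 0)))))
        (frobMod (MvPolynomial σ k ⧸ C) p e)) := by
  classical
  subst hq
  subst hC
  have hq0 : 0 < p ^ e := Nat.pow_pos (Fact.out : p.Prime).pos
  obtain ⟨hA, -, hex, -, -, -⟩ := hres
  have hCtop : Ideal.span (Set.range f) ≠ ⊤ := by
    have hnt : Nontrivial (MvPolynomial σ k ⧸ Ideal.span (Set.range f)) :=
      CharP.nontrivial_of_char_ne_one (v := p) (Fact.out : p.Prime).ne_one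
    exact Ideal.Quotient.nontrivial_iff.1 hnt
  -- positive degrees
  have hdf : ∀ i, ∃ d, 0 < d ∧ f i ∈ MvPolynomial.weightedHomogeneousSubmodule k w d := by
    intro i
    by_cases h0 : df i = 0
    · refine ⟨1, one_pos, ?_⟩
      have h1 : f i ∈ extZ (MvPolynomial.weightedHomogeneousSubmodule k w) 0 := by
        have := hf i
        rw [h0] at this
        simpa [extZ] using this
      have h2 := s6_hc_self w 0 (f i) h1
      rw [s6_hc_zero w hw] at h2
      by_cases h3 : MvPolynomial.coeff 0 (f i) = 0
      · rw [h3, map_zero] at h2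
        rw [← h2]; exact Submodule.zero_mem _
      · exfalso
        apply hCtop
        refine Ideal.eq_top_of_isUnit_mem _ (Ideal.subset_span ⟨i, rfl⟩) ?_
        rw [← h2]
        exact (isUnit_iff_ne_zero.2 h3).map MvPolynomial.C
    · exact ⟨df i, Nat.pos_of_ne_zero h0, hf i⟩
  choose df' hdf' hf' using hdf
  obtain ⟨z, hzdeg, hzmin⟩ := hγ
  obtain ⟨y, hydeg, hymin⟩ := hΓ
  choose zt hzt1 hzt2 using fun i j => s6_lift _ _ _ _ (hzdeg i j (Set.mem_univ j))
  choose yt hyt1 hyt2 using fun i j => s6_lift _ _ _ _ (hydeg i j (Set.mem_univ j))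
  obtain ⟨-, hzm⟩ := s6_gen_lift _ (A 0) (A 1) z zt hzt2 hzmin
  obtain ⟨hyg, -⟩ := s6_gen_lift _ ((A 0).map (· ^ p ^ e)) ((A 1).map (· ^ p ^ e)) y yt hyt2 hymin
  obtain ⟨π, hπ, hπ1⟩ := s6_split (k := k) (σ := σ) p e
  have hztC : ∀ i, (A 0).mulVec (zt i) ∈ s6_vI (r 0) (Ideal.span (Set.range f)) := by
    intro i
    rw [s6_mem_vI]
    intro j
    rw [← Ideal.Quotient.eq_zero_iff_mem]
    have h1 := (z i).2
    rw [LinearMap.mem_ker, Matrix.mulVecLin_apply] at h1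
    have h2 : (z i).1 = fun j => Ideal.Quotient.mk _ (zt i j) := funext fun j => (hzt2 i j).symm
    rw [h2, s6_red_mulVec] at h1
    exact congrFun h1 j
  have hA01 : ∀ u, (A 0).mulVec ((A 1).mulVec u) = 0 := fun u => (hex 0).apply_apply_eq_zero u
  have hmul : A 0 * A 1 = 0 := by
    refine Matrix.ext fun i j => ?_
    have := congrFun (hA01 (Pi.single j 1)) i
    rw [Matrix.mulVec_mulVec] at this
    simpa using this
  have hmulq : (A 0).map (· ^ p ^ e) * (A 1).map (· ^ p ^ e) = 0 := by
    have h1 : ∀ (a b : ℕ) (X : Matrix (Fin a) (Fin b) (MvPolynomial σ k)),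
      X.map (· ^ p ^ e) = X.map (iterateFrobenius (MvPolynomial σ k) p e) := fun _ _ _ => rfl
    rw [h1, h1, ← Matrix.map_mul, hmul]
    ext1 i j
    simp
  have main := s6_main w hw (fun j => ((p ^ e : ℕ) : ℤ) * bz 1 j) f df' hdf' hf'
    hreg.toIsWeaklyRegular ((A 0).map (· ^ p ^ e)).mulVecLin (p ^ e) hq0
    (LinearMap.range ((A 1).map (· ^ p ^ e)).mulVecLin)
    (by
      rw [Matrix.range_mulVecLin]
      refine s6_gr_span w _ _ ?_
      rintro _ ⟨l, rfl⟩
      exact ⟨((p ^ e : ℕ) : ℤ) * bz 2 l, s6_hom_pow w (bz 1) hq0 (x := fun j => A 1 j l)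
        (fun j => hA 1 j l)⟩)
    (by
      rintro _ ⟨u, rfl⟩
      rw [Matrix.mulVecLin_apply, Matrix.mulVecLin_apply, Matrix.mulVec_mulVec, hmulq,
        Matrix.zero_mulVec])
    (fun i => ((p ^ e : ℕ) : ℤ) * γ i) (fun i j => zt i j ^ p ^ e) yt
    (fun i => s6_hom_pow w (bz 1) hq0 (fun j => hzt1 i j))
    (fun i j => hyt1 i j)
    (by
      intro i
      rw [Matrix.mulVecLin_apply, s6_frob_mulVec]
      exact s6_mem_vI.2 fun j => s6_pow_mem p e f _ (s6_mem_vI.1 (hztC i) j))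
    hyg
    (fun i => s6_minz p e π hπ hπ1 f (A 1) zt i (hzm i))
  have hcol : ∀ l : Fin (r 2), (fun j => redMat (Ideal.span (Set.range f)) (A 1) j l) ∈
      LinearMap.ker (Matrix.mulVecLin (redMat (Ideal.span (Set.range f)) (A 0))) := by
    intro l
    rw [LinearMap.mem_ker, Matrix.mulVecLin_apply]
    have := s6_red_mulVec (Ideal.span (Set.range f)) (A 0) (fun j => A 1 j l)
    refine Eq.trans this ?_
    ext1 i
    have h2 := congrFun (congrFun hmul i) l
    rw [Matrix.mul_apply] at h2
    have h3 : (A 0).mulVec (fun j => A 1 j l) i = 0 := h2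
    rw [h3]; simp
  unfold TorM
  refine s6_tor (Matrix.mulVecLin (redMat (Ideal.span (Set.range f)) (A 0))) _ ?_
  refine s6_tens _ _ (ι := Fin ℓ ⊕ Fin (r 2)) (Sum.elim z fun l => ⟨_, hcol l⟩) ?_
  intro v hv
  have hsm : ∀ (a : MvPolynomial σ k ⧸ Ideal.span (Set.range f))
      (x : frobMod (MvPolynomial σ k ⧸ Ideal.span (Set.range f)) p e),
      (a • x : frobMod (MvPolynomial σ k ⧸ Ideal.span (Set.range f)) p e) =
      (show MvPolynomial σ k ⧸ Ideal.span (Set.range f) from a ^ p ^ e *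
        (show MvPolynomial σ k ⧸ Ideal.span (Set.range f) from x)) := fun a x => rfl
  choose vt hvt using fun j => Ideal.Quotient.mk_surjective
    (show MvPolynomial σ k ⧸ Ideal.span (Set.range f) from v j)
  have hvt' : ((A 0).map (· ^ p ^ e)).mulVecLin vt ∈
      s6_vI (r 0) (Ideal.span (Set.range f)) := by
    rw [s6_mem_vI]
    intro i
    rw [← Ideal.Quotient.eq_zero_iff_mem]
    refine Eq.trans ?_ (hv i)
    simp only [Matrix.mulVecLin_apply, Matrix.mulVec, dotProduct, Matrix.map_apply, map_sum,
      map_mul, map_pow, hvt]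
    refine Finset.sum_congr rfl fun j _ => ?_
    rw [hsm]
    congr 2
    simp [redMat, Pi.single_apply]
  obtain ⟨a, ha, x, hx, hax⟩ := Submodule.mem_sup.1 (main vt hvt')
  obtain ⟨t, ht, _, ⟨u, rfl⟩, rfl⟩ := Submodule.mem_sup.1 ha
  obtain ⟨d, rfl⟩ := (Submodule.mem_span_range_iff_exists_fun _).1 ht
  refine ⟨fun i => show MvPolynomial σ k ⧸ Ideal.span (Set.range f) from
    Sum.elim (fun i => Ideal.Quotient.mk _ (d i)) (fun l => Ideal.Quotient.mk _ (u l)) i, ?_⟩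
  intro j
  refine (hvt j).symm.trans ?_
  rw [← hax, Fintype.sum_sum_type]
  have hx0 : Ideal.Quotient.mk (Ideal.span (Set.range f)) (x j) = 0 :=
    Ideal.Quotient.eq_zero_iff_mem.2 (s6_mem_vI.1 hx j)
  simp only [Pi.add_apply, map_add, hx0, add_zero, Finset.sum_apply, map_sum, Pi.smul_apply,
    smul_eq_mul, map_mul, map_pow, hzt2, Matrix.mulVecLin_apply, Matrix.mulVec, dotProduct,
    Matrix.map_apply]
  congr 1
  refine Finset.sum_congr rfl fun i _ => ?_
  exact mul_comm _ _
end

section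
/- Let P be a polynomial ring over a field of positive characteristic p with q = p^e, let q̲ : Q_2 → Q_1 be a homomorphism of graded free P-modules given by a matrix g, and let z be an element of Q_1 (a column vector). If z^{[q]} (the vector obtained by raising each entry of z to the q-th power) lies in the image of the map g^{[q]} : Q_2^{[q]} → Q_1^{[q]} given by raising each entry of g to the q-th power, then z lies in the image of q̲. -/
open Finset CategoryTheory

theorem aux_split {K L : Type} [Field K] [Field L] (φ : K →+* L) :
    ∃ l : L →+ K, l 1 = 1 ∧ ∀ c d, l (φ c * d) = c * l d := by
  letI := φ.toAlgebra
  obtain ⟨l, hl⟩ := (Algebra.linearMap K L).exists_leftInverse_of_injective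
    (LinearMap.ker_eq_bot.2 φ.injective)
  refine ⟨l.toAddMonoidHom, ?_, fun c d => ?_⟩
  · have := LinearMap.congr_fun hl 1
    simpa using this
  · have := l.map_smul c d
    rw [Algebra.smul_def] at this
    exact this

theorem aux_psi {k σ : Type} [Field k] (p : ℕ) [Fact p.Prime] [CharP k p] (e : ℕ) :
    ∃ ψ : MvPolynomial σ k →+ MvPolynomial σ k, ψ 1 = 1 ∧
      ∀ f h, ψ (f ^ p ^ e * h) = f * ψ h := by
  classical
  obtain ⟨l, hl1, hl⟩ := aux_split (iterateFrobenius k p e)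
  have hq : p ^ e ≠ 0 := pow_ne_zero _ (Fact.out : p.Prime).ne_zero
  have hle : ∀ s u : σ →₀ ℕ, p ^ e • s ≤ p ^ e • u ↔ s ≤ u := by
    intro s u
    simp only [Finsupp.le_def, Finsupp.smul_apply, smul_eq_mul]
    exact forall_congr' fun i => Nat.mul_le_mul_left_iff (Nat.pos_of_ne_zero hq)
  have hinj : Function.Injective (fun s : σ →₀ ℕ => p ^ e • s) := fun s u h =>
    le_antisymm ((hle _ _).1 h.le) ((hle _ _).1 h.ge)
  have key : ∀ h : MvPolynomial σ k, ∃ r : MvPolynomial σ k,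
      ∀ u, r.coeff u = l (h.coeff (p ^ e • u)) := by
    intro h
    refine ⟨∑ s ∈ h.support.preimage _ hinj.injOn,
      MvPolynomial.monomial s (l (h.coeff (p ^ e • s))), fun u => ?_⟩
    rw [MvPolynomial.coeff_sum]
    simp only [MvPolynomial.coeff_monomial]
    rw [Finset.sum_ite_eq']
    split_ifs with hu
    · rfl
    · simp only [Finset.mem_preimage, MvPolynomial.mem_support_iff, not_not] at hu
      rw [hu, map_zero]
  choose ψ hψ using key
  refine ⟨AddMonoidHom.mk' ψ fun a b => ?_, ?_, fun f h => ?_⟩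
  · ext u; simp [hψ]
  · ext u
    simp only [AddMonoidHom.mk'_apply, hψ, MvPolynomial.coeff_one]
    have : (0 = p ^ e • u) ↔ 0 = u := by
      constructor
      · intro h; exact hinj (by simpa using h)
      · rintro rfl; simp
    simp only [this]
    split_ifs <;> simp [hl1]
  · simp only [AddMonoidHom.mk'_apply]
    induction f using MvPolynomial.induction_on' with
    | monomial s c =>
      ext u
      rw [hψ, MvPolynomial.monomial_pow, MvPolynomial.coeff_monomial_mul',
        MvPolynomial.coeff_monomial_mul']
      simp only [hle]
      split_ifs with hs
      · have h1 : p ^ e • u - p ^ e • s = p ^ e • (u - s) := by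
          ext i; simp [Nat.mul_sub]
        rw [h1, hψ, ← hl, iterateFrobenius_def]
      · simp
    | add f f' hf hf' =>
      rw [add_pow_char_pow, add_mul, add_mul, ← hf, ← hf']
      ext u; simp [hψ]

/-- **Observation 3.7.** Let `P` be a positively graded polynomial ring over a field of
characteristic `p`, `g : Q₂ → Q₁` a homogeneous map of graded free `P`-modules given by a
matrix, and `z ∈ Q₁`.  If `z^{[q]}` lies in the image of `g^{[q]}`, then `z` lies in the
image of `g`. -/
theorem socle_degrees_stmt7
    {k : Type} [Field k] (p : ℕ) [Fact p.Prime] [CharP k p]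
    {σ : Type} [Fintype σ] (w : σ → ℕ) (hw : ∀ i, 0 < w i)
    (e : ℕ) (q : ℕ) (hq : q = p ^ e)
    (m n : ℕ) (b : Fin m → ℕ) (a : Fin n → ℕ)
    (g : Matrix (Fin n) (Fin m) (MvPolynomial σ k))
    (hg : ∀ i j, (a i ≤ b j ∧
        g i j ∈ MvPolynomial.weightedHomogeneousSubmodule k w (b j - a i)) ∨ g i j = 0)
    (z : Fin n → MvPolynomial σ k)
    (hz : (fun i => z i ^ q) ∈ LinearMap.range (Matrix.mulVecLin (g.map (· ^ q)))) :
    z ∈ LinearMap.range (Matrix.mulVecLin g) := by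
  subst hq
  obtain ⟨ψ, h1, h2⟩ := aux_psi (k := k) (σ := σ) p e
  obtain ⟨y, hy⟩ := hz
  refine ⟨fun j => ψ (y j), ?_⟩
  funext i
  have := congrArg ψ (congrFun hy i)
  have h3 : ψ (z i ^ p ^ e) = z i := by simpa [h1] using h2 (z i) 1
  rw [h3] at this
  rw [← this]
  simp [Matrix.mulVec, dotProduct, h2]
end

section
/- Let R be an artinian Gorenstein graded k-algebra whose socle is concentrated in degree δ, and let J be a homogeneous ideal of R. If the socle degrees of R/J are d_1, …, d_ℓ, then the minimal homogeneous generators of the annihilator ideal ann_R(J) = 0 : J have degrees δ − d_1, …, δ − d_ℓ. -/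
open Finset CategoryTheory

section Helpers
variable {k : Type} [Field k] {R : Type} [CommRing R] [Algebra k R]

/-- The elements of `Q` orthogonal to `P` for the form `φ (x * y)`. -/
def perpIn (φ : R →ₗ[k] k) (P Q : Submodule k R) : Submodule k R where
  carrier := {x | x ∈ Q ∧ ∀ y ∈ P, φ (x * y) = 0}
  add_mem' := by
    rintro a b ⟨ha, ha'⟩ ⟨hb, hb'⟩
    refine ⟨Q.add_mem ha hb, fun y hy => ?_⟩
    rw [add_mul, map_add, ha' y hy, hb' y hy, add_zero]
  zero_mem' := ⟨Q.zero_mem, fun y _ => by simp⟩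
  smul_mem' := by
    rintro c a ⟨ha, ha'⟩
    refine ⟨Q.smul_mem c ha, fun y hy => ?_⟩
    rw [smul_mul_assoc, map_smul, ha' y hy, smul_zero]

theorem mem_perpIn {φ : R →ₗ[k] k} {P Q : Submodule k R} {x : R} :
    x ∈ perpIn φ P Q ↔ x ∈ Q ∧ ∀ y ∈ P, φ (x * y) = 0 := Iff.rfl

theorem finrank_perpIn [FiniteDimensional k R] (φ : R →ₗ[k] k) (P Q : Submodule k R)
    (h : ∀ y ∈ P, y ≠ 0 → ∃ x ∈ Q, φ (x * y) ≠ 0) :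
    Module.finrank k (perpIn φ P Q) + Module.finrank k P = Module.finrank k Q := by
  let B : Q →ₗ[k] P →ₗ[k] k := ((LinearMap.mul k R).compr₂ φ).domRestrict₁₂ Q P
  have hB : ∀ x y, B x y = φ ((x : R) * y) := fun x y => rfl
  have hinj : Function.Injective B.flip := by
    rw [injective_iff_map_eq_zero]
    intro y hy
    by_contra hne
    obtain ⟨x, hx, hxy⟩ := h y y.2 (by simpa using hne)
    exact hxy (by simpa [hB] using LinearMap.congr_fun hy ⟨x, hx⟩)
  have hsurj : Function.Surjective B := LinearMap.flip_injective_iff₁.mp hinj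
  have h1 := B.finrank_range_add_finrank_ker
  rw [LinearMap.range_eq_top.mpr hsurj, finrank_top] at h1
  have h2 : Module.finrank k (P →ₗ[k] k) = Module.finrank k P := Subspace.dual_finrank_eq
  have h3 : Module.finrank k (LinearMap.ker B) = Module.finrank k (perpIn φ P Q) := by
    have : (LinearMap.ker B).map Q.subtype = perpIn φ P Q := by
      ext x
      constructor
      · rintro ⟨x, hx, rfl⟩
        refine ⟨x.2, fun y hy => ?_⟩
        exact LinearMap.congr_fun (LinearMap.mem_ker.mp hx) ⟨y, hy⟩
      · rintro ⟨hx, hx'⟩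
        refine ⟨⟨x, hx⟩, ?_, rfl⟩
        apply LinearMap.mem_ker.mpr
        ext y
        exact hx' y y.2
    rw [← this]
    exact (Submodule.equivMapOfInjective _ Q.injective_subtype (LinearMap.ker B)).finrank_eq
  omega

theorem exists_form (𝒜 : ℕ → Submodule k R) [GradedAlgebra 𝒜] [FiniteDimensional k R]
    (δ : ℕ) (hGor : socCount 𝒜 (⊥ : Ideal R) δ = 1 ∧
      ∀ n : ℕ, n ≠ δ → socCount 𝒜 (⊥ : Ideal R) n = 0) :
    ∃ φ : R →ₗ[k] k, ∀ i, ∀ x ∈ 𝒜 i, x ≠ 0 → ∃ j, i + j = δ ∧ ∃ y ∈ 𝒜 j, φ (x * y) ≠ 0 := by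
  set Soc : ℕ → Submodule k R := fun n =>
    Submodule.restrictScalars k ((⊥ : Ideal R).colon (irrel 𝒜)) ⊓ 𝒜 n with hSoc
  have hc : ∀ n, socCount 𝒜 (⊥ : Ideal R) n = Module.finrank k (Soc n) := by
    intro n
    have : (Submodule.restrictScalars k (⊥ : Ideal R) ⊓ 𝒜 n : Submodule k R) = ⊥ := by
      simp
    rw [socCount, this, finrank_bot, Nat.sub_zero]
  have h1 : Module.finrank k (Soc δ) = 1 := (hc δ) ▸ hGor.1
  obtain ⟨s, hs, hs'⟩ := finrank_eq_one_iff'.mp h1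
  obtain ⟨φ, hφ⟩ := Module.Projective.exists_dual_ne_zero k (x := (s : R)) (by simpa using hs)
  refine ⟨φ, fun i x hx hx0 => ?_⟩
  have hfin : {n | 𝒜 n ≠ ⊥}.Finite := WellFoundedGT.finite_ne_bot_of_iSupIndep
    (DirectSum.Decomposition.isInternal 𝒜).submodule_iSupIndep
  let T : Set ℕ := {j | ∃ y ∈ 𝒜 j, x * y ≠ 0}
  have hT : T.Finite := by
    refine hfin.subset ?_
    rintro j ⟨y, hy, hxy⟩ hbot
    rw [hbot, Submodule.mem_bot] at hy
    simp [hy] at hxy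
  have hTn : T.Nonempty := ⟨0, 1, SetLike.GradedOne.one_mem, by simpa using hx0⟩
  obtain ⟨j, ⟨y, hy, hxy⟩, hmax⟩ := Set.exists_max_image T id hT hTn
  have hmem : x * y ∈ Soc (i + j) := by
    refine ⟨?_, SetLike.GradedMul.mul_mem hx hy⟩
    have : irrel 𝒜 ≤ LinearMap.ker (LinearMap.mulLeft R (x * y)) := by
      refine Ideal.span_le.mpr ?_
      rintro a ⟨l, hl, ha⟩
      change x * y * a = 0
      by_contra hne
      have := hmax (j + l) ⟨y * a, SetLike.GradedMul.mul_mem hy ha, by rwa [← mul_assoc]⟩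
      simp at this
      omega
    change x * y ∈ (⊥ : Ideal R).colon (irrel 𝒜)
    rw [Submodule.mem_colon]
    intro a ha
    exact this ha
  have hij : i + j = δ := by
    by_contra hne
    have h2 := hGor.2 _ hne
    rw [hc, Submodule.finrank_eq_zero] at h2
    rw [h2] at hmem
    exact hxy hmem
  refine ⟨j, hij, y, hy, ?_⟩
  obtain ⟨c, hcs⟩ := hs' ⟨x * y, hij ▸ hmem⟩
  have hcs' : c • (s : R) = x * y := congrArg Subtype.val hcs
  rw [← hcs', map_smul]
  refine smul_ne_zero ?_ hφ
  rintro rfl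
  exact hxy (by rw [← hcs', zero_smul])

/-- The degree-`n` piece of an ideal. -/
def pc (𝒜 : ℕ → Submodule k R) (I : Ideal R) (n : ℕ) : Submodule k R :=
  Submodule.restrictScalars k I ⊓ 𝒜 n

theorem mem_pc {𝒜 : ℕ → Submodule k R} {I : Ideal R} {n : ℕ} {x : R} :
    x ∈ pc 𝒜 I n ↔ x ∈ I ∧ x ∈ 𝒜 n := Iff.rfl

/-- Every element of a homogeneous ideal satisfying a closed condition on homogeneous elements. -/
theorem homog_le (𝒜 : ℕ → Submodule k R) [GradedAlgebra 𝒜] {I : Ideal R}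
    (hI : I.IsHomogeneous 𝒜) (N : AddSubmonoid R) (h : ∀ n, ∀ x ∈ pc 𝒜 I n, x ∈ N) :
    ∀ x ∈ I, x ∈ N := by
  classical
  intro x hx
  rw [← DirectSum.sum_support_decompose 𝒜 x]
  exact N.sum_mem fun n _ => h n _ ⟨hI n hx, SetLike.coe_mem _⟩

theorem irrel_homog (𝒜 : ℕ → Submodule k R) [GradedAlgebra 𝒜] : (irrel 𝒜).IsHomogeneous 𝒜 :=
  Ideal.homogeneous_span _ _ (by rintro x ⟨i, _, hx⟩; exact ⟨i, hx⟩)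

theorem ann_homog (𝒜 : ℕ → Submodule k R) [GradedAlgebra 𝒜] {J : Ideal R}
    (hJ : J.IsHomogeneous 𝒜) : ((⊥ : Ideal R).colon (J : Set R)).IsHomogeneous 𝒜 := by
  intro n y hy
  rw [Submodule.mem_colon] at hy ⊢
  refine homog_le 𝒜 hJ
    (LinearMap.ker (LinearMap.mulLeft k ((DirectSum.decompose 𝒜 y n : 𝒜 n) : R))).toAddSubmonoid ?_
  rintro m z ⟨hz, hzm⟩
  change ((DirectSum.decompose 𝒜 y n : 𝒜 n) : R) * z = 0
  rw [← DirectSum.coe_decompose_mul_add_of_right_mem 𝒜 hzm]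
  have : y * z = 0 := hy z hz
  rw [this]; simp

theorem restr_mul_le (I K : Ideal R) :
    Submodule.restrictScalars k (I * K) ≤ Submodule.restrictScalars k K :=
  fun _ hx => (Ideal.mul_le_right : I * K ≤ K) hx

theorem mem_ann {J : Ideal R} {y : R} :
    y ∈ (⊥ : Ideal R).colon (J : Set R) ↔ ∀ z ∈ J, y * z = 0 := by
  rw [Submodule.mem_colon]; rfl

variable (𝒜 : ℕ → Submodule k R) [GradedAlgebra 𝒜] {δ : ℕ} {φ : R →ₗ[k] k}

theorem piece_zero 
    (hφ : ∀ i, ∀ x ∈ 𝒜 i, x ≠ 0 → ∃ j, i + j = δ ∧ ∃ y ∈ 𝒜 j, φ (x * y) ≠ 0)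
    {n : ℕ} (hn : δ < n) {x : R} (hx : x ∈ 𝒜 n) : x = 0 := by
  by_contra h
  obtain ⟨j, hj, _⟩ := hφ n x hx h
  omega

theorem ndeg (hφ : ∀ i, ∀ x ∈ 𝒜 i, x ≠ 0 → ∃ j, i + j = δ ∧ ∃ y ∈ 𝒜 j, φ (x * y) ≠ 0)
    {n e : ℕ} (hne : n + e = δ) {P : Submodule k R} (hP : P ≤ 𝒜 e) :
    ∀ y ∈ P, y ≠ 0 → ∃ x ∈ 𝒜 n, φ (x * y) ≠ 0 := by
  intro y hy hy0
  obtain ⟨j, hj, x, hx, hxy⟩ := hφ e y (hP hy) hy0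
  have : j = n := by omega
  subst this
  exact ⟨x, hx, by rwa [mul_comm]⟩

theorem ann_piece (hφ : ∀ i, ∀ x ∈ 𝒜 i, x ≠ 0 → ∃ j, i + j = δ ∧ ∃ y ∈ 𝒜 j, φ (x * y) ≠ 0)
    {J : Ideal R} (hJ : J.IsHomogeneous 𝒜) {n e : ℕ} (hne : n + e = δ) :
    pc 𝒜 ((⊥ : Ideal R).colon (J : Set R)) e = perpIn φ (pc 𝒜 J n) (𝒜 e) := by
  ext y
  rw [mem_pc, mem_ann, mem_perpIn]
  constructor
  · rintro ⟨h1, h2⟩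
    exact ⟨h2, fun z hz => by rw [h1 z hz.1, map_zero]⟩
  · rintro ⟨h1, h2⟩
    refine ⟨?_, h1⟩
    refine homog_le 𝒜 hJ (LinearMap.ker (LinearMap.mulLeft k y)).toAddSubmonoid ?_
    rintro m z ⟨hz, hzm⟩
    change y * z = 0
    by_contra h0
    obtain ⟨j, hj, w, hw, hne0⟩ := hφ (e + m) (y * z) (SetLike.GradedMul.mul_mem h1 hzm) h0
    apply hne0
    rw [mul_assoc]
    refine h2 _ ⟨J.mul_mem_right _ hz, ?_⟩
    have : n = m + j := by omega
    rw [this]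
    exact SetLike.GradedMul.mul_mem hzm hw

theorem finrank_ann [FiniteDimensional k R]
    (hφ : ∀ i, ∀ x ∈ 𝒜 i, x ≠ 0 → ∃ j, i + j = δ ∧ ∃ y ∈ 𝒜 j, φ (x * y) ≠ 0)
    {J : Ideal R} (hJ : J.IsHomogeneous 𝒜) {n e : ℕ} (hne : n + e = δ) :
    Module.finrank k (pc 𝒜 ((⊥ : Ideal R).colon (J : Set R)) e) + Module.finrank k (pc 𝒜 J n)
      = Module.finrank k (𝒜 e) := by
  rw [ann_piece 𝒜 hφ hJ hne]
  exact finrank_perpIn φ _ _ (ndeg 𝒜 hφ (by omega) inf_le_right)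

theorem finrank_piece [FiniteDimensional k R]
    (hφ : ∀ i, ∀ x ∈ 𝒜 i, x ≠ 0 → ∃ j, i + j = δ ∧ ∃ y ∈ 𝒜 j, φ (x * y) ≠ 0)
    {n e : ℕ} (hne : n + e = δ) :
    Module.finrank k (𝒜 n) = Module.finrank k (𝒜 e) := by
  have h1 := finrank_perpIn φ _ _ (ndeg 𝒜 hφ hne (le_refl (𝒜 e)))
  have h2 := finrank_perpIn φ _ _ (ndeg 𝒜 hφ (show e + n = δ by omega) (le_refl (𝒜 n)))
  omega

theorem ideal_piece [FiniteDimensional k R]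
    (hφ : ∀ i, ∀ x ∈ 𝒜 i, x ≠ 0 → ∃ j, i + j = δ ∧ ∃ y ∈ 𝒜 j, φ (x * y) ≠ 0)
    {J : Ideal R} (hJ : J.IsHomogeneous 𝒜) {n e : ℕ} (hne : n + e = δ) :
    pc 𝒜 J n = perpIn φ (pc 𝒜 ((⊥ : Ideal R).colon (J : Set R)) e) (𝒜 n) := by
  apply Submodule.eq_of_le_of_finrank_eq
  · rintro x ⟨hx, hxn⟩
    refine ⟨hxn, fun y hy => ?_⟩
    rw [mul_comm, mem_ann.mp hy.1 x hx, map_zero]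
  · have h1 := finrank_ann 𝒜 hφ hJ hne
    have h2 := finrank_piece 𝒜 hφ hne
    have h3 := finrank_perpIn φ (pc 𝒜 ((⊥ : Ideal R).colon (J : Set R)) e) (𝒜 n)
      (ndeg 𝒜 hφ hne inf_le_right)
    omega

theorem colon_piece [FiniteDimensional k R]
    (hφ : ∀ i, ∀ x ∈ 𝒜 i, x ≠ 0 → ∃ j, i + j = δ ∧ ∃ y ∈ 𝒜 j, φ (x * y) ≠ 0)
    {J : Ideal R} (hJ : J.IsHomogeneous 𝒜) {n e : ℕ} (hne : n + e = δ) :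
    pc 𝒜 (J.colon (irrel 𝒜)) n =
      perpIn φ (pc 𝒜 (irrel 𝒜 * (⊥ : Ideal R).colon (J : Set R)) e) (𝒜 n) := by
  ext x
  rw [mem_pc, mem_perpIn, Submodule.mem_colon]
  constructor
  · rintro ⟨h1, h2⟩
    refine ⟨h2, ?_⟩
    rintro y ⟨hy, -⟩
    have : irrel 𝒜 * (⊥ : Ideal R).colon (J : Set R) ≤
        LinearMap.ker (LinearMap.mulLeft R x) := by
      refine Ideal.mul_le.mpr fun a ha b hb => ?_
      change x * (a * b) = 0
      rw [← mul_assoc, mul_comm]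
      exact mem_ann.mp hb _ (h1 a ha)
    have h3 : x * y = 0 := this hy
    rw [h3, map_zero]
  · rintro ⟨h1, h2⟩
    refine ⟨?_, h1⟩
    have : irrel 𝒜 ≤ Submodule.comap (LinearMap.mulLeft R x) J := by
      refine Ideal.span_le.mpr ?_
      rintro a ⟨i, hi, ha⟩
      change x * a ∈ J
      have hxa : x * a ∈ 𝒜 (n + i) := SetLike.GradedMul.mul_mem h1 ha
      by_cases hle : n + i ≤ δ
      · obtain ⟨e', he'⟩ := Nat.exists_eq_add_of_le hle
        have h3 : x * a ∈ pc 𝒜 J (n + i) := by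
          rw [ideal_piece 𝒜 hφ hJ he'.symm]
          refine ⟨hxa, fun y hy => ?_⟩
          rw [mul_assoc]
          refine h2 _ ⟨Ideal.mul_mem_mul (Ideal.subset_span ⟨i, hi, ha⟩) hy.1, ?_⟩
          have : e = i + e' := by omega
          rw [this]
          exact SetLike.GradedMul.mul_mem ha hy.2
        exact h3.1
      · rw [piece_zero 𝒜 hφ (by omega) hxa]
        exact J.zero_mem
    exact fun a ha => this ha

theorem socCount_eq [FiniteDimensional k R]
    (hφ : ∀ i, ∀ x ∈ 𝒜 i, x ≠ 0 → ∃ j, i + j = δ ∧ ∃ y ∈ 𝒜 j, φ (x * y) ≠ 0)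
    {J : Ideal R} (hJ : J.IsHomogeneous 𝒜) {n e : ℕ} (hne : n + e = δ) :
    Module.finrank k (pc 𝒜 (irrel 𝒜 * (⊥ : Ideal R).colon (J : Set R)) e) + socCount 𝒜 J n
      = Module.finrank k (pc 𝒜 ((⊥ : Ideal R).colon (J : Set R)) e) := by
  have h1 := finrank_ann 𝒜 hφ hJ hne
  have h2 := finrank_piece 𝒜 hφ hne
  have h3 := finrank_perpIn φ (pc 𝒜 (irrel 𝒜 * (⊥ : Ideal R).colon (J : Set R)) e) (𝒜 n)
      (ndeg 𝒜 hφ hne inf_le_right)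
  rw [← colon_piece 𝒜 hφ hJ hne] at h3
  have h4 : Module.finrank k (pc 𝒜 (irrel 𝒜 * (⊥ : Ideal R).colon (J : Set R)) e) ≤
      Module.finrank k (pc 𝒜 ((⊥ : Ideal R).colon (J : Set R)) e) :=
    Submodule.finrank_mono (inf_le_inf_right _ (restr_mul_le _ _))
  have h5 : socCount 𝒜 J n = Module.finrank k (pc 𝒜 (J.colon (irrel 𝒜)) n) -
    Module.finrank k (pc 𝒜 J n) := rfl
  omega

theorem irrel_le_jac 
    (hφ : ∀ i, ∀ x ∈ 𝒜 i, x ≠ 0 → ∃ j, i + j = δ ∧ ∃ y ∈ 𝒜 j, φ (x * y) ≠ 0) :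
    irrel 𝒜 ≤ (⊥ : Ideal R).jacobson := by
  refine Ideal.span_le.mpr ?_
  rintro a ⟨i, hi, ha⟩
  refine Ideal.radical_le_jacobson ⟨δ + 1, ?_⟩
  have h1 : a ^ (δ + 1) ∈ 𝒜 ((δ + 1) • i) := SetLike.pow_mem_graded _ ha
  have : δ < (δ + 1) • i := by rw [smul_eq_mul]; nlinarith
  exact piece_zero 𝒜 hφ this h1

theorem base_add_irrel (h0 : ZeroPieceIsBase 𝒜) (r : R) :
    ∃ c : k, ∃ a ∈ irrel 𝒜, r = c • (1 : R) + a := by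
  classical
  induction r using DirectSum.Decomposition.inductionOn 𝒜 with
  | zero => exact ⟨0, 0, Ideal.zero_mem _, by simp⟩
  | @homogeneous i m =>
    rcases Nat.eq_zero_or_pos i with rfl | hi
    · obtain ⟨c, hc⟩ := h0 m m.2
      exact ⟨c, 0, Ideal.zero_mem _, by simp [hc]⟩
    · exact ⟨0, m, Ideal.subset_span ⟨i, hi, m.2⟩, by simp⟩
  | add x y hx hy =>
    obtain ⟨c, a, ha, rfl⟩ := hx
    obtain ⟨c', a', ha', rfl⟩ := hy
    exact ⟨c + c', a + a', Ideal.add_mem _ ha ha', by rw [add_smul]; ring⟩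

theorem span_le_aux (h0 : ZeroPieceIsBase 𝒜) {K : Ideal R} {X : Set R} (hX : X ⊆ K) :
    ∀ y ∈ Submodule.span R X,
      y ∈ Submodule.span k X ⊔ Submodule.restrictScalars k (irrel 𝒜 * K) := by
  intro y hy
  have hle : Submodule.span k X ⊔ Submodule.restrictScalars k (irrel 𝒜 * K) ≤
      Submodule.restrictScalars k K :=
    sup_le (show Submodule.span k X ≤ Submodule.restrictScalars k K from Submodule.span_le.mpr hX) (restr_mul_le _ _)
  induction hy using Submodule.span_induction with
  | mem x hx => exact Submodule.mem_sup_left (Submodule.subset_span hx)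
  | zero => exact Submodule.zero_mem _
  | add x y _ _ hx hy => exact Submodule.add_mem _ hx hy
  | smul r x _ hx =>
    obtain ⟨c, a, ha, rfl⟩ := base_add_irrel 𝒜 h0 r
    rw [add_smul, smul_assoc, one_smul]
    refine Submodule.add_mem _ (Submodule.smul_mem _ _ hx) (Submodule.mem_sup_right ?_)
    exact Ideal.mul_mem_mul ha (hle hx)

end Helpers

/-- **Observation 1.4.** Let `R` be an artinian Gorenstein graded `k`-algebra with socle
degree `δ` and `J` a homogeneous ideal of `R`.  If the socle degrees of `R/J` are
`d 0, …, d (ℓ-1)`, then the minimal homogeneous generators of `ann J = 0 : J` have degrees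
`δ - d 0, …, δ - d (ℓ-1)`. -/
theorem socle_degrees_stmt11
    {k R : Type} [Field k] [CommRing R] [Algebra k R]
    (𝒜 : ℕ → Submodule k R) [GradedAlgebra 𝒜] (h0 : ZeroPieceIsBase 𝒜)
    (hFT : Algebra.FiniteType k R) (hart : FiniteDimensional k R)
    (δ : ℕ) (hGor : socCount 𝒜 (⊥ : Ideal R) δ = 1 ∧
      ∀ n : ℕ, n ≠ δ → socCount 𝒜 (⊥ : Ideal R) n = 0)
    (J : Ideal R) (hJ : J.IsHomogeneous 𝒜)
    {ℓ : ℕ} (d : Fin ℓ → ℕ) (hd : HasSocleDegrees 𝒜 J d) :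
    ∃ g : Fin ℓ → R, (∀ i, d i ≤ δ ∧ g i ∈ 𝒜 (δ - d i)) ∧
      IsMinGenSet g ((⊥ : Ideal R).colon J) := by
  classical
  obtain ⟨φ, hφ⟩ := exists_form 𝒜 δ hGor
  set K : Ideal R := (⊥ : Ideal R).colon (J : Set R) with hK
  have hKh : K.IsHomogeneous 𝒜 := ann_homog 𝒜 hJ
  have hMh : (irrel 𝒜 * K).IsHomogeneous 𝒜 := (irrel_homog 𝒜).mul hKh
  have hMK : ∀ e, pc 𝒜 (irrel 𝒜 * K) e ≤ pc 𝒜 K e := fun e =>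
    inf_le_inf_right _ (restr_mul_le _ _)
  have hdle : ∀ i, d i ≤ δ := by
    intro i
    by_contra hlt
    have h1 := hd.2 (d i)
    have h2 : (𝒜 (d i)) = ⊥ := by
      rw [eq_bot_iff]
      intro x hx
      exact piece_zero 𝒜 hφ (not_le.mp hlt) hx
    have h3 : socCount 𝒜 J (d i) = 0 := by
      rw [socCount, h2, inf_bot_eq, inf_bot_eq, Nat.sub_self]
    rw [h3] at h1
    have h4 := Finset.card_eq_zero.mp h1.symm
    have : i ∈ (univ.filter fun j => d j = d i) := by simp
    rw [h4] at this
    simp at this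
  have hC : ∀ n, n ≤ δ → ∃ C : Submodule k R, C ≤ pc 𝒜 K (δ - n) ∧
      C ⊔ pc 𝒜 (irrel 𝒜 * K) (δ - n) = pc 𝒜 K (δ - n) ∧
      Disjoint C (pc 𝒜 (irrel 𝒜 * K) (δ - n)) ∧
      ∃ b : {i // d i = n} → R, LinearIndependent k b ∧ Submodule.span k (Set.range b) = C := by
    intro n hn
    obtain ⟨C, hC1, hC2⟩ := IsModularLattice.exists_disjoint_and_sup_eq (hMK (δ - n))
    have hCle : C ≤ pc 𝒜 K (δ - n) := hC2 ▸ le_sup_right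
    refine ⟨C, hCle, by rw [sup_comm]; exact hC2, hC1.symm, ?_⟩
    have h1 := socCount_eq 𝒜 hφ hJ (show n + (δ - n) = δ by omega)
    rw [← hK] at h1
    have h2 := Submodule.finrank_sup_add_finrank_inf_eq (pc 𝒜 (irrel 𝒜 * K) (δ - n)) C
    rw [hC2, hC1.eq_bot, finrank_bot] at h2
    have h3 : Module.finrank k C = Fintype.card {i // d i = n} := by
      rw [Fintype.card_subtype, ← hd.2 n]
      omega
    let B : Module.Basis {i // d i = n} k C :=
      (Module.finBasis k C).reindex (Fintype.equivOfCardEq (by simp [h3]))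
    refine ⟨fun i => (B i : R), ?_, ?_⟩
    · exact B.linearIndependent.map' C.subtype C.ker_subtype
    · have : Set.range (fun i => (B i : R)) = C.subtype '' Set.range B := by
        rw [← Set.range_comp]; rfl
      rw [this, Submodule.span_image, B.span_eq, Submodule.map_top, Submodule.range_subtype]
  choose! C hCK hCsup hCdis b hbli hbspan using hC
  have hbmem : ∀ n, n ≤ δ → ∀ i, b n i ∈ C n := fun n hn i => by
    rw [← hbspan n hn]; exact Submodule.subset_span ⟨i, rfl⟩
  let g : Fin ℓ → R := fun i => b (d i) ⟨i, rfl⟩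
  have hgb : ∀ n (i : {i // d i = n}), g i = b n i := by
    rintro n ⟨i, rfl⟩; rfl
  have hgC : ∀ i, g i ∈ C (d i) := fun i => hbmem _ (hdle i) _
  have hgK : ∀ i, g i ∈ pc 𝒜 K (δ - d i) := fun i => hCK _ (hdle i) (hgC i)
  refine ⟨g, fun i => ⟨hdle i, (hgK i).2⟩, ?_, ?_⟩
  · apply le_antisymm
    · refine Submodule.span_le.mpr ?_
      rintro _ ⟨i, rfl⟩
      exact (hgK i).1
    · have : IsNoetherianRing R := IsNoetherianRing.of_finite k R
      refine Submodule.le_of_le_smul_of_le_jacobson_bot (I := irrel 𝒜)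
        (IsNoetherian.noetherian _) (irrel_le_jac 𝒜 hφ) ?_
      refine homog_le 𝒜 hKh
        (Submodule.span R (Set.range g) ⊔ irrel 𝒜 • K).toAddSubmonoid ?_
      intro e x hx
      by_cases he : e ≤ δ
      · have hx' := hx
        have hee : δ - (δ - e) = e := by omega
        have hs := hCsup (δ - e) (by omega)
        rw [hee] at hs
        rw [← hs] at hx'
        obtain ⟨y, hy, z, hz, rfl⟩ := Submodule.mem_sup.mp hx'
        refine Submodule.add_mem_sup ?_ hz.1
        rw [← hbspan (δ - e) (by omega)] at hy
        have hle : Submodule.span k (Set.range (b (δ - e))) ≤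
            Submodule.restrictScalars k (Submodule.span R (Set.range g)) := by
          refine Submodule.span_le.mpr ?_
          rintro _ ⟨i, rfl⟩
          rw [← hgb]
          exact Submodule.subset_span ⟨i, rfl⟩
        exact hle hy
      · rw [piece_zero 𝒜 hφ (not_le.mp he) hx.2]
        exact AddSubmonoid.zero_mem _
  · intro i hi
    have h1 := span_le_aux 𝒜 h0 (K := K) (X := g '' {j | j ≠ i})
      (by rintro _ ⟨j, _, rfl⟩; exact (hgK j).1) _ hi
    obtain ⟨y, hy, z, hz, hyz⟩ := Submodule.mem_sup.mp h1
    let p := GradedAlgebra.proj 𝒜 (δ - d i)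
    have hpg : p (g i) = g i := DirectSum.decompose_of_mem_same 𝒜 (hgK i).2
    have hpz : p z ∈ pc 𝒜 (irrel 𝒜 * K) (δ - d i) := ⟨hMh _ hz, SetLike.coe_mem _⟩
    have hpy : p y ∈ Submodule.span k (b (d i) '' {j | j ≠ ⟨i, rfl⟩}) := by
      have hle : Submodule.span k (g '' {j | j ≠ i}) ≤
          (Submodule.span k (b (d i) '' {j | j ≠ ⟨i, rfl⟩})).comap p := by
        refine Submodule.span_le.mpr ?_
        rintro _ ⟨j, hj, rfl⟩
        change p (g j) ∈ Submodule.span k (b (d i) '' {j | j ≠ ⟨i, rfl⟩})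
        by_cases hji : d j = d i
        · have : p (g j) = g j :=
            DirectSum.decompose_of_mem_same 𝒜 (hji ▸ (hgK j).2)
          rw [this, hgb (d i) ⟨j, hji⟩]
          refine Submodule.subset_span ⟨_, ?_, rfl⟩
          intro h
          exact hj (congrArg Subtype.val h)
        · have : p (g j) = 0 := by
            refine DirectSum.decompose_of_mem_ne 𝒜 (hgK j).2 ?_
            have := hdle i
            have := hdle j
            omega
          rw [this]
          exact Submodule.zero_mem _
      exact hle hy
    have hpyC : p y ∈ C (d i) := by
      rw [← hbspan _ (hdle i)]
      exact Submodule.span_mono (Set.image_subset_range _ _) hpy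
    have hsum : p y + p z = g i := by rw [← map_add, hyz, hpg]
    have hpz0 : p z = 0 := by
      refine Submodule.disjoint_def.mp (hCdis _ (hdle i)) _ ?_ hpz
      have : p z = g i - p y := by rw [← hsum]; ring
      rw [this]
      exact Submodule.sub_mem _ (hgC i) hpyC
    rw [hpz0, add_zero] at hsum
    rw [hsum] at hpy
    exact (hbli _ (hdle i)).notMem_span_image (s := {j | j ≠ ⟨i, rfl⟩}) (by simp) hpy
end

section
/- Let R → S be a surjection of graded k-algebras with S artinian and R Gorenstein, and suppose S has finite projective dimension as an R-module. If the back twists in the top homological degree of the minimal homogeneous resolution of S by free R-modules are {b_i}, then the socle degrees of S are {b_i + a(R)}. -/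
open Finset CategoryTheory

namespace SD

section LA
variable {k : Type} [Field k] {V W : Type} [AddCommGroup V] [Module k V]
  [AddCommGroup W] [Module k W]

/-- dimension of `Z / (B ∩ Z)` -/
noncomputable def qd (Z B : Submodule k V) : ℕ :=
  Module.finrank k (Z ⧸ B.comap Z.subtype)

lemma qd_add (Z B : Submodule k V) (h : B ≤ Z) [FiniteDimensional k Z] :
    qd Z B + Module.finrank k B = Module.finrank k Z := by
  rw [← Submodule.finrank_quotient_add_finrank (B.comap Z.subtype), qd,
    (Submodule.comapSubtypeEquivOfLe h).finrank_eq]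

lemma qd_sub (Z B : Submodule k V) (h : B ≤ Z) [FiniteDimensional k Z] :
    Module.finrank k Z - Module.finrank k B = qd Z B := by
  have := qd_add Z B h
  omega

lemma qd_of_surj (Z B : Submodule k V) {G : Type} [AddCommGroup G] [Module k G]
    (f : G →ₗ[k] Z) (hf : Function.Surjective f) :
    qd Z B = Module.finrank k (G ⧸ (B.comap (Z.subtype ∘ₗ f))) := by
  have hs : Function.Surjective ((B.comap Z.subtype).mkQ ∘ₗ f) :=
    (Submodule.mkQ_surjective _).comp hf
  have hk : LinearMap.ker ((B.comap Z.subtype).mkQ ∘ₗ f) = B.comap (Z.subtype ∘ₗ f) := by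
    rw [LinearMap.ker_comp, Submodule.ker_mkQ, Submodule.comap_comp]
  rw [qd, ← (LinearMap.quotKerEquivOfSurjective _ hs).finrank_eq, hk]

lemma qd_rel (Z B : Submodule k V) (Z' B' : Submodule k W) (E : Submodule k (V × W))
    (h1 : ∀ v ∈ Z, ∃ w ∈ Z', (v, w) ∈ E) (h2 : ∀ w ∈ Z', ∃ v ∈ Z, (v, w) ∈ E)
    (h3 : ∀ v ∈ Z, ∀ w ∈ Z', (v, w) ∈ E → (v ∈ B ↔ w ∈ B')) : qd Z B = qd Z' B' := by
  let G : Submodule k (V × W) := E ⊓ Z.prod Z'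
  let f : G →ₗ[k] Z := ((LinearMap.fst k V W).comp G.subtype).codRestrict Z
    (fun g => g.2.2.1)
  let f' : G →ₗ[k] Z' := ((LinearMap.snd k V W).comp G.subtype).codRestrict Z'
    (fun g => g.2.2.2)
  have hf : Function.Surjective f := by
    rintro ⟨v, hv⟩
    obtain ⟨w, hw, hE⟩ := h1 v hv
    exact ⟨⟨(v, w), hE, hv, hw⟩, rfl⟩
  have hf' : Function.Surjective f' := by
    rintro ⟨w, hw⟩
    obtain ⟨v, hv, hE⟩ := h2 w hw
    exact ⟨⟨(v, w), hE, hv, hw⟩, rfl⟩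
  rw [qd_of_surj Z B f hf, qd_of_surj Z' B' f' hf']
  have : B.comap (Z.subtype ∘ₗ f) = B'.comap (Z'.subtype ∘ₗ f') := by
    ext ⟨⟨v, w⟩, hE, hv, hw⟩
    exact h3 v hv w hw hE
  rw [this]

lemma qd_pi {m : ℕ} (Z B : Fin m → Submodule k V) :
    (∀ j, FiniteDimensional k (Z j)) →
    qd (Submodule.pi Set.univ Z) (Submodule.pi Set.univ B) = ∑ j, qd (Z j) (B j) := by
  intro hfd
  let f : (Submodule.pi Set.univ Z) →ₗ[k] (∀ j, (Z j) ⧸ (B j).comap (Z j).subtype) :=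
    LinearMap.pi fun j => ((B j).comap (Z j).subtype).mkQ ∘ₗ
      (((LinearMap.proj j).comp (Submodule.pi Set.univ Z).subtype).codRestrict (Z j)
        (fun v => v.2 j (Set.mem_univ j)))
  have hs : Function.Surjective f := by
    intro g
    choose z hz using fun j => Submodule.mkQ_surjective _ (g j)
    refine ⟨⟨fun j => (z j : V), fun j _ => (z j).2⟩, ?_⟩
    funext j
    exact hz j
  have hk : LinearMap.ker f = (Submodule.pi Set.univ B).comap
      (Submodule.pi Set.univ Z).subtype := by
    ext v
    rw [LinearMap.mem_ker, funext_iff]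
    simp [f, Submodule.mem_pi]
    rfl
  rw [qd, ← hk, (LinearMap.quotKerEquivOfSurjective _ hs).finrank_eq,
    Module.finrank_pi_fintype]
  rfl

lemma qd_eq_zero_of_le (Z B : Submodule k V) (h : Z ≤ B) : qd Z B = 0 := by
  have : B.comap Z.subtype = ⊤ := by
    ext z; simp [h z.2]
  rw [qd, this]
  exact Module.finrank_zero_of_subsingleton

lemma exists_of_qd_ne_zero (Z B : Submodule k V) (h : qd Z B ≠ 0) : ∃ v ∈ Z, v ∉ B := by
  by_contra! hc
  exact h (qd_eq_zero_of_le Z B hc)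

lemma qd_ne_zero (Z B : Submodule k V) [FiniteDimensional k Z] (v : V) (hv : v ∈ Z)
    (hB : v ∉ B) : qd Z B ≠ 0 := by
  intro h
  rw [qd, Module.finrank_zero_iff] at h
  have := (Submodule.Quotient.mk_eq_zero (B.comap Z.subtype) (x := ⟨v, hv⟩)).mp
    (Subsingleton.elim _ _)
  exact hB this

end LA

section Gr
variable {k : Type} [Field k] {R : Type} [CommRing R] [Algebra k R]
  (𝒜 : ℕ → Submodule k R)

def zp (n : ℤ) : Submodule k R := if 0 ≤ n then 𝒜 n.toNat else ⊥

lemma zp_natCast (n : ℕ) : zp 𝒜 (n : ℤ) = 𝒜 n := by simp [zp]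

lemma zp_neg {n : ℤ} (h : n < 0) : zp 𝒜 n = ⊥ := by simp [zp, h]

lemma mem_freePiece {m : ℕ} (b : Fin m → ℕ) (n : ℤ) (v : Fin m → R) :
    v ∈ freePiece 𝒜 b n ↔ ∀ j, v j ∈ zp 𝒜 (n - b j) := by
  simp only [freePiece, Submodule.mem_pi, Set.mem_univ, true_imp_iff]
  rfl

variable [GradedAlgebra 𝒜]

noncomputable def pr (n : ℤ) : R →ₗ[k] R :=
  if 0 ≤ n then GradedAlgebra.proj 𝒜 n.toNat else 0

lemma pr_mem_zp (n : ℤ) (u : R) : pr 𝒜 n u ∈ zp 𝒜 n := by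
  unfold pr zp
  split_ifs with h
  · simp [GradedAlgebra.proj_apply]
  · simp

lemma pr_of_mem {n : ℤ} {u : R} (h : u ∈ zp 𝒜 n) : pr 𝒜 n u = u := by
  unfold pr zp at *
  split_ifs at * with h'
  · rw [GradedAlgebra.proj_apply, DirectSum.decompose_of_mem_same _ h]
  · simpa using h.symm

lemma pr_mul {d : ℕ} {x : R} (hx : x ∈ 𝒜 d) (n : ℤ) (u : R) :
    pr 𝒜 n (x * u) = x * pr 𝒜 (n - d) u := by
  unfold pr
  by_cases h : 0 ≤ n
  · rw [if_pos h, GradedAlgebra.proj_apply]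
    by_cases h' : d ≤ n.toNat
    · rw [DirectSum.coe_decompose_mul_of_left_mem_of_le _ hx h', if_pos (by omega),
        GradedAlgebra.proj_apply, show n.toNat - d = (n - d).toNat by omega]
    · rw [DirectSum.coe_decompose_mul_of_left_mem_of_not_le _ hx h', if_neg (by omega)]
      simp
  · rw [if_neg h, if_neg (by omega)]
    simp

lemma pr_mem {I : Ideal R} (hI : I.IsHomogeneous 𝒜) (n : ℤ) {u : R} (hu : u ∈ I) :
    pr 𝒜 n u ∈ I := by
  unfold pr
  split_ifs with h
  · rw [GradedAlgebra.proj_apply]; exact hI _ hu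
  · simp

lemma mul_mem_zp {d : ℕ} {x : R} (hx : x ∈ 𝒜 d) {n : ℤ} {u : R} (hu : u ∈ zp 𝒜 (n - d)) :
    x * u ∈ zp 𝒜 n := by
  have := pr_mem_zp 𝒜 n (x * u)
  rwa [pr_mul 𝒜 hx, pr_of_mem 𝒜 hu] at this

noncomputable def vpr {m : ℕ} (b : Fin m → ℕ) (n : ℤ) (v : Fin m → R) : Fin m → R :=
  fun j => pr 𝒜 (n - b j) (v j)

lemma vpr_mem {m : ℕ} (b : Fin m → ℕ) (n : ℤ) (v : Fin m → R) :
    vpr 𝒜 b n v ∈ freePiece 𝒜 b n := by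
  rw [mem_freePiece]; exact fun j => pr_mem_zp _ _ _

lemma pr_mulVec {m m' : ℕ} (b : Fin m → ℕ) (b' : Fin m' → ℕ) (A : Matrix (Fin m) (Fin m') R)
    (hA : ∀ j l, A j l ∈ 𝒜 (b' l - b j) ∧ (b' l < b j → A j l = 0)) (n : ℤ)
    (v : Fin m' → R) (j : Fin m) :
    pr 𝒜 (n - b j) ((A.mulVec v) j) = (A.mulVec (vpr 𝒜 b' n v)) j := by
  simp only [Matrix.mulVec, dotProduct, map_sum, vpr]
  refine Finset.sum_congr rfl fun l _ => ?_
  by_cases h : b' l < b j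
  · rw [(hA j l).2 h]; simp
  · rw [pr_mul 𝒜 (hA j l).1]
    congr 2
    push_cast [Nat.cast_sub (not_lt.mp h)]
    ring_nf

end Gr
section Cx
variable {k : Type} [Field k] {R : Type} [CommRing R] [Algebra k R]
  (𝒜 : ℕ → Submodule k R)
  {r : ℕ → ℕ} (b : (i : ℕ) → Fin (r i) → ℕ)
  (A : (i : ℕ) → Matrix (Fin (r i)) (Fin (r (i + 1))) R)

/-- boundaries mod `I` -/
def Bd (I : Ideal R) (s : ℕ) : Submodule R (Fin (r s) → R) where
  carrier := {v | ∃ w, ∀ j, v j - ((A s).mulVec w) j ∈ I}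
  add_mem' := by
    rintro v v' ⟨w, hw⟩ ⟨w', hw'⟩
    refine ⟨w + w', fun j => ?_⟩
    have := I.add_mem (hw j) (hw' j)
    rw [Matrix.mulVec_add]
    convert this using 1
    simp only [Pi.add_apply]; ring
  zero_mem' := ⟨0, fun j => by simp⟩
  smul_mem' := by
    rintro y v ⟨w, hw⟩
    refine ⟨y • w, fun j => ?_⟩
    have := I.mul_mem_left y (hw j)
    rw [Matrix.mulVec_smul]
    convert this using 1
    simp only [Pi.smul_apply, smul_eq_mul]; ring

/-- cycle condition mod `I` -/
def Cy (I : Ideal R) : (s : ℕ) → Submodule R (Fin (r s) → R)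
  | 0 => ⊤
  | (s + 1) => (Submodule.pi Set.univ fun _ => I).comap (A s).mulVecLin

lemma mem_Cy_succ (I : Ideal R) (s : ℕ) (v : Fin (r (s + 1)) → R) :
    v ∈ Cy A I (s + 1) ↔ ∀ j, ((A s).mulVec v) j ∈ I := by
  simp [Cy, Submodule.mem_pi]

def So (I : Ideal R) (s : ℕ) : Submodule R (Fin (r s) → R) where
  carrier := {v | v ∈ Cy A I s ∧ ∀ y ∈ irrel 𝒜, y • v ∈ Bd A I s}
  add_mem' := by
    rintro v v' ⟨h1, h2⟩ ⟨h1', h2'⟩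
    refine ⟨add_mem h1 h1', fun y hy => ?_⟩
    rw [smul_add]
    exact add_mem (h2 y hy) (h2' y hy)
  zero_mem' := ⟨zero_mem _, fun y hy => by rw [smul_zero]; exact zero_mem _⟩
  smul_mem' := by
    rintro c v ⟨h1, h2⟩
    refine ⟨Submodule.smul_mem _ _ h1, fun y hy => ?_⟩
    rw [smul_comm]
    exact Submodule.smul_mem _ _ (h2 y hy)

def Zn (I : Ideal R) (s : ℕ) (n : ℤ) : Submodule k (Fin (r s) → R) :=
  (So 𝒜 A I s).restrictScalars k ⊓ freePiece 𝒜 (b s) n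

def Bn (I : Ideal R) (s : ℕ) (n : ℤ) : Submodule k (Fin (r s) → R) :=
  (Bd A I s).restrictScalars k ⊓ freePiece 𝒜 (b s) n

def Ex (I : Ideal R) (s : ℕ) : Prop :=
  ∀ i, s ≤ i → ∀ v, v ∈ Cy A I (i + 1) → v ∈ Bd A I (i + 1)

def IsCx : Prop := ∀ i v, (A i).mulVec ((A (i + 1)).mulVec v) = 0

def Rel (I : Ideal R) (s : ℕ) (x : R) :
    Submodule k ((Fin (r (s + 1)) → R) × (Fin (r s) → R)) where
  carrier := {p | ∀ j, ((A s).mulVec p.1) j - x * p.2 j ∈ I}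
  add_mem' := by
    rintro v v' h h' j
    have := I.add_mem (h j) (h' j)
    convert this using 1
    simp only [Prod.fst_add, Prod.snd_add, Matrix.mulVec_add, Pi.add_apply]; ring
  zero_mem' := fun j => by simp
  smul_mem' := by
    rintro y v h j
    have := (I.restrictScalars k).smul_mem y (h j)
    convert this using 1
    simp only [Prod.smul_fst, Prod.smul_snd, Matrix.mulVec_smul, Pi.smul_apply, smul_sub,
      mul_smul_comm]
    rfl

lemma mulVec_mem (I : Ideal R) {m m' : ℕ} (M : Matrix (Fin m) (Fin m') R) (v : Fin m' → R)
    (h : ∀ l, v l ∈ I) (j) : (M.mulVec v) j ∈ I := by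
  unfold Matrix.mulVec dotProduct
  exact Ideal.sum_mem _ fun l _ => I.mul_mem_left _ (h l)

variable {A}

/-- `A_{s-1} u ∈ I` when `A_s v ≡ x u`. -/
lemma cy_of_rel (hc : IsCx A) (I : Ideal R) {x : R} (hx : ∀ u, x * u ∈ I → u ∈ I) (s : ℕ)
    (v : Fin (r (s + 1)) → R) (u : Fin (r s) → R)
    (h : ∀ j, ((A s).mulVec v) j - x * u j ∈ I) : u ∈ Cy A I s := by
  cases s with
  | zero => trivial
  | succ s =>
    rw [mem_Cy_succ]
    intro j
    apply hx
    have h1 := mulVec_mem I (A s) _ h j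
    have h2 : (fun j => ((A (s + 1)).mulVec v) j - x * u j) =
      (A (s + 1)).mulVec v - x • u := rfl
    rw [h2, Matrix.mulVec_sub, hc, Matrix.mulVec_smul] at h1
    simpa using h1

lemma mem_sup_span {I : Ideal R} {x y : R} :
    y ∈ I ⊔ Ideal.span {x} ↔ ∃ u, y - x * u ∈ I := by
  rw [Submodule.mem_sup]
  constructor
  · rintro ⟨a, ha, c, hc, rfl⟩
    obtain ⟨u, rfl⟩ := Ideal.mem_span_singleton'.mp hc
    exact ⟨u, by convert ha using 1; ring⟩
  · rintro ⟨u, hu⟩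
    exact ⟨_, hu, x * u, Ideal.mul_mem_right _ _ (Ideal.mem_span_singleton_self x), by ring⟩

lemma bd_of_cy_sub (I : Ideal R) {s : ℕ} (hE : Ex A I s) {i : ℕ} (hi : s ≤ i) {x : R}
    (v z : Fin (r (i + 1)) → R) (u : Fin (r i) → R)
    (h : ∀ j, ((A i).mulVec v) j - x * u j ∈ I)
    (hz : ∀ j, u j - ((A i).mulVec z) j ∈ I) : v - x • z ∈ Bd A I (i + 1) := by
  apply hE i hi
  rw [mem_Cy_succ]
  intro j
  rw [Matrix.mulVec_sub, Matrix.mulVec_smul]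
  have := I.add_mem (h j) (I.mul_mem_left x (hz j))
  convert this using 1
  simp only [Pi.sub_apply, Pi.smul_apply, smul_eq_mul]; ring

lemma bd_sup_of_sub (I : Ideal R) {i : ℕ} {x : R} (v z : Fin (r i) → R)
    (h : v - x • z ∈ Bd A I i) : v ∈ Bd A (I ⊔ Ideal.span {x}) i := by
  obtain ⟨w, hw⟩ := h
  refine ⟨w, fun j => mem_sup_span.mpr ⟨z j, ?_⟩⟩
  convert hw j using 1
  simp only [Pi.sub_apply, Pi.smul_apply, smul_eq_mul]; ring

lemma bd_sup (I : Ideal R) {i : ℕ} {x : R} (v : Fin (r i) → R) :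
    v ∈ Bd A (I ⊔ Ideal.span {x}) i ↔ ∃ z, v - x • z ∈ Bd A I i := by
  refine ⟨?_, fun ⟨z, hz⟩ => bd_sup_of_sub I v z hz⟩
  rintro ⟨w, hw⟩
  choose z hz using fun j => mem_sup_span.mp (hw j)
  refine ⟨z, w, fun j => ?_⟩
  convert hz j using 1
  simp only [Pi.sub_apply, Pi.smul_apply, smul_eq_mul]; ring

/-- if `v ≡ x z` mod boundaries and `A v ≡ x u` then `u ≡ A z`. -/
lemma u_of_bd (hc : IsCx A) (I : Ideal R) {x : R} (hx : ∀ u, x * u ∈ I → u ∈ I) {s : ℕ}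
    (v z : Fin (r (s + 1)) → R) (u : Fin (r s) → R)
    (h : ∀ j, ((A s).mulVec v) j - x * u j ∈ I)
    (hz : v - x • z ∈ Bd A I (s + 1)) : u ∈ Bd A I s := by
  obtain ⟨w, hw⟩ := hz
  refine ⟨z, fun j => hx _ ?_⟩
  have h1 := mulVec_mem I (A s) _ hw j
  have h2 : (fun j => (v - x • z) j - ((A (s + 1)).mulVec w) j) =
    v - x • z - (A (s + 1)).mulVec w := rfl
  rw [h2, Matrix.mulVec_sub, hc, Matrix.mulVec_sub, Matrix.mulVec_smul] at h1
  have := I.sub_mem h1 (h j)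
  convert this using 1
  simp only [Pi.sub_apply, Pi.smul_apply, smul_eq_mul, Pi.zero_apply]; ring

lemma ex_step (hc : IsCx A) (I : Ideal R) {x : R} (hx : ∀ u, x * u ∈ I → u ∈ I) {s : ℕ}
    (hE : Ex A I s) : Ex A (I ⊔ Ideal.span {x}) (s + 1) := by
  intro i hi v hv
  rw [mem_Cy_succ] at hv
  choose u hu using fun j => mem_sup_span.mp (hv j)
  have hcy := cy_of_rel hc I hx i v u hu
  obtain ⟨i, rfl⟩ : ∃ i', i = i' + 1 := ⟨i - 1, by omega⟩
  obtain ⟨z, hz⟩ := hE i (by omega) u hcy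
  exact bd_sup_of_sub I v z (bd_of_cy_sub I hE (by omega) v z u hu hz)

variable [GradedAlgebra 𝒜]

lemma step (hc : IsCx A)
    (hA : ∀ i j l, A i j l ∈ 𝒜 (b (i + 1) l - b i j) ∧ (b (i + 1) l < b i j → A i j l = 0))
    (I : Ideal R) (hI : I.IsHomogeneous 𝒜) {e : ℕ} {x : R} (hxe : x ∈ 𝒜 e)
    (hxm : x ∈ irrel 𝒜) (hx : ∀ u, x * u ∈ I → u ∈ I) {s : ℕ}
    (hE : Ex A I s) (n : ℤ) :
    qd (Zn 𝒜 b A (I ⊔ Ideal.span {x}) (s + 1) (n + e)) (Bn 𝒜 b A (I ⊔ Ideal.span {x}) (s + 1) (n + e))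
      = qd (Zn 𝒜 b A I s n) (Bn 𝒜 b A I s n) := by
  have key1 : ∀ v u, (∀ j, ((A s).mulVec v) j - x * u j ∈ I) →
      v ∈ So 𝒜 A (I ⊔ Ideal.span {x}) (s + 1) → u ∈ So 𝒜 A I s := by
    intro v u h hv
    refine ⟨cy_of_rel hc I hx s v u h, fun y hy => ?_⟩
    obtain ⟨z, hz⟩ := (bd_sup I _).mp (hv.2 y hy)
    refine u_of_bd hc I hx (y • v) z (y • u) (fun j => ?_) hz
    rw [Matrix.mulVec_smul]
    convert I.mul_mem_left y (h j) using 1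
    simp only [Pi.smul_apply, smul_eq_mul]; ring
  have key2 : ∀ v u, (∀ j, ((A s).mulVec v) j - x * u j ∈ I) →
      u ∈ So 𝒜 A I s → v ∈ So 𝒜 A (I ⊔ Ideal.span {x}) (s + 1) := by
    intro v u h hu
    refine ⟨?_, fun y hy => ?_⟩
    · rw [mem_Cy_succ]
      exact fun j => mem_sup_span.mpr ⟨_, h j⟩
    · obtain ⟨z, hz⟩ := hu.2 y hy
      refine bd_sup_of_sub I _ z (bd_of_cy_sub I hE le_rfl (y • v) z (y • u) (fun j => ?_) hz)
      rw [Matrix.mulVec_smul]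
      convert I.mul_mem_left y (h j) using 1
      simp only [Pi.smul_apply, smul_eq_mul]; ring
  have hpr : ∀ v u, (∀ j, ((A s).mulVec v) j - x * u j ∈ I) → ∀ j,
      ((A s).mulVec (vpr 𝒜 (b (s + 1)) (n + e) v)) j - x * (vpr 𝒜 (b s) n u) j ∈ I := by
    intro v u h j
    have := pr_mem 𝒜 hI (n + e - b s j) (h j)
    rw [map_sub, pr_mulVec 𝒜 (b s) (b (s + 1)) (A s) (hA s), pr_mul 𝒜 hxe] at this
    rwa [show n + (e : ℤ) - b s j - e = n - b s j by ring] at this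
  have hfix : ∀ {m : ℕ} (b : Fin m → ℕ) (n : ℤ) v, v ∈ freePiece 𝒜 b n → vpr 𝒜 b n v = v := by
    intro m b n v hv
    funext j
    exact pr_of_mem 𝒜 ((mem_freePiece 𝒜 b n v).mp hv j)
  apply qd_rel _ _ _ _ (Rel A I s x)
  · rintro v ⟨hv, hvn⟩
    have hcy := hv.1
    rw [mem_Cy_succ] at hcy
    choose u hu using fun j => mem_sup_span.mp (hcy j)
    have hu' := hpr v u hu
    rw [hfix _ _ v hvn] at hu'
    exact ⟨_, ⟨key1 v _ hu' hv, vpr_mem _ _ _ _⟩, hu'⟩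
  · rintro u ⟨hu, hun⟩
    obtain ⟨w, hw⟩ := hu.2 x hxm
    have hw' : ∀ j, ((A s).mulVec w) j - x * u j ∈ I := by
      intro j
      convert I.neg_mem (hw j) using 1
      simp only [Pi.smul_apply, smul_eq_mul]; ring
    have hu' := hpr w u hw'
    rw [hfix _ _ u hun] at hu'
    exact ⟨_, ⟨key2 _ u hu' hu, vpr_mem _ _ _ _⟩, hu'⟩
  · rintro v ⟨hv, hvn⟩ u ⟨hu, hun⟩ hE'
    have hE' : ∀ j, ((A s).mulVec v) j - x * u j ∈ I := hE'
    constructor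
    · rintro ⟨hb, -⟩
      obtain ⟨z, hz⟩ := (bd_sup I v).mp hb
      exact ⟨u_of_bd hc I hx v z u hE' hz, hun⟩
    · rintro ⟨⟨z, hz⟩, -⟩
      exact ⟨bd_sup_of_sub I v z (bd_of_cy_sub I hE le_rfl v z u hE' hz), hvn⟩

end Cx
set_option linter.unusedSectionVars false

section CA
variable {k : Type} [Field k] {R : Type} [CommRing R] [Algebra k R]
  (𝒜 : ℕ → Submodule k R) [GradedAlgebra 𝒜]

lemma exists_gens [IsNoetherianRing R] : ∃ (T : Finset R) (e : R → ℕ),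
    (∀ y ∈ T, 0 < e y ∧ y ∈ 𝒜 (e y)) ∧ irrel 𝒜 = Ideal.span (T : Set R) := by
  have hfg : (irrel 𝒜).FG := IsNoetherian.noetherian _
  obtain ⟨T, hT, hs⟩ := Submodule.fg_span_iff_fg_span_finset_subset _ |>.mp hfg
  choose! e he using fun y (hy : y ∈ (T : Set R)) => hT hy
  exact ⟨T, e, he, hs⟩

lemma expand {T : Finset R} {e : R → ℕ} (hT : ∀ y ∈ T, 0 < e y ∧ y ∈ 𝒜 (e y))
    (hs : irrel 𝒜 = Ideal.span (T : Set R)) {n : ℕ} (hn : 0 < n) {x : R} (hx : x ∈ 𝒜 n) :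
    ∃ f : R → R, x = ∑ y ∈ T, y * f y ∧ ∀ y ∈ T, f y ∈ zp 𝒜 (n - e y) := by
  have hm : x ∈ irrel 𝒜 := Ideal.subset_span ⟨n, hn, hx⟩
  rw [hs] at hm
  obtain ⟨f, -, hf⟩ := Submodule.mem_span_finset.mp hm
  refine ⟨fun y => pr 𝒜 (n - e y) (f y), ?_, fun y _ => pr_mem_zp _ _ _⟩
  rw [← zp_natCast 𝒜] at hx
  rw [← pr_of_mem 𝒜 hx, ← hf, map_sum]
  refine Finset.sum_congr rfl fun y hy => ?_
  rw [smul_eq_mul, mul_comm, pr_mul 𝒜 (hT y hy).2]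

lemma fd (h0 : ZeroPieceIsBase 𝒜) [IsNoetherianRing R] (n : ℕ) :
    FiniteDimensional k (𝒜 n) := by
  obtain ⟨T, e, hT, hs⟩ := exists_gens 𝒜
  induction n using Nat.strong_induction_on with
  | _ n ih =>
  rcases Nat.eq_zero_or_pos n with rfl | hn
  · have : 𝒜 0 ≤ Submodule.span k {1} := by
      intro x hx
      obtain ⟨c, rfl⟩ := h0 x hx
      exact Submodule.smul_mem _ _ (Submodule.mem_span_singleton_self 1)
    exact Submodule.finiteDimensional_of_le this
  · have hz : ∀ y : T, FiniteDimensional k ((zp 𝒜 (n - e y)).map (LinearMap.mulLeft k y.1)) := by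
      intro y
      have : FiniteDimensional k (zp 𝒜 (n - e y)) := by
        by_cases h : (0 : ℤ) ≤ n - e y
        · rw [show zp 𝒜 (n - e y) = 𝒜 ((n : ℤ) - e y).toNat from if_pos h]
          exact ih _ (by have := (hT y y.2).1; omega)
        · rw [zp_neg 𝒜 (by omega)]
          infer_instance
      infer_instance
    have : 𝒜 n ≤ ⨆ y : T, (zp 𝒜 (n - e y)).map (LinearMap.mulLeft k y.1) := by
      intro x hx
      obtain ⟨f, rfl, hf⟩ := expand 𝒜 hT hs hn hx
      refine Submodule.sum_mem _ fun y hy => ?_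
      refine Submodule.mem_iSup_of_mem ⟨y, hy⟩ ?_
      exact ⟨f y, hf y hy, rfl⟩
    exact Submodule.finiteDimensional_of_le this

lemma fdz (hfd : ∀ n, FiniteDimensional k (𝒜 n)) (n : ℤ) : FiniteDimensional k (zp 𝒜 n) := by
  by_cases h : 0 ≤ n
  · rw [show zp 𝒜 n = 𝒜 n.toNat from if_pos h]
    exact hfd _
  · rw [zp_neg 𝒜 (by omega)]
    infer_instance

lemma vanish [IsNoetherianRing R] (I : Ideal R) (hI : I.radical = irrel 𝒜) :
    ∃ N, ∀ n, N ≤ n → ∀ x ∈ 𝒜 n, x ∈ I := by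
  obtain ⟨T, e, hT, hs⟩ := exists_gens 𝒜
  obtain ⟨M, hM⟩ := I.exists_radical_pow_le_of_fg (IsNoetherian.noetherian _)
  rw [hI] at hM
  have key : ∀ N n, N * (T.sup e + 1) ≤ n → ∀ x ∈ 𝒜 n, x ∈ (irrel 𝒜) ^ N := by
    intro N
    induction N with
    | zero => intro n _ x _; simp
    | succ N ih =>
      intro n hn x hx
      have hn' : N * (T.sup e + 1) + (T.sup e + 1) ≤ n := by rwa [Nat.succ_mul] at hn
      obtain ⟨f, rfl, hf⟩ := expand 𝒜 hT hs (by omega) hx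
      refine Ideal.sum_mem _ fun y hy => ?_
      have hle : e y ≤ T.sup e := Finset.le_sup hy
      rw [pow_succ']
      refine Ideal.mul_mem_mul ?_ (ih (n - e y) (by omega) _ ?_)
      · exact Ideal.subset_span ⟨_, hT y hy⟩
      · have := hf y hy
        rwa [← Nat.cast_sub (by omega), zp_natCast] at this
  exact ⟨_, fun n hn x hx => hM (key M n hn x hx)⟩

lemma top_degree [IsNoetherianRing R] (I : Ideal R) (hI : I.radical = irrel 𝒜) (hne : I ≠ ⊤) :
    ∃ t, (∃ x ∈ 𝒜 t, x ∉ I) ∧ (∀ n, t < n → 𝒜 n ≤ I.restrictScalars k) ∧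
      𝒜 t ≤ (I.colon (irrel 𝒜 : Set R)).restrictScalars k := by
  obtain ⟨N, hN⟩ := vanish 𝒜 I hI
  classical
  let P : ℕ → Prop := fun n => ∃ x ∈ 𝒜 n, x ∉ I
  have h0 : P 0 := ⟨1, SetLike.GradedOne.one_mem, fun h => hne ((Ideal.eq_top_iff_one I).mpr h)⟩
  have hP : ∀ n, P n → n ≤ N := by
    rintro n ⟨x, hx, hxI⟩
    by_contra hlt
    exact hxI (hN n (by omega) x hx)
  have h1 : P (Nat.findGreatest P N) := Nat.findGreatest_spec (Nat.zero_le N) h0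
  have h2 : ∀ n, Nat.findGreatest P N < n → 𝒜 n ≤ I.restrictScalars k := by
    intro n hn x hx
    by_contra hxI
    have hp : P n := ⟨x, hx, hxI⟩
    exact absurd (Nat.le_findGreatest (hP n hp) hp) (by omega)
  refine ⟨_, h1, h2, fun x hx => ?_⟩
  change x ∈ I.colon (irrel 𝒜 : Set R)
  have : irrel 𝒜 ≤ I.colon {x} := by
    refine Ideal.span_le.mpr ?_
    rintro y ⟨i, hi, hy⟩
    refine Submodule.mem_colon_singleton.mpr ?_
    rw [smul_eq_mul, mul_comm]
    exact h2 _ (by omega) (SetLike.GradedMul.mul_mem hx hy)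
  refine Submodule.mem_colon.mpr fun s hs => ?_
  have := Submodule.mem_colon_singleton.mp (this hs)
  rw [smul_eq_mul, mul_comm] at this
  exact this

/-- graded socle count -/
noncomputable def sq (I : Ideal R) (n : ℤ) : ℕ :=
  qd ((I.colon (irrel 𝒜 : Set R)).restrictScalars k ⊓ zp 𝒜 n) (I.restrictScalars k ⊓ zp 𝒜 n)

lemma le_colon (I : Ideal R) : I ≤ I.colon (irrel 𝒜 : Set R) := by
  intro x hx
  exact Submodule.mem_colon.mpr fun s _ => I.mul_mem_right s hx

lemma socCount_eq (hfd : ∀ n, FiniteDimensional k (𝒜 n)) (I : Ideal R) (n : ℕ) :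
    socCount 𝒜 I n = sq 𝒜 I n := by
  have := hfd n
  unfold socCount sq
  rw [zp_natCast]
  have : FiniteDimensional k
    (((I.colon (irrel 𝒜 : Set R)).restrictScalars k ⊓ 𝒜 n : Submodule k R)) :=
    Submodule.finiteDimensional_of_le inf_le_right
  exact qd_sub _ _ (inf_le_inf_right _ (le_colon 𝒜 I))

lemma sq_neg (I : Ideal R) {n : ℤ} (h : n < 0) : sq 𝒜 I n = 0 := by
  apply qd_eq_zero_of_le
  rw [zp_neg 𝒜 h]; simp

/-- graded dimension of the quotient -/
noncomputable def hq (I : Ideal R) (n : ℤ) : ℕ :=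
  qd (zp 𝒜 n) (I.restrictScalars k ⊓ zp 𝒜 n)

lemma hilb_coeff (hfd : ∀ n, FiniteDimensional k (𝒜 n)) (I : Ideal R) (n : ℕ) :
    PowerSeries.coeff n (hilbQ 𝒜 I) = hq 𝒜 I n := by
  have := hfd n
  rw [hilbQ, PowerSeries.coeff_mk, hq, zp_natCast,
    ← qd_add (𝒜 n) (I.restrictScalars k ⊓ 𝒜 n) inf_le_right]
  push_cast; ring

def Rel2 (I : Ideal R) (x : R) : Submodule k (R × R) where
  carrier := {p | p.1 - x * p.2 ∈ I}
  add_mem' := by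
    rintro v v' h h'
    have := I.add_mem h h'
    change _ ∈ I
    convert this using 1
    simp only [Prod.fst_add, Prod.snd_add]; ring
  zero_mem' := by simp
  smul_mem' := by
    rintro y v h
    have := (I.restrictScalars k).smul_mem y h
    change _ ∈ I
    convert this using 1
    simp only [Prod.smul_fst, Prod.smul_snd, smul_sub, mul_smul_comm]
    rfl

lemma hq_step (hfd : ∀ n, FiniteDimensional k (𝒜 n)) (I : Ideal R) (hI : I.IsHomogeneous 𝒜)
    {e : ℕ} {x : R} (hxe : x ∈ 𝒜 e) (hx : ∀ u, x * u ∈ I → u ∈ I) (n : ℤ) :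
    hq 𝒜 (I ⊔ Ideal.span {x}) n + hq 𝒜 I (n - e) = hq 𝒜 I n := by
  have := fdz 𝒜 hfd n
  have hle : I.restrictScalars k ⊓ zp 𝒜 n ≤
      (I ⊔ Ideal.span {x}).restrictScalars k ⊓ zp 𝒜 n :=
    inf_le_inf_right _ (fun y hy => (le_sup_left : I ≤ I ⊔ Ideal.span {x}) hy)
  have : FiniteDimensional k
      ((I ⊔ Ideal.span {x}).restrictScalars k ⊓ zp 𝒜 n : Submodule k R) :=
    Submodule.finiteDimensional_of_le inf_le_right
  have e1 := qd_add (zp 𝒜 n) (I.restrictScalars k ⊓ zp 𝒜 n) inf_le_right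
  have e2 := qd_add (zp 𝒜 n) ((I ⊔ Ideal.span {x}).restrictScalars k ⊓ zp 𝒜 n) inf_le_right
  have e3 := qd_add _ _ hle
  have e4 : qd ((I ⊔ Ideal.span {x}).restrictScalars k ⊓ zp 𝒜 n)
      (I.restrictScalars k ⊓ zp 𝒜 n) = hq 𝒜 I (n - e) := by
    apply qd_rel _ _ _ _ (Rel2 I x)
    · rintro v ⟨hv, hvn⟩
      obtain ⟨u, hu⟩ := mem_sup_span.mp hv
      refine ⟨_, pr_mem_zp 𝒜 (n - e) u, ?_⟩
      have := pr_mem 𝒜 hI n hu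
      rwa [map_sub, pr_of_mem 𝒜 hvn, pr_mul 𝒜 hxe] at this
    · intro u hu
      refine ⟨x * u, ⟨mem_sup_span.mpr ⟨u, by simp⟩, mul_mem_zp 𝒜 hxe hu⟩, ?_⟩
      change x * u - x * u ∈ I
      simp
    · rintro v ⟨hv, hvn⟩ u hu h
      have h : v - x * u ∈ I := h
      constructor
      · rintro ⟨hvI, -⟩
        refine ⟨hx _ ?_, hu⟩
        have := I.sub_mem hvI h
        simpa using this
      · rintro ⟨huI, -⟩
        refine ⟨?_, hvn⟩
        have := I.add_mem h (I.mul_mem_left x huI)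
        simpa using this
  unfold hq at *
  omega

lemma hilb_step (hfd : ∀ n, FiniteDimensional k (𝒜 n)) (I : Ideal R) (hI : I.IsHomogeneous 𝒜)
    {e : ℕ} {x : R} (hxe : x ∈ 𝒜 e) (hx : ∀ u, x * u ∈ I → u ∈ I) :
    hilbQ 𝒜 (I ⊔ Ideal.span {x}) =
      ((1 - Polynomial.X ^ e : Polynomial ℤ) : PowerSeries ℤ) * hilbQ 𝒜 I := by
  ext n
  have h := hq_step 𝒜 hfd I hI hxe hx n
  rw [Polynomial.coe_sub, Polynomial.coe_one, Polynomial.coe_pow, Polynomial.coe_X, sub_mul,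
    one_mul, map_sub, PowerSeries.coeff_X_pow_mul', hilb_coeff 𝒜 hfd, hilb_coeff 𝒜 hfd, ← h]
  split_ifs with hn
  · rw [hilb_coeff 𝒜 hfd, Nat.cast_sub hn]
    push_cast; ring
  · have : hq 𝒜 I ((n : ℤ) - e) = 0 := by
      apply qd_eq_zero_of_le
      rw [zp_neg 𝒜 (by omega)]; simp
    rw [this]; simp

lemma exists_seq (xs : List R) (hreg : RingTheory.Sequence.IsRegular R xs)
    (hom : ∀ x ∈ xs, ∃ i, 0 < i ∧ x ∈ 𝒜 i) :
    ∃ (x : ℕ → R) (e : ℕ → ℕ) (I : ℕ → Ideal R), I 0 = ⊥ ∧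
      I xs.length = Ideal.span {x | x ∈ xs} ∧ ∀ i, i < xs.length →
        0 < e i ∧ x i ∈ 𝒜 (e i) ∧ I (i + 1) = I i ⊔ Ideal.span {x i} ∧
        (I i).IsHomogeneous 𝒜 ∧ ∀ u, x i * u ∈ I i → u ∈ I i := by
  choose! e he using hom
  refine ⟨fun i => xs.getD i 0, fun i => e (xs.getD i 0), fun i => Ideal.ofList (xs.take i),
    by simp, by simp [Ideal.ofList], fun i hi => ?_⟩
  have hget : xs.getD i 0 = xs[i] := by simp [hi]
  simp only [hget]
  refine ⟨(he _ (List.getElem_mem hi)).1, (he _ (List.getElem_mem hi)).2, ?_, ?_, ?_⟩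
  · rw [← List.take_append_getElem hi, Ideal.ofList_append, Ideal.ofList_singleton]
  · apply Ideal.homogeneous_span
    intro y hy
    exact ⟨_, (he y (List.mem_of_mem_take hy)).2⟩
  · intro u hu
    have h := hreg.regular_mod_prev i hi
    have h2 : (Submodule.Quotient.mk (xs[i] * u) :
      R ⧸ (Ideal.ofList (xs.take i) • ⊤ : Submodule R R)) = 0 := by
      rw [Submodule.Quotient.mk_eq_zero]
      simpa using hu
    have h3 := h.right_eq_zero_of_smul (x := Submodule.Quotient.mk u) (by
      exact h2)
    rw [Submodule.Quotient.mk_eq_zero] at h3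
    simpa using h3

end CA
section Fin
variable {k : Type} [Field k] {R : Type} [CommRing R] [Algebra k R]
  (𝒜 : ℕ → Submodule k R) [GradedAlgebra 𝒜]

lemma a_inv_eq [IsNoetherianRing R] (hfd : ∀ n, FiniteDimensional k (𝒜 n))
    (d : ℕ) (x : ℕ → R) (e : ℕ → ℕ) (I : ℕ → Ideal R) (hI0 : I 0 = ⊥)
    (hstep : ∀ i, i < d → 0 < e i ∧ x i ∈ 𝒜 (e i) ∧ I (i + 1) = I i ⊔ Ideal.span {x i} ∧
        (I i).IsHomogeneous 𝒜 ∧ ∀ u, x i * u ∈ I i → u ∈ I i)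
    (hrad : (I d).radical = irrel 𝒜) (hne : I d ≠ ⊤) (δ : ℕ)
    (hδ : ∀ n : ℕ, n ≠ δ → socCount 𝒜 (I d) n = 0)
    (a : ℤ) (ha : IsAInv 𝒜 (⊥ : Ideal R) a) :
    a = δ - ∑ l ∈ range d, (e l : ℤ) := by
  have hH : ∀ i, i ≤ d → hilbQ 𝒜 (I i) =
      ((∏ l ∈ range i, (1 - Polynomial.X ^ e l : Polynomial ℤ) : Polynomial ℤ) :
        PowerSeries ℤ) * hilbQ 𝒜 (⊥ : Ideal R) := by
    intro i
    induction i with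
    | zero => intro _; simp [hI0]
    | succ i ih =>
      intro hi
      obtain ⟨h1, h2, h3, h4, h5⟩ := hstep i (by omega)
      rw [h3, hilb_step 𝒜 hfd (I i) h4 h2 h5, ih (by omega), Finset.prod_range_succ,
        ← mul_assoc, ← Polynomial.coe_mul, mul_comm (∏ l ∈ range i, _)]
  have hQdeg : ∀ l, l < d → (1 - Polynomial.X ^ e l : Polynomial ℤ).natDegree = e l := by
    intro l hl
    rw [← neg_sub, Polynomial.natDegree_neg]
    exact Polynomial.natDegree_X_pow_sub_C (r := (1 : ℤ))
  have hQne : ∀ l, l < d → (1 - Polynomial.X ^ e l : Polynomial ℤ) ≠ 0 := by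
    intro l hl h
    have h1 := hQdeg l hl
    rw [h] at h1
    have := (hstep l hl).1
    simp at h1
    omega
  obtain ⟨t, ⟨y, hyt, hyI⟩, htop, hcol⟩ := top_degree 𝒜 (I d) hrad hne
  have htδ : t = δ := by
    by_contra hne
    have h1 := hδ t hne
    rw [socCount_eq 𝒜 hfd, sq, zp_natCast] at h1
    have := hfd t
    have : FiniteDimensional k
      ((((I d).colon (irrel 𝒜 : Set R)).restrictScalars k ⊓ 𝒜 t : Submodule k R)) :=
      Submodule.finiteDimensional_of_le inf_le_right
    refine qd_ne_zero _ _ y ?_ ?_ h1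
    · exact ⟨hcol hyt, hyt⟩
    · exact fun h => hyI h.1
  subst htδ
  set P := PowerSeries.trunc (t + 1) (hilbQ 𝒜 (I d)) with hP
  have hct : PowerSeries.coeff t (hilbQ 𝒜 (I d)) ≠ 0 := by
    rw [hilb_coeff 𝒜 hfd]
    have := hfd t
    rw [hq, zp_natCast]
    have h2 : qd (𝒜 t) ((I d).restrictScalars k ⊓ 𝒜 t) ≠ 0 :=
      qd_ne_zero _ _ y hyt (fun h => hyI h.1)
    exact_mod_cast h2
  have hPH : (P : PowerSeries ℤ) = hilbQ 𝒜 (I d) := by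
    ext n
    rw [Polynomial.coeff_coe, hP, PowerSeries.coeff_trunc]
    split_ifs with hn
    · rfl
    · rw [hilb_coeff 𝒜 hfd, hq, zp_natCast, qd_eq_zero_of_le]
      · simp
      · exact le_inf (htop n (by omega)) le_rfl
  have hPt : P.coeff t ≠ 0 := by
    rw [hP, PowerSeries.coeff_trunc, if_pos (by omega)]
    exact hct
  have hPdeg : P.natDegree = t := by
    apply le_antisymm
    · have := PowerSeries.natDegree_trunc_lt (hilbQ 𝒜 (I d)) t
      rw [← hP] at this
      omega
    · exact Polynomial.le_natDegree_of_ne_zero hPt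
  have hP0 : P ≠ 0 := fun h => hPt (by rw [h]; simp)
  obtain ⟨num, den, hden, hnd, rfl⟩ := ha
  set Q : Polynomial ℤ := ∏ l ∈ range d, (1 - Polynomial.X ^ e l : Polynomial ℤ) with hQ
  have hQ0 : Q ≠ 0 := Finset.prod_ne_zero_iff.mpr fun l hl => hQne l (Finset.mem_range.mp hl)
  have hQd : Q.natDegree = ∑ l ∈ range d, e l := by
    rw [hQ, Polynomial.natDegree_prod _ _ fun l hl => hQne l (Finset.mem_range.mp hl)]
    exact Finset.sum_congr rfl fun l hl => hQdeg l (Finset.mem_range.mp hl)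
  have heq : den * P = Q * num := by
    apply Polynomial.coe_injective
    rw [Polynomial.coe_mul, Polynomial.coe_mul, hPH, hH d le_rfl, ← hnd]
    ring
  have hnum : num ≠ 0 := by
    rintro rfl
    rw [mul_zero] at heq
    exact mul_ne_zero hden hP0 heq
  have hdeg := congrArg Polynomial.natDegree heq
  rw [Polynomial.natDegree_mul hden hP0, Polynomial.natDegree_mul hQ0 hnum, hPdeg, hQd] at hdeg
  have : ((den.natDegree + t : ℕ) : ℤ) = ((∑ l ∈ range d, e l + num.natDegree : ℕ) : ℤ) := by
    rw [hdeg]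
  push_cast at this
  linarith

def Rel3 (m : ℕ) (j : Fin m) : Submodule k ((Fin m → R) × R) where
  carrier := {p | p.1 j = p.2}
  add_mem' := by
    rintro v v' h h'
    change v.1 j + v'.1 j = v.2 + v'.2
    rw [h, h']
  zero_mem' := rfl
  smul_mem' := by
    rintro y v h
    change y • v.1 j = y • v.2
    rw [h]

lemma start_eq (J : Ideal R) {c : ℕ} {r : ℕ → ℕ} {b : (i : ℕ) → Fin (r i) → ℕ}
    {A : (i : ℕ) → Matrix (Fin (r i)) (Fin (r (i + 1))) R}
    (hres : IsMinGradedFreeResolution 𝒜 J c r b A) (n : ℤ) :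
    qd (Zn 𝒜 b A ⊥ 0 n) (Bn 𝒜 b A ⊥ 0 n) = sq 𝒜 J n := by
  obtain ⟨hr0, hb0, -, -, -, -, -, hex⟩ := hres
  have hss : Subsingleton (Fin (r 0)) := by rw [hr0]; infer_instance
  let j0 : Fin (r 0) := ⟨0, by omega⟩
  have hBd : ∀ v, v ∈ Bd A ⊥ 0 ↔ v j0 ∈ J := by
    intro v
    have h1 := hex v
    have h2 : ((J.mkQ).comp (∑ j : Fin (r 0), LinearMap.proj j)) v = J.mkQ (v j0) := by
      rw [LinearMap.comp_apply, LinearMap.sum_apply, Fintype.sum_subsingleton _ j0]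
      rfl
    rw [h2] at h1
    rw [← Submodule.ker_mkQ J, LinearMap.mem_ker, h1]
    constructor
    · rintro ⟨w, hw⟩
      refine ⟨w, ?_⟩
      funext j
      have := hw j
      rw [Ideal.mem_bot, sub_eq_zero] at this
      exact this.symm
    · rintro ⟨w, rfl⟩
      exact ⟨w, fun j => by simp⟩
  have hfp : ∀ v, v ∈ freePiece 𝒜 (b 0) n ↔ v j0 ∈ zp 𝒜 n := by
    intro v
    rw [mem_freePiece]
    constructor
    · intro h
      have := h j0
      rwa [hb0, Nat.cast_zero, sub_zero] at this
    · intro h j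
      rw [hb0, Nat.cast_zero, sub_zero, Subsingleton.elim j j0]
      exact h
  have hZ : ∀ v, v ∈ Zn 𝒜 b A ⊥ 0 n ↔ v j0 ∈ J.colon (irrel 𝒜 : Set R) ∧ v j0 ∈ zp 𝒜 n := by
    intro v
    constructor
    · rintro ⟨hv, hvn⟩
      refine ⟨Submodule.mem_colon.mpr fun s hs => ?_, (hfp v).mp hvn⟩
      have := (hBd _).mp (hv.2 s hs)
      rw [smul_eq_mul, mul_comm]
      exact this
    · rintro ⟨hv, hvn⟩
      refine ⟨⟨trivial, fun y hy => (hBd _).mpr ?_⟩, (hfp v).mpr hvn⟩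
      have := Submodule.mem_colon.mp hv y hy
      rw [smul_eq_mul, mul_comm] at this
      exact this
  apply qd_rel _ _ _ _ (Rel3 (r 0) j0)
  · intro v hv
    exact ⟨v j0, (hZ v).mp hv, rfl⟩
  · intro u hu
    exact ⟨fun _ => u, (hZ _).mpr hu, rfl⟩
  · intro v hv u hu h
    have h : v j0 = u := h
    subst h
    constructor
    · rintro ⟨h1, h2⟩
      exact ⟨(hBd v).mp h1, (hfp v).mp h2⟩
    · rintro ⟨h1, h2⟩
      exact ⟨(hBd v).mpr h1, (hfp v).mpr h2⟩

lemma bd_last {r : ℕ → ℕ} {A : (i : ℕ) → Matrix (Fin (r i)) (Fin (r (i + 1))) R} (I : Ideal R)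
    (c : ℕ) (h : r (c + 1) = 0) (v : Fin (r c) → R) : v ∈ Bd A I c ↔ ∀ j, v j ∈ I := by
  have : IsEmpty (Fin (r (c + 1))) := by rw [h]; infer_instance
  have h0 : ∀ (w : Fin (r (c + 1)) → R) j, ((A c).mulVec w) j = 0 := by
    intro w j
    simp [Matrix.mulVec, dotProduct]
  constructor
  · rintro ⟨w, hw⟩ j
    simpa [h0] using hw j
  · intro hv
    exact ⟨0, fun j => by simpa using hv j⟩

lemma cy_of_colon {r : ℕ → ℕ} {A : (i : ℕ) → Matrix (Fin (r i)) (Fin (r (i + 1))) R}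
    (hA : ∀ i j l, A i j l ∈ irrel 𝒜) (I : Ideal R) (c : ℕ) (v : Fin (r c) → R)
    (hv : ∀ j, v j ∈ I.colon (irrel 𝒜 : Set R)) : v ∈ Cy A I c := by
  cases c with
  | zero => trivial
  | succ s =>
    rw [mem_Cy_succ]
    intro j
    unfold Matrix.mulVec dotProduct
    refine Ideal.sum_mem _ fun l _ => ?_
    rw [mul_comm]
    exact Submodule.mem_colon.mp (hv l) _ (hA s j l)

lemma end_eq (hfd : ∀ n, FiniteDimensional k (𝒜 n)) {r : ℕ → ℕ}
    (b : (i : ℕ) → Fin (r i) → ℕ) {A : (i : ℕ) → Matrix (Fin (r i)) (Fin (r (i + 1))) R}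
    (hA : ∀ i j l, A i j l ∈ irrel 𝒜) (I : Ideal R) (c : ℕ) (h : r (c + 1) = 0) (n : ℤ) :
    qd (Zn 𝒜 b A I c n) (Bn 𝒜 b A I c n) = ∑ j, sq 𝒜 I (n - b c j) := by
  have hZ : Zn 𝒜 b A I c n = Submodule.pi Set.univ
      (fun j => (I.colon (irrel 𝒜 : Set R)).restrictScalars k ⊓ zp 𝒜 (n - b c j)) := by
    ext v
    simp only [Submodule.mem_pi, Set.mem_univ, true_imp_iff]
    constructor
    · rintro ⟨hv, hvn⟩ j
      refine ⟨Submodule.mem_colon.mpr fun s hs => ?_, (mem_freePiece 𝒜 _ _ _).mp hvn j⟩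
      have := (bd_last I c h _).mp (hv.2 s hs) j
      rw [smul_eq_mul, mul_comm]
      exact this
    · intro hv
      refine ⟨⟨cy_of_colon 𝒜 hA I c v fun j => (hv j).1, fun y hy => ?_⟩,
        (mem_freePiece 𝒜 _ _ _).mpr fun j => (hv j).2⟩
      refine (bd_last I c h _).mpr fun j => ?_
      have := Submodule.mem_colon.mp (hv j).1 y hy
      rw [smul_eq_mul, mul_comm] at this
      exact this
  have hB : Bn 𝒜 b A I c n = Submodule.pi Set.univ
      (fun j => I.restrictScalars k ⊓ zp 𝒜 (n - b c j)) := by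
    ext v
    simp only [Submodule.mem_pi, Set.mem_univ, true_imp_iff]
    constructor
    · rintro ⟨hv, hvn⟩ j
      exact ⟨(bd_last I c h _).mp hv j, (mem_freePiece 𝒜 _ _ _).mp hvn j⟩
    · intro hv
      exact ⟨(bd_last I c h _).mpr fun j => (hv j).1,
        (mem_freePiece 𝒜 _ _ _).mpr fun j => (hv j).2⟩
  rw [hZ, hB, qd_pi]
  · rfl
  · intro j
    have := fdz 𝒜 hfd (n - b c j)
    exact Submodule.finiteDimensional_of_le inf_le_right

lemma main (h0 : ZeroPieceIsBase 𝒜)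
    (hFT : Algebra.FiniteType k R)
    (hGor : IsGorensteinGraded 𝒜)
    (J : Ideal R) (hart : J.radical = irrel 𝒜)
    (c : ℕ) (r : ℕ → ℕ) (b : (i : ℕ) → Fin (r i) → ℕ)
    (A : (i : ℕ) → Matrix (Fin (r i)) (Fin (r (i + 1))) R)
    (hres : IsMinGradedFreeResolution 𝒜 J c r b A)
    (a : ℤ) (ha : IsAInv 𝒜 (⊥ : Ideal R) a) :
    (∀ i : Fin (r c), (0 : ℤ) ≤ (b c i : ℤ) + a) ∧
    ∀ n : ℕ, socCount 𝒜 J n =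
      (univ.filter fun i : Fin (r c) => (b c i : ℤ) + a = (n : ℤ)).card := by
  have hN : IsNoetherianRing R := Algebra.FiniteType.isNoetherianRing k R
  have hfd := fd 𝒜 h0
  obtain ⟨xs, hreg, hom, hrad, δ, hδ1, hδ0⟩ := hGor
  obtain ⟨x, e, I, hI0, hId, hstep⟩ := exists_seq 𝒜 xs hreg hom
  rw [← hId] at hrad hδ1 hδ0
  have hne : I xs.length ≠ ⊤ := by
    intro h
    apply hreg.top_ne_smul
    rw [show Ideal.ofList xs = ⊤ from hId.symm.trans h]
    simp
  have haeq := a_inv_eq 𝒜 hfd xs.length x e I hI0 hstep hrad hne δ hδ0 a ha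
  have hJne : J ≠ ⊤ := by
    intro h
    rw [h, Ideal.radical_top, ← hrad] at hart
    exact hne (Ideal.radical_eq_top.mp hart.symm)
  have hstart := start_eq 𝒜 J hres
  obtain ⟨hr0, hb0, hrc, hrpos, hA, hAm, hex, -⟩ := hres
  have hcx : IsCx A := fun i v => (hex i).apply_apply_eq_zero v
  have hchain : ∀ i, i ≤ xs.length → Ex A (I i) i ∧ ∀ n : ℤ,
      qd (Zn 𝒜 b A (I i) i (n + ∑ l ∈ range i, (e l : ℤ)))
        (Bn 𝒜 b A (I i) i (n + ∑ l ∈ range i, (e l : ℤ))) = sq 𝒜 J n := by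
    intro i
    induction i with
    | zero =>
      intro _
      rw [hI0]
      refine ⟨?_, fun n => by simpa using hstart n⟩
      intro i _ v hv
      rw [mem_Cy_succ] at hv
      obtain ⟨w, hw⟩ := (hex i v).mp (by
        funext j
        exact hv j)
      refine ⟨w, fun j => ?_⟩
      rw [← hw]
      simp
    | succ i ih =>
      intro hi
      obtain ⟨h1, h2, h3, h4, h5⟩ := hstep i (by omega)
      obtain ⟨hE, hq⟩ := ih (by omega)
      rw [h3]
      refine ⟨ex_step hcx (I i) h5 hE, fun n => ?_⟩
      rw [Finset.sum_range_succ, ← add_assoc,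
        step 𝒜 b hcx hA (I i) h4 h2 (Ideal.subset_span ⟨_, h1, h2⟩) h5 hE, hq]
  obtain ⟨hE, hq⟩ := hchain xs.length le_rfl
  set d := xs.length with hd
  set D : ℤ := ∑ l ∈ range d, (e l : ℤ) with hD
  have hsq : ∀ n : ℤ, sq 𝒜 (I d) n = if n = δ then 1 else 0 := by
    intro n
    rcases lt_or_ge n 0 with hn | hn
    · rw [sq_neg 𝒜 _ hn, if_neg (by omega)]
    · lift n to ℕ using hn
      rw [← socCount_eq 𝒜 hfd]
      split_ifs with h
      · rw [show n = δ by exact_mod_cast h, hδ1]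
      · exact hδ0 n (by exact_mod_cast h)
  have hcd : c ≤ d := by
    by_contra hlt
    have h1 : sq 𝒜 (I d) δ ≠ 0 := by rw [hsq]; simp
    obtain ⟨σ, hσ, hσI⟩ := exists_of_qd_ne_zero _ _ h1
    have hσ' : σ ∉ I d := fun h => hσI ⟨h, hσ.2⟩
    have hcy : (fun _ => σ : Fin (r c) → R) ∈ Cy A (I d) c :=
      cy_of_colon 𝒜 hAm (I d) c _ fun _ => hσ.1
    have hbd : (fun _ => σ : Fin (r c) → R) ∈ Bd A (I d) c := by
      obtain ⟨c', rfl⟩ : ∃ c', c = c' + 1 := ⟨c - 1, by omega⟩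
      exact hE c' (by omega) _ hcy
    exact hσ' ((bd_last (I d) c (hrc _ (by omega)) _).mp hbd ⟨0, hrpos⟩)
  have hdc : d ≤ c := by
    by_contra hlt
    obtain ⟨t, ⟨y, hyt, hyJ⟩, -, hcol⟩ := top_degree 𝒜 J hart hJne
    have h1 : sq 𝒜 J t ≠ 0 := by
      have := hfd t
      have : FiniteDimensional k
        ((J.colon (irrel 𝒜 : Set R)).restrictScalars k ⊓ 𝒜 t : Submodule k R) :=
        Submodule.finiteDimensional_of_le inf_le_right
      rw [sq, zp_natCast]
      exact qd_ne_zero _ _ y ⟨hcol hyt, hyt⟩ (fun h => hyJ h.1)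
    apply h1
    rw [← hq]
    have : IsEmpty (Fin (r d)) := by rw [hrc d (by omega)]; infer_instance
    apply qd_eq_zero_of_le
    intro v _
    rw [Subsingleton.elim v 0]
    exact zero_mem _
  have hcd' : c = d := le_antisymm hcd hdc
  rw [← hcd'] at hq hsq
  have hfinal : ∀ n : ℤ, sq 𝒜 J n =
      (univ.filter fun i : Fin (r c) => (b c i : ℤ) + a = n).card := by
    intro n
    rw [← hq, end_eq 𝒜 hfd b hAm (I c) c (hrc _ (by omega)), Finset.card_filter]
    refine Finset.sum_congr rfl fun j _ => ?_
    rw [hsq]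
    congr 1
    apply propext
    rw [haeq]
    constructor <;> intro h <;> linarith
  refine ⟨fun i => ?_, fun n => ?_⟩
  · by_contra hlt
    have h1 := hfinal ((b c i : ℤ) + a)
    rw [sq_neg 𝒜 _ (by omega)] at h1
    have h2 := Finset.card_eq_zero.mp h1.symm
    have h3 : i ∈ univ.filter fun i' : Fin (r c) => (b c i' : ℤ) + a = (b c i : ℤ) + a := by simp
    rw [h2] at h3
    simp at h3
  · rw [socCount_eq 𝒜 hfd]
    exact hfinal n

end Fin

end SD

/-- **Corollary 1.6.** Let `R → S = R/J` be a surjection of graded `k`-algebras with `S`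
artinian and `R` Gorenstein.  If `S` has finite projective dimension over `R`, with minimal
homogeneous free resolution having back twists `b c 0, …, b c (r c - 1)` in the top
homological degree `c`, then the socle degrees of `S` are `{b c i + a(R)}`. -/
theorem socle_degrees_stmt13
    {k R : Type} [Field k] [CommRing R] [Algebra k R]
    (𝒜 : ℕ → Submodule k R) [GradedAlgebra 𝒜] (h0 : ZeroPieceIsBase 𝒜)
    (hFT : Algebra.FiniteType k R)
    (hGor : IsGorensteinGraded 𝒜)
    (J : Ideal R) (hJ : J.IsHomogeneous 𝒜) (hart : J.radical = irrel 𝒜)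
    (c : ℕ) (r : ℕ → ℕ) (b : (i : ℕ) → Fin (r i) → ℕ)
    (A : (i : ℕ) → Matrix (Fin (r i)) (Fin (r (i + 1))) R)
    (hres : IsMinGradedFreeResolution 𝒜 J c r b A)
    (a : ℤ) (ha : IsAInv 𝒜 (⊥ : Ideal R) a) :
    (∀ i : Fin (r c), (0 : ℤ) ≤ (b c i : ℤ) + a) ∧
    ∀ n : ℕ, socCount 𝒜 J n =
      (univ.filter fun i : Fin (r c) => (b c i : ℤ) + a = (n : ℤ)).card := by
  exact SD.main 𝒜 h0 hFT hGor J hart c r b A hres a ha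
end
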